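/- arXiv:2412.11879 — 4 statements merged into one kernel-verified Lean document; each statement's English description precedes it below -/
import Mathlib

section
/- Let n ≥ 1, let V ⊆ ℝ^n be an n-dimensional simplex, let f₁,…,f_k : ℝ^n → ℝ be affine (degree ≤ 1) polynomials with real coefficients, each positive on the interior of V, and let E : ℂ × ℂ^n → ℂ be analytic on an open set containing ℂ × V (with V ⊆ ℝ^n ⊆ ℂ^n). Then there exists a function F : ℂ → ℂ, meromorphic on all of ℂ, such that: (1) F(s) = ∫_V (f₁(x)⋯f_k(x))^s · E(s,x) dx for every s ∈ ℂ with Re(s) > 0 (the power being the real power of a positive real); (2) F is analytic at every point of ℂ ∖ ℚ; (3) for every s₀ ∈ ℂ the function s ↦ (s−s₀)^n · F(s) is bounded on some punctured neighborhood of s₀, i.e. F has a pole of order at most n at every point. -/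
open Complex MeasureTheory Filter

section SimplexIntegral

/-- A uniformly bounded family of functions depending holomorphically on a parameter has a
holomorphic integral over a finite measure space. -/
lemma differentiableAt_integral_of_norm_le {α : Type*} [MeasurableSpace α] {μ : Measure α}
    [IsFiniteMeasure μ] {F : ℂ → α → ℂ} {s₀ : ℂ} {R C : ℝ} (hR : 0 < R)
    (hmeas : ∀ s, AEStronglyMeasurable (F s) μ)
    (hdiff : ∀ᵐ t ∂μ, DifferentiableOn ℂ (fun s => F s t) (Metric.ball s₀ R))
    (hbound : ∀ᵐ t ∂μ, ∀ s ∈ Metric.ball s₀ R, ‖F s t‖ ≤ C) :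
    DifferentiableAt ℂ (fun s => ∫ t, F s t ∂μ) s₀ := by
  have hsub : ∀ x ∈ Metric.ball s₀ (R / 4), Metric.closedBall x (R / 2) ⊆ Metric.ball s₀ R := by
    intro x hx
    apply Metric.closedBall_subset_ball'
    have := Metric.mem_ball.1 hx
    linarith
  refine (hasDerivAt_integral_of_dominated_loc_of_deriv_le
    (F' := fun s t => deriv (fun s => F s t) s) (bound := fun _ => C / (R / 2))
    (Metric.ball_mem_nhds s₀ (by positivity : 0 < R / 4))
    (Eventually.of_forall hmeas) ?_ ?_ ?_ (integrable_const _) ?_).2.differentiableAt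
  · refine Integrable.of_bound (hmeas s₀) C ?_
    filter_upwards [hbound] with t ht using ht s₀ (Metric.mem_ball_self hR)
  · refine aestronglyMeasurable_of_tendsto_ae (nhdsWithin s₀ {s₀}ᶜ)
      (f := fun s t => (s - s₀)⁻¹ • (F s t - F s₀ t)) (fun s => ?_) ?_
    · exact ((hmeas s).sub (hmeas s₀)).const_smul ((s - s₀)⁻¹)
    · filter_upwards [hdiff] with t ht
      have h := (ht.differentiableAt (Metric.ball_mem_nhds s₀ hR)).hasDerivAt
      exact hasDerivAt_iff_tendsto_slope.1 h
  · filter_upwards [hdiff, hbound] with t ht hb x hx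
    refine norm_deriv_le_of_forall_mem_sphere_norm_le (by positivity) ?_ fun z hz =>
      hb z (hsub x hx (Metric.sphere_subset_closedBall hz))
    exact (ht.mono (hsub x hx)).diffContOnCl_ball (Set.Subset.refl _)
  · filter_upwards [hdiff] with t ht x hx
    exact (ht.differentiableAt (Metric.isOpen_ball.mem_nhds
      (Metric.ball_subset_ball (by linarith) hx))).hasDerivAt

/-- The uniform probability measure on the open unit cube. -/
noncomputable def cubeMeasure (n : ℕ) : Measure (Fin n → ℝ) :=
  Measure.pi fun _ => volume.restrict (Set.Ioo 0 1)

instance : IsProbabilityMeasure (volume.restrict (Set.Ioo (0 : ℝ) 1)) :=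
  ⟨by simp⟩

instance (n : ℕ) : IsProbabilityMeasure (cubeMeasure n) := by
  unfold cubeMeasure; infer_instance

lemma cubeMeasure_eq (n : ℕ) :
    cubeMeasure n = volume.restrict (Set.univ.pi fun _ => Set.Ioo 0 1) := by
  rw [cubeMeasure, volume_pi, Measure.restrict_pi_pi]

lemma measurableSet_openCube (n : ℕ) :
    MeasurableSet (Set.univ.pi fun _ : Fin n => Set.Ioo (0 : ℝ) 1) :=
  MeasurableSet.univ_pi fun _ => measurableSet_Ioo

lemma ae_cubeMeasure (n : ℕ) : ∀ᵐ t ∂cubeMeasure n, ∀ l, t l ∈ Set.Ioo (0 : ℝ) 1 := by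
  rw [cubeMeasure_eq]
  filter_upwards [ae_restrict_mem (measurableSet_openCube n)] with t ht l using ht l trivial

/-- `G` is analytic at all points of `ℂ × [0,1]^n`. -/
def AnalyticOnCube {n : ℕ} (G : ℂ × (Fin n → ℂ) → ℂ) : Prop :=
  ∀ (s : ℂ) (t : Fin n → ℝ), (∀ l, t l ∈ Set.Icc (0 : ℝ) 1) →
    AnalyticAt ℂ G (s, fun i => (t i : ℂ))

/-- The integrand of a multivariate Mellin integral. -/
noncomputable def mellinIntegrand {n : ℕ} (a b : Fin n → ℕ) (G : ℂ × (Fin n → ℂ) → ℂ) (s : ℂ)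
    (t : Fin n → ℝ) : ℂ :=
  (∏ l, (t l : ℂ) ^ ((a l : ℂ) * s + b l)) * G (s, fun i => (t i : ℂ))

/-- The multivariate Mellin integral over the unit cube. -/
noncomputable def mellinIntegral {n : ℕ} (a b : Fin n → ℕ) (G : ℂ × (Fin n → ℂ) → ℂ) (s : ℂ) : ℂ :=
  ∫ t, mellinIntegrand a b G s t ∂cubeMeasure n

lemma continuous_ofReal_pi {n : ℕ} (s : ℂ) :
    Continuous fun t : Fin n → ℝ => ((s, fun i => (t i : ℂ)) : ℂ × (Fin n → ℂ)) := by
  fun_prop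

variable {n : ℕ} {a b : Fin n → ℕ} {G : ℂ × (Fin n → ℂ) → ℂ}

lemma aestronglyMeasurable_mellinIntegrand (hG : AnalyticOnCube G) (s : ℂ) :
    AEStronglyMeasurable (mellinIntegrand a b G s) (cubeMeasure n) := by
  rw [cubeMeasure_eq]
  refine ContinuousOn.aestronglyMeasurable ?_ (measurableSet_openCube n)
  intro t ht
  have ht' : ∀ l, t l ∈ Set.Ioo (0 : ℝ) 1 := fun l => ht l trivial
  refine ContinuousAt.continuousWithinAt (ContinuousAt.mul ?_ ?_)
  · refine tendsto_finsetProd _ fun l _ => ?_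
    have : Continuous fun t : Fin n → ℝ => (t l : ℂ) := by fun_prop
    exact this.continuousAt.cpow continuousAt_const (Or.inl (by simpa using (ht' l).1))
  · exact ContinuousAt.comp (f := fun t : Fin n → ℝ => ((s, fun i => (t i : ℂ)) : ℂ × (Fin n → ℂ)))
      (hG s t fun l => Set.Ioo_subset_Icc_self (ht' l)).continuousAt
      (continuous_ofReal_pi s).continuousAt

lemma norm_mellinIntegrand_le {s : ℂ} (hs : ∀ l, 0 ≤ a l * s.re + b l) {t : Fin n → ℝ}
    (ht : ∀ l, t l ∈ Set.Ioo (0 : ℝ) 1) :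
    ‖mellinIntegrand a b G s t‖ ≤ ‖G (s, fun i => (t i : ℂ))‖ := by
  rw [mellinIntegrand, norm_mul, norm_prod]
  refine mul_le_of_le_one_left (norm_nonneg _) (Finset.prod_le_one (fun _ _ => norm_nonneg _) ?_)
  intro l _
  rw [norm_cpow_eq_rpow_re_of_pos (ht l).1]
  refine Real.rpow_le_one (ht l).1.le (ht l).2.le ?_
  simpa using hs l

lemma AnalyticOnCube.exists_norm_le (hG : AnalyticOnCube G) {K : Set ℂ} (hK : IsCompact K) :
    ∃ C, ∀ s ∈ K, ∀ t : Fin n → ℝ, (∀ l, t l ∈ Set.Icc (0 : ℝ) 1) →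
      ‖G (s, fun i => (t i : ℂ))‖ ≤ C := by
  have hc : IsCompact (K ×ˢ Set.univ.pi fun _ : Fin n => Set.Icc (0 : ℝ) 1) :=
    hK.prod (isCompact_univ_pi fun _ => isCompact_Icc)
  obtain ⟨C, hC⟩ := hc.exists_bound_of_continuousOn
    (f := fun p : ℂ × (Fin n → ℝ) => G (p.1, fun i => (p.2 i : ℂ))) (by
      rintro ⟨s, t⟩ ⟨_, ht⟩
      refine ContinuousAt.continuousWithinAt ?_
      exact ContinuousAt.comp
        (f := fun p : ℂ × (Fin n → ℝ) => ((p.1, fun i => (p.2 i : ℂ)) : ℂ × (Fin n → ℂ)))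
        (hG s t fun l => ht l trivial).continuousAt (by fun_prop))
  exact ⟨C, fun s hs t ht => hC (s, t) ⟨hs, fun l _ => ht l⟩⟩

lemma integrable_mellinIntegrand (hG : AnalyticOnCube G) {s : ℂ}
    (hs : ∀ l, 0 ≤ a l * s.re + b l) : Integrable (mellinIntegrand a b G s) (cubeMeasure n) := by
  obtain ⟨C, hC⟩ := hG.exists_norm_le (isCompact_singleton (x := s))
  refine Integrable.of_bound (aestronglyMeasurable_mellinIntegrand hG s) C ?_
  filter_upwards [ae_cubeMeasure n] with t ht
  exact (norm_mellinIntegrand_le hs ht).trans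
    (hC s rfl t fun l => Set.Ioo_subset_Icc_self (ht l))

lemma isOpen_iInter_re_pos (a b : Fin n → ℕ) : IsOpen {s : ℂ | ∀ l, 0 < a l * s.re + b l} := by
  simp only [Set.ofPred_forall]
  exact isOpen_iInter_of_finite fun l => isOpen_lt continuous_const (by fun_prop)

lemma differentiableOn_mellinIntegral (hG : AnalyticOnCube G) :
    DifferentiableOn ℂ (mellinIntegral a b G) {s | ∀ l, 0 < a l * s.re + b l} := by
  intro s₀ hs₀
  refine DifferentiableAt.differentiableWithinAt ?_
  obtain ⟨R, hR, hRs⟩ := Metric.isOpen_iff.1 (isOpen_iInter_re_pos a b) s₀ hs₀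
  obtain ⟨C, hC⟩ := hG.exists_norm_le (isCompact_closedBall s₀ R)
  refine differentiableAt_integral_of_norm_le hR (C := C)
    (aestronglyMeasurable_mellinIntegrand hG) ?_ ?_
  · filter_upwards [ae_cubeMeasure n] with t ht s _
    refine DifferentiableAt.differentiableWithinAt (DifferentiableAt.mul ?_ ?_)
    · refine DifferentiableAt.fun_finsetProd fun l _ => ?_
      refine DifferentiableAt.const_cpow (by fun_prop) (Or.inl ?_)
      simpa using (ht l).1.ne'
    · exact DifferentiableAt.comp s (f := fun s : ℂ => ((s, fun i => (t i : ℂ)) : ℂ × (Fin n → ℂ)))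
        (hG s t fun l => Set.Ioo_subset_Icc_self (ht l)).differentiableAt (by fun_prop)
  · filter_upwards [ae_cubeMeasure n] with t ht s hs
    exact (norm_mellinIntegrand_le (fun l => (hRs hs l).le) ht).trans
      (hC s (Metric.ball_subset_closedBall hs) t fun l => Set.Ioo_subset_Icc_self (ht l))

lemma integral_cubeMeasure_succ {m : ℕ} (l : Fin (m + 1)) {h : (Fin (m + 1) → ℝ) → ℂ}
    (hi : Integrable h (cubeMeasure (m + 1))) :
    ∫ t, h t ∂cubeMeasure (m + 1) =
      ∫ t, (∫ u in Set.Ioo (0 : ℝ) 1, h (l.insertNth u t)) ∂cubeMeasure m := by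
  have hp := (measurePreserving_piFinSuccAbove
    (fun _ : Fin (m + 1) => volume.restrict (Set.Ioo (0 : ℝ) 1)) l).symm
  have hi' := (hp.integrable_comp_emb (MeasurableEquiv.measurableEmbedding _)).2 hi
  rw [cubeMeasure, ← hp.integral_comp (MeasurableEquiv.measurableEmbedding _)]
  exact integral_prod_symm _ hi'

/-- The Fréchet derivative of `G` in the direction of the `l`-th cube coordinate. -/
noncomputable def partialDeriv (l : Fin n) (G : ℂ × (Fin n → ℂ) → ℂ) : ℂ × (Fin n → ℂ) → ℂ :=
  fun p => fderiv ℂ G p (0, Pi.single l 1)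

/-- The function `2 G` restricted to the face `t l = 1`, extended constantly along `l`. -/
noncomputable def faceValue (l : Fin n) (G : ℂ × (Fin n → ℂ) → ℂ) : ℂ × (Fin n → ℂ) → ℂ :=
  fun p => 2 * G (p.1, Function.update p.2 l 1)

lemma AnalyticOnCube.partialDeriv (hG : AnalyticOnCube G) (l : Fin n) :
    AnalyticOnCube (partialDeriv l G) := fun s t ht =>
  (ContinuousLinearMap.apply ℂ ℂ ((0, Pi.single l 1) : ℂ × (Fin n → ℂ))).analyticAt _ |>.comp
    (hG s t ht).fderiv

lemma update_ofReal (t : Fin n → ℝ) (l : Fin n) (u : ℝ) :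
    Function.update (fun i => (t i : ℂ)) l (u : ℂ) = fun i => (Function.update t l u i : ℂ) := by
  ext i
  by_cases h : i = l
  · subst h; simp
  · simp [h]

lemma AnalyticOnCube.faceValue (hG : AnalyticOnCube G) (l : Fin n) :
    AnalyticOnCube (faceValue l G) := by
  intro s t ht
  refine analyticAt_const.mul ?_
  refine AnalyticAt.comp (g := G)
    (f := fun p : ℂ × (Fin n → ℂ) => (p.1, Function.update p.2 l 1)) ?_ ?_
  · have := update_ofReal t l 1
    rw [ofReal_one] at this
    simp only [this]
    refine hG s _ fun i => ?_
    by_cases h : i = l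
    · subst h; simp
    · simpa [h] using ht i
  · refine analyticAt_fst.prod (AnalyticAt.pi fun i => ?_)
    by_cases h : i = l
    · subst h; simpa using analyticAt_const
    · simp only [Function.update_of_ne h]
      exact ((ContinuousLinearMap.proj (R := ℂ) (φ := fun _ : Fin n => ℂ) i).analyticAt _).comp
        analyticAt_snd

/-- One-dimensional integration by parts against a power. -/
lemma integral_cpow_mul_by_parts {z : ℂ} (hz : 0 ≤ z.re) {g g' : ℝ → ℂ}
    (hg : ∀ u ∈ Set.Icc (0 : ℝ) 1, HasDerivAt g (g' u) u)
    (hg' : ContinuousOn g' (Set.Icc 0 1)) :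
    ∫ u in Set.Ioo (0 : ℝ) 1, (z + 1) * ((u : ℂ) ^ z * g u) =
      ∫ u in Set.Ioo (0 : ℝ) 1, ((u : ℂ) * (2 * g 1) - (u : ℂ) ^ (z + 1) * g' u) := by
  have hz1 : z + 1 ≠ 0 := fun h => by
    have := congrArg re h
    simp at this; linarith
  have hgc : ContinuousOn g (Set.Icc 0 1) := fun u hu => (hg u hu).continuousAt.continuousWithinAt
  have hpow1 : Continuous fun u : ℝ => (u : ℂ) ^ (z + 1) :=
    continuous_ofReal_cpow_const (by simp; linarith)
  have hderiv : ∀ u ∈ Set.Ioo (0 : ℝ) 1, HasDerivAt (fun u : ℝ => (u : ℂ) ^ (z + 1) * g u)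
      ((z + 1) * ((u : ℂ) ^ z * g u) + (u : ℂ) ^ (z + 1) * g' u) u := by
    intro u hu
    refine ((hasDerivAt_ofReal_cpow_const hu.1.ne' hz1).mul
      (hg u (Set.Ioo_subset_Icc_self hu))).congr_deriv ?_
    rw [add_sub_cancel_right]; ring
  have hbdd : ∀ h : ℝ → ℂ, ContinuousOn h (Set.Icc 0 1) →
      IntegrableOn (fun u : ℝ => (u : ℂ) ^ z * h u) (Set.Ioo 0 1) := by
    intro h hh
    obtain ⟨C, hC⟩ := isCompact_Icc.exists_bound_of_continuousOn hh
    refine Integrable.of_bound (C := C) ?_ ?_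
    · refine ContinuousOn.aestronglyMeasurable ?_ measurableSet_Ioo
      refine ContinuousOn.mul (fun u hu => ?_) (hh.mono Set.Ioo_subset_Icc_self)
      exact (continuous_ofReal.continuousAt.cpow continuousAt_const
        (Or.inl (by simpa using hu.1))).continuousWithinAt
    · filter_upwards [ae_restrict_mem measurableSet_Ioo] with u hu
      rw [norm_mul, norm_cpow_eq_rpow_re_of_pos hu.1]
      exact (mul_le_of_le_one_left (norm_nonneg _) (Real.rpow_le_one hu.1.le hu.2.le hz)).trans
        (hC u (Set.Ioo_subset_Icc_self hu))
  have hi1 : IntegrableOn (fun u : ℝ => (z + 1) * ((u : ℂ) ^ z * g u)) (Set.Ioo 0 1) :=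
    (hbdd g hgc).const_mul _
  have hi2 : IntegrableOn (fun u : ℝ => (u : ℂ) ^ (z + 1) * g' u) (Set.Ioo 0 1) :=
    ((hpow1.continuousOn.mul hg').integrableOn_Icc).mono_set Set.Ioo_subset_Icc_self
  have hi3 : IntegrableOn (fun u : ℝ => (u : ℂ) * (2 * g 1)) (Set.Ioo 0 1) :=
    (Continuous.integrableOn_Icc (by fun_prop)).mono_set Set.Ioo_subset_Icc_self
  have hftc := intervalIntegral.integral_eq_sub_of_hasDerivAt_of_le zero_le_one
    (hpow1.continuousOn.mul hgc) hderiv (by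
      rw [intervalIntegrable_iff_integrableOn_Ioo_of_le zero_le_one]
      exact hi1.add hi2)
  have hlin : ∫ u in Set.Ioo (0 : ℝ) 1, (u : ℂ) * (2 * g 1) = g 1 := by
    rw [integral_mul_const, ← integral_Ioc_eq_integral_Ioo,
      ← intervalIntegral.integral_of_le zero_le_one, intervalIntegral.integral_ofReal]
    simp
  rw [intervalIntegral.integral_of_le zero_le_one, integral_Ioc_eq_integral_Ioo,
    integral_add hi1 hi2] at hftc
  rw [integral_sub hi3 hi2, hlin, eq_sub_iff_add_eq, hftc]
  simp [zero_cpow hz1]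

lemma mellinIntegral_by_parts (hG : AnalyticOnCube G) (l : Fin n) {s : ℂ} (hs : 0 < s.re) :
    ((a l : ℂ) * s + b l + 1) * mellinIntegral a b G s =
      mellinIntegral (Function.update a l 0) (Function.update b l 1) (faceValue l G) s -
        mellinIntegral a (Function.update b l (b l + 1)) (partialDeriv l G) s := by
  obtain ⟨m, rfl⟩ : ∃ m, n = m + 1 := ⟨n - 1, by have := l.pos; omega⟩
  have hnn : ∀ (a b : Fin (m + 1) → ℕ) (i), 0 ≤ a i * s.re + b i := fun a b i => by positivity
  have hi1 := (integrable_mellinIntegrand hG (hnn a b)).const_mul ((a l : ℂ) * s + b l + 1)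
  have hi2 := integrable_mellinIntegrand (hG.faceValue l)
    (hnn (Function.update a l 0) (Function.update b l 1))
  have hi3 := integrable_mellinIntegrand (hG.partialDeriv l)
    (hnn a (Function.update b l (b l + 1)))
  simp only [mellinIntegral]
  rw [← integral_const_mul, ← integral_sub' hi2 hi3, integral_cubeMeasure_succ l hi1,
    integral_cubeMeasure_succ l (hi2.sub hi3)]
  refine integral_congr_ae ?_
  filter_upwards [ae_cubeMeasure m] with t ht
  have hmem : ∀ u ∈ Set.Icc (0 : ℝ) 1, ∀ i, (l.insertNth u t : Fin (m + 1) → ℝ) i ∈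
      Set.Icc (0 : ℝ) 1 := by
    intro u hu i
    induction i using l.succAboveCases with
    | x => simpa using hu
    | p i => simpa using Set.Ioo_subset_Icc_self (ht i)
  set g : ℝ → ℂ := fun u => G (s, fun i => ((l.insertNth u t : Fin (m + 1) → ℝ) i : ℂ)) with hgdef
  set g' : ℝ → ℂ := fun u =>
    partialDeriv l G (s, fun i => ((l.insertNth u t : Fin (m + 1) → ℝ) i : ℂ)) with hgdef'
  set P : ℂ := ∏ i : Fin m, (t i : ℂ) ^ ((a (l.succAbove i) : ℂ) * s + b (l.succAbove i)) with hP
  have hpath : ∀ u : ℝ, HasDerivAt (fun u : ℝ =>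
      ((s, fun i => ((l.insertNth u t : Fin (m + 1) → ℝ) i : ℂ)) : ℂ × (Fin (m + 1) → ℂ)))
      (0, Pi.single l 1) u := by
    intro u
    refine (hasDerivAt_const _ _).prodMk (hasDerivAt_pi.2 fun i => ?_)
    induction i using l.succAboveCases with
    | x => simpa using (hasDerivAt_id u).ofReal_comp
    | p i => simpa using hasDerivAt_const _ _
  have hg : ∀ u ∈ Set.Icc (0 : ℝ) 1, HasDerivAt g (g' u) u := fun u hu => by
    have h := (hG s _ (hmem u hu)).differentiableAt.hasFDerivAt.restrictScalars ℝ
    exact h.comp_hasDerivAt u (hpath u)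
  have hg' : ContinuousOn g' (Set.Icc 0 1) := fun u hu =>
    (ContinuousAt.comp (f := fun u : ℝ =>
      ((s, fun i => ((l.insertNth u t : Fin (m + 1) → ℝ) i : ℂ)) : ℂ × (Fin (m + 1) → ℂ)))
      (hG.partialDeriv l s _ (hmem u hu)).continuousAt (hpath u).continuousAt).continuousWithinAt
  have key := integral_cpow_mul_by_parts (z := (a l : ℂ) * s + b l)
    (by simpa using hnn a b l) hg hg'
  have hface : ∀ u : ℝ, faceValue l G
      (s, fun i => ((l.insertNth u t : Fin (m + 1) → ℝ) i : ℂ)) = 2 * g 1 := by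
    intro u
    have := update_ofReal (l.insertNth u t : Fin (m + 1) → ℝ) l 1
    rw [ofReal_one] at this
    simp [faceValue, hgdef, this]
  calc _ = ∫ u in Set.Ioo (0 : ℝ) 1, P * ((((a l : ℂ) * s + b l) + 1) *
          ((u : ℂ) ^ ((a l : ℂ) * s + b l) * g u)) := by
        refine integral_congr_ae (Eventually.of_forall fun u => ?_)
        simp only [mellinIntegrand, Fin.prod_univ_succAbove _ l, Fin.insertNth_apply_same,
          Fin.insertNth_apply_succAbove]
        ring
    _ = ∫ u in Set.Ioo (0 : ℝ) 1, P * ((u : ℂ) * (2 * g 1) -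
          (u : ℂ) ^ ((a l : ℂ) * s + b l + 1) * g' u) := by
        rw [integral_const_mul, key, integral_const_mul]
    _ = _ := by
        refine integral_congr_ae (Eventually.of_forall fun u => ?_)
        simp only [mellinIntegrand, Fin.prod_univ_succAbove _ l, Fin.insertNth_apply_same,
          Fin.insertNth_apply_succAbove, hface, Pi.sub_apply, Function.update_self,
          Function.update_of_ne (Fin.succAbove_ne l _)]
        simp only [Nat.cast_zero, zero_mul, zero_add, Nat.cast_one, cpow_one, Nat.cast_add,
          ← add_assoc]
        rw [← hP]
        ring

/-- The factor `∏_{k < M} (a s + b + k + 1)` removed by `M` integrations by parts. -/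
noncomputable def poleFactor (a b M : ℕ) (s : ℂ) : ℂ :=
  ∏ k ∈ Finset.range M, ((a : ℂ) * s + b + k + 1)

lemma poleFactor_succ (a b M : ℕ) (s : ℂ) :
    poleFactor a b (M + 1) s = poleFactor a (b + 1) M s * ((a : ℂ) * s + b + 1) := by
  rw [poleFactor, Finset.prod_range_succ', poleFactor]
  congr 1
  · refine Finset.prod_congr rfl fun k _ => ?_
    push_cast; ring
  · simp

lemma differentiable_poleFactor (a b M : ℕ) : Differentiable ℂ (poleFactor a b M) := by
  unfold poleFactor
  fun_prop

lemma prod_update_poleFactor (a b M : Fin n → ℕ) (l : Fin n) (x y z : ℕ) (s : ℂ) :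
    ∏ i, poleFactor (Function.update a l x i) (Function.update b l y i)
      (Function.update M l z i) s =
    poleFactor x y z s * ∏ i ∈ Finset.univ.erase l, poleFactor (a i) (b i) (M i) s := by
  rw [← Finset.mul_prod_erase _ _ (Finset.mem_univ l)]
  simp only [Function.update_self]
  congr 1
  refine Finset.prod_congr rfl fun i hi => ?_
  simp only [Function.update_of_ne (Finset.ne_of_mem_erase hi)]

/-- After clearing the pole factors, the Mellin integral extends holomorphically to a larger
half-plane. -/
lemma exists_continuation_mellinIntegral (K : ℕ) : ∀ (a b M : Fin n → ℕ)
    (G : ℂ × (Fin n → ℂ) → ℂ), AnalyticOnCube G → ∑ l, M l ≤ K →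
    ∃ H : ℂ → ℂ, DifferentiableOn ℂ H {s | ∀ l, 0 < a l * s.re + b l + M l} ∧
      ∀ s : ℂ, 0 < s.re → (∏ l, poleFactor (a l) (b l) (M l) s) * mellinIntegral a b G s = H s := by
  have base : ∀ (a b M : Fin n → ℕ) (G : ℂ × (Fin n → ℂ) → ℂ), AnalyticOnCube G →
      (∀ l, M l = 0) →
      ∃ H : ℂ → ℂ, DifferentiableOn ℂ H {s | ∀ l, 0 < a l * s.re + b l + M l} ∧
        ∀ s : ℂ, 0 < s.re →
          (∏ l, poleFactor (a l) (b l) (M l) s) * mellinIntegral a b G s = H s := by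
    intro a b M G hG hM0
    refine ⟨mellinIntegral a b G, ?_, fun s _ => ?_⟩
    · simpa [hM0] using differentiableOn_mellinIntegral hG
    · simp [hM0, poleFactor]
  induction K with
  | zero => exact fun a b M G hG hM => base a b M G hG (by simpa using hM)
  | succ K ih =>
    intro a b M G hG hM
    by_cases hM0 : ∀ l, M l = 0
    · exact base a b M G hG hM0
    obtain ⟨l, hl⟩ := not_forall.1 hM0
    obtain ⟨N, hN⟩ := Nat.exists_eq_succ_of_ne_zero hl
    have hsum : ∀ x, ∑ i, Function.update M l x i = x + ∑ i ∈ Finset.univ.erase l, M i := by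
      intro x
      rw [← Finset.add_sum_erase _ _ (Finset.mem_univ l), Function.update_self]
      congr 1
      exact Finset.sum_congr rfl fun i hi => Function.update_of_ne (Finset.ne_of_mem_erase hi) _ _
    rw [← Finset.add_sum_erase _ _ (Finset.mem_univ l), hN] at hM
    obtain ⟨H₁, hd₁, he₁⟩ := ih (Function.update a l 0) (Function.update b l 1)
      (Function.update M l 0) _ (hG.faceValue l) (by rw [hsum]; omega)
    obtain ⟨H₂, hd₂, he₂⟩ := ih a (Function.update b l (b l + 1))
      (Function.update M l N) _ (hG.partialDeriv l) (by rw [hsum]; omega)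
    refine ⟨fun s => poleFactor (a l) (b l + 1) N s * H₁ s - H₂ s,
      DifferentiableOn.sub (DifferentiableOn.mul
        (differentiable_poleFactor _ _ _).differentiableOn (hd₁.mono ?_)) (hd₂.mono ?_), ?_⟩
    · intro s hs i
      by_cases h : i = l
      · subst h; simp
      · simpa [h] using hs i
    · intro s hs i
      by_cases h : i = l
      · subst h
        have := hs i
        rw [hN] at this
        push_cast [Function.update_self] at this ⊢
        linarith
      · simpa [h] using hs i
    · intro s hs
      have h₁ := he₁ s hs
      have h₂ := he₂ s hs
      rw [prod_update_poleFactor] at h₁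
      have h := prod_update_poleFactor a b M l (a l) (b l + 1) N s
      rw [Function.update_eq_self] at h
      rw [h] at h₂
      have h0 := prod_update_poleFactor a b M l (a l) (b l) (M l) s
      simp only [Function.update_eq_self] at h0
      have hp : poleFactor 0 1 0 s = 1 := by simp [poleFactor]
      rw [h0, hN, poleFactor_succ]
      beta_reduce
      rw [← h₁, ← h₂, hp]
      linear_combination poleFactor (a l) (b l + 1) N s *
        (∏ i ∈ Finset.univ.erase l, poleFactor (a i) (b i) (M i) s) *
        mellinIntegral_by_parts (a := a) (b := b) hG l hs

/-- `I` extends from the right half-plane to a meromorphic function on `ℂ` whose poles are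
rational and of order at most `n`. -/
def HasMeromorphicContinuation (n : ℕ) (I : ℂ → ℂ) : Prop :=
  ∃ F : ℂ → ℂ, (∀ z : ℂ, MeromorphicAt F z) ∧ (∀ s : ℂ, 0 < s.re → F s = I s) ∧
    (∀ s : ℂ, s ∉ Set.range ((↑) : ℚ → ℂ) → AnalyticAt ℂ F s) ∧
    (∀ s₀ : ℂ, ∃ C : ℝ, ∀ᶠ s in nhdsWithin s₀ {s₀}ᶜ, ‖(s - s₀) ^ n * F s‖ ≤ C)

lemma HasMeromorphicContinuation.congr {I J : ℂ → ℂ} (h : HasMeromorphicContinuation n I)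
    (hIJ : ∀ s : ℂ, 0 < s.re → I s = J s) : HasMeromorphicContinuation n J := by
  obtain ⟨F, h₁, h₂, h₃, h₄⟩ := h
  exact ⟨F, h₁, fun s hs => (h₂ s hs).trans (hIJ s hs), h₃, h₄⟩

lemma HasMeromorphicContinuation.add {I J : ℂ → ℂ} (hI : HasMeromorphicContinuation n I)
    (hJ : HasMeromorphicContinuation n J) : HasMeromorphicContinuation n fun s => I s + J s := by
  obtain ⟨F, h₁, h₂, h₃, h₄⟩ := hI
  obtain ⟨F', h₁', h₂', h₃', h₄'⟩ := hJ
  refine ⟨F + F', fun z => (h₁ z).add (h₁' z), fun s hs => ?_,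
    fun s hs => (h₃ s hs).add (h₃' s hs), fun s₀ => ?_⟩
  · simp [h₂ s hs, h₂' s hs]
  · obtain ⟨C, hC⟩ := h₄ s₀
    obtain ⟨C', hC'⟩ := h₄' s₀
    refine ⟨C + C', ?_⟩
    filter_upwards [hC, hC'] with s hs hs'
    rw [Pi.add_apply, mul_add]
    exact (norm_add_le _ _).trans (add_le_add hs hs')

lemma linearFactor_ne_zero_of_re_pos (a b k : ℕ) {s : ℂ} (hs : 0 < s.re) :
    (a : ℂ) * s + b + k + 1 ≠ 0 := by
  intro h
  have := congrArg re h
  simp at this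
  have : 0 ≤ (a : ℝ) * s.re := by positivity
  have : (0 : ℝ) ≤ b := by positivity
  have : (0 : ℝ) ≤ k := by positivity
  linarith

lemma poleFactor_ne_zero_of_re_pos (a b M : ℕ) {s : ℂ} (hs : 0 < s.re) :
    poleFactor a b M s ≠ 0 :=
  Finset.prod_ne_zero_iff.2 fun k _ => linearFactor_ne_zero_of_re_pos a b k hs

lemma poleFactor_ne_zero_of_le {a b M M' : ℕ} (h : M ≤ M') {s : ℂ}
    (hs : poleFactor a b M' s ≠ 0) : poleFactor a b M s ≠ 0 :=
  Finset.prod_ne_zero_iff.2 fun k hk =>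
    Finset.prod_ne_zero_iff.1 hs k (Finset.range_subset_range.2 h hk)

lemma poleFactor_ne_zero_of_not_rat (a b M : ℕ) {s : ℂ}
    (hs : s ∉ Set.range ((↑) : ℚ → ℂ)) : poleFactor a b M s ≠ 0 := by
  refine Finset.prod_ne_zero_iff.2 fun k _ h => ?_
  have ha : (a : ℂ) ≠ 0 := by
    intro ha
    rw [ha] at h
    have : ((b + k + 1 : ℕ) : ℂ) = 0 := by push_cast; linear_combination h
    exact absurd (Nat.cast_eq_zero.1 this) (by omega)
  refine hs ⟨-(b + k + 1) / a, ?_⟩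
  push_cast
  rw [div_eq_iff ha]
  linear_combination -h

/-- The zeros of a pole factor are isolated and simple. -/
lemma exists_continuousAt_div_poleFactor (a b M : ℕ) (s₀ : ℂ) :
    ∃ g : ℂ → ℂ, ContinuousAt g s₀ ∧ ∀ᶠ s in nhdsWithin s₀ {s₀}ᶜ,
      poleFactor a b M s ≠ 0 ∧ (s - s₀) / poleFactor a b M s = g s := by
  by_cases h : poleFactor a b M s₀ = 0
  · obtain ⟨k₀, hk₀, h0⟩ := Finset.prod_eq_zero_iff.1 h
    have ha : (a : ℂ) ≠ 0 := by
      intro ha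
      rw [ha] at h0
      have : ((b + k₀ + 1 : ℕ) : ℂ) = 0 := by push_cast; linear_combination h0
      exact absurd (Nat.cast_eq_zero.1 this) (by omega)
    set Q : ℂ → ℂ := fun s => ∏ k ∈ (Finset.range M).erase k₀, ((a : ℂ) * s + b + k + 1) with hQ
    have hQc : Continuous Q := by fun_prop
    have hQ0 : Q s₀ ≠ 0 := by
      refine Finset.prod_ne_zero_iff.2 fun k hk hz => Finset.ne_of_mem_erase hk ?_
      have : (k : ℂ) = k₀ := by linear_combination hz - h0
      exact_mod_cast this
    refine ⟨fun s => (a * Q s)⁻¹, ContinuousAt.inv₀ (by fun_prop) (mul_ne_zero ha hQ0), ?_⟩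
    filter_upwards [self_mem_nhdsWithin, nhdsWithin_le_nhds (hQc.continuousAt.eventually_ne hQ0)]
      with s hs hQs
    have hs' : s - s₀ ≠ 0 := sub_ne_zero.2 hs
    have hfac : poleFactor a b M s = a * (s - s₀) * Q s := by
      rw [poleFactor, ← Finset.mul_prod_erase _ _ hk₀]
      congr 1
      linear_combination h0
    rw [hfac]
    exact ⟨mul_ne_zero (mul_ne_zero ha hs') hQs, by field_simp⟩
  · have hc := (differentiable_poleFactor a b M).continuous
    refine ⟨fun s => (s - s₀) / poleFactor a b M s,
      ContinuousAt.div (by fun_prop) hc.continuousAt h, ?_⟩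
    filter_upwards [nhdsWithin_le_nhds (hc.continuousAt.eventually_ne h)] with s hs
    exact ⟨hs, rfl⟩

theorem hasMeromorphicContinuation_mellinIntegral (a b : Fin n → ℕ) (hG : AnalyticOnCube G) :
    HasMeromorphicContinuation n (mellinIntegral a b G) := by
  set D : ℕ → ℂ → ℂ := fun N s => ∏ l, poleFactor (a l) (b l) (a l * N + 1) s with hD
  have hDd : ∀ N, Differentiable ℂ (D N) := fun N =>
    Differentiable.fun_finsetProd fun l _ => differentiable_poleFactor _ _ _
  have hDpos : ∀ N s, 0 < s.re → D N s ≠ 0 := fun N s hs =>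
    Finset.prod_ne_zero_iff.2 fun l _ => poleFactor_ne_zero_of_re_pos _ _ _ hs
  have hDle : ∀ {N N'} s, N ≤ N' → D N' s ≠ 0 → D N s ≠ 0 := fun {N N'} s h hs =>
    Finset.prod_ne_zero_iff.2 fun l hl =>
      poleFactor_ne_zero_of_le (by gcongr) (Finset.prod_ne_zero_iff.1 hs l hl)
  set R : ℕ → Set ℂ := fun N => {s | -(N : ℝ) < s.re} with hR
  have hRo : ∀ N, IsOpen (R N) := fun N => isOpen_lt continuous_const continuous_re
  have hex : ∀ N : ℕ, ∃ H : ℂ → ℂ, DifferentiableOn ℂ H (R N) ∧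
      ∀ s : ℂ, 0 < s.re → D N s * mellinIntegral a b G s = H s := by
    intro N
    obtain ⟨H, hd, he⟩ := exists_continuation_mellinIntegral _ a b (fun l => a l * N + 1) G hG le_rfl
    refine ⟨H, hd.mono fun s hs l => ?_, he⟩
    have hs' : 0 ≤ s.re + N := by
      have : -(N : ℝ) < s.re := hs
      linarith
    have h1 : 0 ≤ (a l : ℝ) * (s.re + N) := by positivity
    have h2 : (0 : ℝ) ≤ b l := by positivity
    push_cast
    linarith
  choose H hHd hHe using hex
  have hHa : ∀ N s, s ∈ R N → AnalyticAt ℂ (H N) s := fun N s hs =>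
    (hHd N).analyticAt ((hRo N).mem_nhds hs)
  have hDa : ∀ N s, AnalyticAt ℂ (D N) s := fun N s => (hDd N).analyticAt s
  have hcons : ∀ {N N'} s, N ≤ N' → s ∈ R N → H N s * D N' s = H N' s * D N s := by
    intro N N' s hNN hs
    have hsub : R N ⊆ R N' := fun z hz => by
      have h1 : -(N : ℝ) < z.re := hz
      have h2 : (N : ℝ) ≤ N' := by exact_mod_cast hNN
      change -(N' : ℝ) < z.re
      linarith
    have hconv : Convex ℝ (R N) := convex_halfSpace_re_gt _
    refine AnalyticOnNhd.eqOn_of_preconnected_of_eventuallyEq (U := R N) (z₀ := 1)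
      (f := fun s => H N s * D N' s) (g := fun s => H N' s * D N s)
      (fun z hz => (hHa N z hz).mul (hDa N' z))
      (fun z hz => (hHa N' z (hsub hz)).mul (hDa N z)) hconv.isPreconnected ?_ ?_ hs
    · change -(N : ℝ) < (1 : ℂ).re
      have : (0 : ℝ) ≤ N := by positivity
      simp; linarith
    · have : ∀ᶠ z : ℂ in nhds 1, 0 < z.re :=
        (isOpen_lt continuous_const continuous_re).mem_nhds (by simp)
      filter_upwards [this] with z hz
      rw [← hHe N z hz, ← hHe N' z hz]
      ring
  set ν : ℂ → ℕ := fun s => ⌈|s.re|⌉₊ + 1 with hν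
  have hνR : ∀ s, s ∈ R (ν s) := by
    intro s
    have h1 := Nat.le_ceil |s.re|
    have h2 := neg_abs_le s.re
    change -((⌈|s.re|⌉₊ + 1 : ℕ) : ℝ) < s.re
    push_cast
    linarith
  set F : ℂ → ℂ := fun s => H (ν s) s / D (ν s) s with hF
  have hloc : ∀ s₀, ∃ N, s₀ ∈ R N ∧ ∀ᶠ s in nhds s₀, D N s ≠ 0 → F s = H N s / D N s := by
    intro s₀
    refine ⟨⌈|s₀.re| + 1⌉₊ + 1, ?_, ?_⟩
    · have h1 := Nat.le_ceil (|s₀.re| + 1)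
      have h2 := neg_abs_le s₀.re
      change -((⌈|s₀.re| + 1⌉₊ + 1 : ℕ) : ℝ) < s₀.re
      push_cast
      linarith
    · have : ∀ᶠ s : ℂ in nhds s₀, |s.re| < |s₀.re| + 1 :=
        (isOpen_lt (by fun_prop) continuous_const).mem_nhds (by simp)
      filter_upwards [this] with s hs hDs
      have hle : ν s ≤ ⌈|s₀.re| + 1⌉₊ + 1 := by
        simp only [hν]
        gcongr
      rw [hF]
      beta_reduce
      rw [div_eq_div_iff (hDle s hle hDs) hDs]
      exact hcons s hle (hνR s)
  have hg := fun (N : ℕ) (s₀ : ℂ) (l : Fin n) =>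
    exists_continuousAt_div_poleFactor (a l) (b l) (a l * N + 1) s₀
  choose g hgc hge using hg
  have hDne : ∀ N s₀, ∀ᶠ s in nhdsWithin s₀ {s₀}ᶜ, D N s ≠ 0 := by
    intro N s₀
    filter_upwards [eventually_all.2 (hge N s₀)] with s hs
    exact Finset.prod_ne_zero_iff.2 fun l _ => (hs l).1
  refine ⟨F, fun s₀ => ?_, fun s hs => ?_, fun s₀ hs₀ => ?_, fun s₀ => ?_⟩
  · obtain ⟨N, hN, hFN⟩ := hloc s₀
    refine ((hHa N s₀ hN).meromorphicAt.div (hDa N s₀).meromorphicAt).congr ?_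
    filter_upwards [hDne N s₀, nhdsWithin_le_nhds hFN] with s h1 h2 using (h2 h1).symm
  · rw [hF]
    beta_reduce
    rw [← hHe _ s hs, mul_div_cancel_left₀ _ (hDpos _ s hs)]
  · obtain ⟨N, hN, hFN⟩ := hloc s₀
    have hD0 : D N s₀ ≠ 0 := Finset.prod_ne_zero_iff.2 fun l _ =>
      poleFactor_ne_zero_of_not_rat _ _ _ hs₀
    refine ((hHa N s₀ hN).div (hDa N s₀) hD0).congr ?_
    filter_upwards [(hDd N).continuous.continuousAt.eventually_ne hD0, hFN] with s h1 h2
      using (h2 h1).symm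
  · obtain ⟨N, hN, hFN⟩ := hloc s₀
    have hc : ContinuousAt (fun s => (∏ l, g N s₀ l s) * H N s) s₀ :=
      (tendsto_finsetProd _ fun l _ => hgc N s₀ l).mul (hHa N s₀ hN).continuousAt
    refine ⟨‖(∏ l, g N s₀ l s₀) * H N s₀‖ + 1, ?_⟩
    filter_upwards [hDne N s₀, nhdsWithin_le_nhds hFN, eventually_all.2 (hge N s₀),
      nhdsWithin_le_nhds (hc.norm.eventually_lt_const (lt_add_one _))] with s h1 h2 h3 h4
    have heq : (s - s₀) ^ n * F s = (∏ l, g N s₀ l s) * H N s := by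
      rw [h2 h1, ← Finset.prod_congr rfl fun l _ => (h3 l).2, Finset.prod_div_distrib]
      simp only [Finset.prod_const, Finset.card_univ, Fintype.card_fin, hD]
      ring
    rw [heq]
    exact h4.le

/-- The point of the simplex with vertices `c 0, …, c r` with iterated cone coordinates
`t 0, …, t (r - 1)`. -/
def coneSum {K E : Type*} [CommRing K] [AddCommGroup E] [Module K E] (c : ℕ → E) (t : ℕ → K)
    (r : ℕ) : E :=
  c 0 + ∑ i ∈ Finset.range r, (∏ l ∈ Finset.range (i + 1), t l) • (c (i + 1) - c i)

section coneSum

variable {K E : Type*} [CommRing K] [AddCommGroup E] [Module K E]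

@[simp]
lemma coneSum_zero (c : ℕ → E) (t : ℕ → K) : coneSum c t 0 = c 0 := by simp [coneSum]

lemma coneSum_succ (c : ℕ → E) (t : ℕ → K) (r : ℕ) :
    coneSum c t (r + 1) =
      (1 - t 0) • c 0 + t 0 • coneSum (fun i => c (i + 1)) (fun i => t (i + 1)) r := by
  simp only [coneSum]
  have h (i : ℕ) : ∏ l ∈ Finset.range (i + 1 + 1), t l =
      t 0 * ∏ l ∈ Finset.range (i + 1), t (l + 1) := by
    rw [Finset.prod_range_succ', mul_comm]
  rw [Finset.sum_range_succ', smul_add, Finset.smul_sum, zero_add, Finset.prod_range_one]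
  simp only [h, mul_smul]
  module

lemma coneSum_eq_prod_mul {c t : ℕ → K} {m : ℕ} (hc : ∀ i < m, c i = 0) (r : ℕ) :
    coneSum c t (m + r) =
      (∏ l ∈ Finset.range m, t l) * coneSum (fun i => c (i + m)) (fun i => t (i + m)) r := by
  induction m generalizing c t with
  | zero => simp
  | succ m ih =>
    rw [show m + 1 + r = m + r + 1 by ring, coneSum_succ, hc 0 (by omega),
      ih fun i hi => hc (i + 1) (by omega), Finset.prod_range_succ', smul_zero, zero_add,
      smul_eq_mul, ← mul_assoc, mul_comm (t 0)]
    rfl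

lemma AffineMap.map_coneSum {E' : Type*} [AddCommGroup E'] [Module K E'] (g : E →ᵃ[K] E')
    (c : ℕ → E) (t : ℕ → K) (r : ℕ) :
    g (coneSum c t r) = coneSum (fun i => g (c i)) t r := by
  simp only [coneSum]
  rw [add_comm (c 0), ← vadd_eq_add, g.map_vadd, map_sum, vadd_eq_add, add_comm]
  congr 1
  refine Finset.sum_congr rfl fun i _ => ?_
  rw [map_smul, ← vsub_eq_sub, g.linearMap_vsub, vsub_eq_sub]

lemma coneSum_nonneg {c t : ℕ → ℝ} {r : ℕ} (hc : ∀ i ≤ r, 0 ≤ c i)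
    (ht : ∀ i, t i ∈ Set.Icc (0 : ℝ) 1) : 0 ≤ coneSum c t r := by
  induction r generalizing c t with
  | zero => simpa using hc 0 le_rfl
  | succ r ih =>
    rw [coneSum_succ]
    have h1 := ih (c := fun i => c (i + 1)) (fun i hi => hc (i + 1) (by omega))
      fun i => ht (i + 1)
    have h0 := hc 0 (by omega)
    have h2 : 0 ≤ 1 - t 0 := by linarith [(ht 0).2]
    have h3 := (ht 0).1
    simp only [smul_eq_mul]
    positivity

lemma coneSum_pos {c t : ℕ → ℝ} {r : ℕ} (hc : ∀ i ≤ r, 0 < c i)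
    (ht : ∀ i, t i ∈ Set.Icc (0 : ℝ) 1) : 0 < coneSum c t r := by
  induction r generalizing c t with
  | zero => simpa using hc 0 le_rfl
  | succ r ih =>
    rw [coneSum_succ]
    have h1 := ih (c := fun i => c (i + 1)) (fun i hi => hc (i + 1) (by omega))
      fun i => ht (i + 1)
    have h0 := hc 0 (by omega)
    have h2 : 0 ≤ 1 - t 0 := by linarith [(ht 0).2]
    simp only [smul_eq_mul]
    rcases (ht 0).1.eq_or_lt with h | h
    · rw [← h]; simpa using h0
    · positivity

lemma coneSum_pos_of_exists {c t : ℕ → ℝ} {r i : ℕ} (hi : i ≤ r) (hc : ∀ i ≤ r, 0 ≤ c i)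
    (hci : 0 < c i) (ht : ∀ i, t i ∈ Set.Icc (0 : ℝ) 1) (ht' : ∀ i < r, t i ∈ Set.Ioo (0 : ℝ) 1) :
    0 < coneSum c t r := by
  induction r generalizing c t i with
  | zero => obtain rfl : i = 0 := by omega
            simpa using hci
  | succ r ih =>
    rw [coneSum_succ]
    have hc' : ∀ i ≤ r, 0 ≤ c (i + 1) := fun i hi => hc (i + 1) (by omega)
    have h1 := coneSum_nonneg hc' fun i => ht (i + 1)
    have h2 : 0 < 1 - t 0 := by linarith [(ht' 0 (by omega)).2]
    have h3 := (ht' 0 (by omega)).1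
    have h0 := hc 0 (by omega)
    simp only [smul_eq_mul]
    cases i with
    | zero => positivity
    | succ i =>
      have := ih (c := fun i => c (i + 1)) (i := i) (by omega) hc' hci (fun i => ht (i + 1))
        fun i hi => ht' (i + 1) (by omega)
      positivity

lemma exists_coneSum_eq {E : Type*} [AddCommGroup E] [Module ℝ E] (c : ℕ → E) (μ : ℕ → ℝ) (r : ℕ)
    (hμ : ∀ i ≤ r, 0 < μ i) (hsum : ∑ i ∈ Finset.range (r + 1), μ i = 1) :
    ∃ t : ℕ → ℝ, (∀ i, t i ∈ Set.Ioo (0 : ℝ) 1) ∧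
      coneSum c t r = ∑ i ∈ Finset.range (r + 1), μ i • c i := by
  induction r generalizing c μ with
  | zero =>
    refine ⟨fun _ => 1 / 2, fun _ => by norm_num, ?_⟩
    have : μ 0 = 1 := by simpa using hsum
    simp [this]
  | succ r ih =>
    rw [Finset.sum_range_succ'] at hsum
    set τ : ℝ := ∑ i ∈ Finset.range (r + 1), μ (i + 1) with hτ
    have h0 := hμ 0 (by omega)
    have hτ0 : 0 < τ := Finset.sum_pos
      (fun i hi => hμ (i + 1) (by have := Finset.mem_range.1 hi; omega)) ⟨0, by simp⟩
    obtain ⟨t, ht, hct⟩ := ih (fun i => c (i + 1)) (fun i => μ (i + 1) / τ)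
      (fun i hi => div_pos (hμ (i + 1) (by omega)) hτ0)
      (by rw [← Finset.sum_div, div_self hτ0.ne'])
    refine ⟨fun i => if i = 0 then τ else t (i - 1), fun i => ?_, ?_⟩
    · dsimp only
      split_ifs
      · exact ⟨hτ0, by linarith⟩
      · exact ht _
    · rw [coneSum_succ, Finset.sum_range_succ', add_comm]
      simp only [hct, Finset.smul_sum, smul_smul, if_true, Nat.add_one_ne_zero, if_false,
        Nat.add_sub_cancel, mul_div_cancel₀ _ hτ0.ne', show (1 : ℝ) - τ = μ 0 by linarith]

end coneSum

/-- Extension of a vector by zero to a sequence. -/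
def extendZero {K : Type*} [Zero K] (t : Fin n → K) (i : ℕ) : K :=
  if h : i < n then t ⟨i, h⟩ else 0

/-- Iterated cone coordinates on the simplex with vertices `w`. -/
def duffy {K E : Type*} [CommRing K] [AddCommGroup E] [Module K E] (w : Fin (n + 1) → E)
    (t : Fin n → K) : E :=
  coneSum (fun i => w (Fin.ofNat (n + 1) i)) (extendZero t) n

lemma extendZero_mem_Icc {t : Fin n → ℝ} (ht : ∀ l, t l ∈ Set.Icc (0 : ℝ) 1) (i : ℕ) :
    extendZero t i ∈ Set.Icc (0 : ℝ) 1 := by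
  unfold extendZero
  split_ifs with h
  · exact ht _
  · simp

lemma prod_range_extendZero {K : Type*} [CommRing K] (t : Fin n → K) {m : ℕ} (hm : m ≤ n) :
    ∏ l ∈ Finset.range m, extendZero t l = ∏ l : Fin n, if (l : ℕ) < m then t l else 1 := by
  have h : ∏ l ∈ Finset.range n, (if l < m then extendZero t l else 1) =
      ∏ l ∈ Finset.range m, extendZero t l := by
    rw [← Finset.prod_filter]
    congr 1
    ext i
    simp
    omega
  rw [← h, Finset.prod_range]
  exact Finset.prod_congr rfl fun l _ => by simp [extendZero]

lemma duffy_eq {K E : Type*} [CommRing K] [AddCommGroup E] [Module K E] (w : Fin (n + 1) → E)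
    (t : Fin n → K) :
    duffy w t = w 0 + ∑ j : Fin n,
      (∏ l : Fin n, if l ≤ j then t l else 1) • (w j.succ - w j.castSucc) := by
  rw [duffy, coneSum, Finset.sum_range]
  congr 1
  refine Finset.sum_congr rfl fun j _ => ?_
  have h1 : Fin.ofNat (n + 1) (j + 1) = j.succ := by
    ext
    simp
  have h2 : Fin.ofNat (n + 1) j = j.castSucc := by
    ext
    simp
  rw [prod_range_extendZero t (by omega), h1, h2]
  simp only [Nat.lt_succ_iff, Fin.val_fin_le]

lemma duffy_mem_convexHull (B : AffineBasis (Fin (n + 1)) ℝ (Fin n → ℝ)) {t : Fin n → ℝ}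
    (ht : ∀ l, t l ∈ Set.Icc (0 : ℝ) 1) : duffy B t ∈ convexHull ℝ (Set.range B) := by
  rw [B.convexHull_eq_nonneg_coord]
  intro i
  rw [duffy, AffineMap.map_coneSum]
  refine coneSum_nonneg (fun j _ => ?_) (extendZero_mem_Icc ht)
  rw [B.coord_apply]
  split_ifs <;> norm_num

lemma image_duffy (B : AffineBasis (Fin (n + 1)) ℝ (Fin n → ℝ)) :
    duffy B '' (Set.univ.pi fun _ => Set.Ioo (0 : ℝ) 1) =
      interior (convexHull ℝ (Set.range B)) := by
  rw [B.interior_convexHull]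
  ext x
  constructor
  · rintro ⟨t, ht, rfl⟩ i
    replace ht : ∀ l, t l ∈ Set.Ioo (0 : ℝ) 1 := fun l => ht l trivial
    rw [duffy, AffineMap.map_coneSum]
    refine coneSum_pos_of_exists (i := i) (by omega) (fun j _ => ?_) ?_
      (extendZero_mem_Icc fun l => Set.Ioo_subset_Icc_self (ht l)) fun j hj => ?_
    · rw [B.coord_apply]
      split_ifs <;> norm_num
    · simp
    · simpa [extendZero, hj] using ht ⟨j, hj⟩
  · intro hx
    obtain ⟨t, ht, h⟩ := exists_coneSum_eq (fun i => B (Fin.ofNat (n + 1) i))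
      (fun i => B.coord (Fin.ofNat (n + 1) i) x) n (fun i _ => hx _)
      (by rw [Finset.sum_range]; simp)
    refine ⟨fun l => t l, fun l _ => ht l, ?_⟩
    have h' : coneSum (fun i => B (Fin.ofNat (n + 1) i)) (extendZero fun l : Fin n => t l) n =
        coneSum (fun i => B (Fin.ofNat (n + 1) i)) t n := by
      simp only [coneSum]
      congr 1
      refine Finset.sum_congr rfl fun i hi => ?_
      congr 1
      refine Finset.prod_congr rfl fun l hl => ?_
      simp only [Finset.mem_range] at hi hl
      simp [extendZero, show l < n by omega]
    rw [duffy, h', h, Finset.sum_range]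
    simp

lemma injOn_duffy (B : AffineBasis (Fin (n + 1)) ℝ (Fin n → ℝ)) :
    Set.InjOn (duffy B) (Set.univ.pi fun _ => Set.Ioo (0 : ℝ) 1) := by
  intro t ht t' ht' h
  replace ht : ∀ l, t l ∈ Set.Ioo (0 : ℝ) 1 := fun l => ht l trivial
  have key (u : Fin n → ℝ) (k : ℕ) (hk : k ≤ n) :
      ∑ i : Fin (n + 1), (if k ≤ i then B.coord i (duffy B u) else 0) =
        ∏ l ∈ Finset.range k, extendZero u l := by
    let L : (Fin n → ℝ) →ᵃ[ℝ] ℝ := (Fintype.linearCombination ℝ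
      fun i : Fin (n + 1) => if k ≤ i then (1 : ℝ) else 0).toAffineMap.comp B.coords
    have h1 : ∀ x, ∑ i : Fin (n + 1), (if k ≤ i then B.coord i x else 0) = L x := by
      intro x
      simp [L, Fintype.linearCombination_apply]
    have h2 : ∀ i ≤ n, L (B (Fin.ofNat (n + 1) i)) = if k ≤ i then 1 else 0 := by
      intro i hi
      rw [← h1]
      have h3 : ∀ j : Fin (n + 1), (if k ≤ j then B.coord j (B (Fin.ofNat (n + 1) i)) else 0) =
          if Fin.ofNat (n + 1) i = j then (if k ≤ i then 1 else 0) else 0 := by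
        intro j
        rw [B.coord_apply]
        by_cases hj : Fin.ofNat (n + 1) i = j
        · subst hj
          simp [Nat.mod_eq_of_lt (show i < n + 1 by omega)]
        · rw [if_neg (Ne.symm hj), if_neg hj, ite_self]
      simp only [h3, Finset.sum_ite_eq, Finset.mem_univ, if_true]
    rw [h1, duffy, AffineMap.map_coneSum]
    obtain ⟨r, hr⟩ := Nat.exists_eq_add_of_le hk
    have h4 : coneSum (fun i => L (B (Fin.ofNat (n + 1) i))) (extendZero u) (k + r) =
        ∏ l ∈ Finset.range k, extendZero u l := by
      rw [coneSum_eq_prod_mul fun i hi => by rw [h2 i (by omega), if_neg hi.not_ge], coneSum, zero_add,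
        h2 k hk, Finset.sum_eq_zero]
      · simp
      · intro i hi
        have := Finset.mem_range.1 hi
        rw [h2 (i + k) (by omega), h2 (i + 1 + k) (by omega), if_pos (by omega),
          if_pos (by omega), sub_self, smul_zero]
    rwa [← hr] at h4
  have key2 (k : ℕ) (hk : k ≤ n) : ∏ l ∈ Finset.range k, extendZero t l =
      ∏ l ∈ Finset.range k, extendZero t' l := by
    rw [← key t k hk, ← key t' k hk, h]
  ext l
  have h1 := key2 (l + 1) (by omega)
  rw [Finset.prod_range_succ, Finset.prod_range_succ, ← key2 l (by omega)] at h1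
  have h2 : ∏ l ∈ Finset.range l, extendZero t l ≠ 0 := by
    refine Finset.prod_ne_zero_iff.2 fun i hi => ?_
    have : i < n := by have := Finset.mem_range.1 hi; omega
    simpa [extendZero, this] using (ht ⟨i, this⟩).1.ne'
  simpa [extendZero] using mul_left_cancel₀ h2 h1

/-- The linear part of `duffy w` in terms of partial products of the cone coordinates. -/
noncomputable def edgeMap (w : Fin (n + 1) → (Fin n → ℝ)) : (Fin n → ℝ) →L[ℝ] (Fin n → ℝ) :=
  (Fintype.linearCombination ℝ fun j => w (Fin.succ j) - w (Fin.castSucc j)).toContinuousLinearMap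

/-- The Jacobian matrix of the partial products `t ↦ ∏ l ≤ j, t l`. -/
def partialProdJacobian (t : Fin n → ℝ) : Matrix (Fin n) (Fin n) ℝ :=
  .of fun j l => if l ≤ j then ∏ i ∈ Finset.univ.erase l, (if i ≤ j then t i else 1) else 0

lemma hasFDerivAt_partialProd (t : Fin n → ℝ) :
    HasFDerivAt (fun (t : Fin n → ℝ) (j : Fin n) => ∏ l : Fin n, if l ≤ j then t l else 1)
      (Matrix.toLin' (partialProdJacobian t)).toContinuousLinearMap t := by
  rw [hasFDerivAt_pi']
  intro j
  have h : ∀ l ∈ Finset.univ, HasFDerivAt (fun t : Fin n → ℝ => if l ≤ j then t l else 1)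
      (if l ≤ j then ContinuousLinearMap.proj (R := ℝ) (φ := fun _ : Fin n => ℝ) l else 0) t := by
    intro l _
    split_ifs
    · exact hasFDerivAt_apply l t
    · exact hasFDerivAt_const _ _
  refine (HasFDerivAt.finsetProd h).congr_fderiv ?_
  ext y
  simp only [sum_apply]
  simp [partialProdJacobian, Matrix.mulVec, dotProduct]
  refine Finset.sum_congr rfl fun l _ => ?_
  split_ifs <;> simp

lemma det_partialProdJacobian (t : Fin n → ℝ) :
    (partialProdJacobian t).det = ∏ l : Fin n, t l ^ (Finset.univ.filter fun j => l < j).card := by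
  rw [Matrix.det_of_isLowerTriangular]
  · have h (j : Fin n) : partialProdJacobian t j j = ∏ l : Fin n, if l < j then t l else 1 := by
      rw [← Finset.mul_prod_erase _ _ (Finset.mem_univ j)]
      simp only [partialProdJacobian, Matrix.of_apply, le_refl, if_true, lt_irrefl, if_false,
        one_mul]
      refine Finset.prod_congr rfl fun i hi => ?_
      simp [(Finset.ne_of_mem_erase hi).le_iff_lt]
    simp only [h]
    rw [Finset.prod_comm]
    refine Finset.prod_congr rfl fun l _ => ?_
    rw [← Finset.prod_filter, Finset.prod_const]
  · intro i j hij
    have : ¬ j ≤ i := not_le.2 hij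
    simp [partialProdJacobian, this]

lemma integral_convexHull_eq (B : AffineBasis (Fin (n + 1)) ℝ (Fin n → ℝ))
    (g : (Fin n → ℝ) → ℂ) :
    ∫ x in convexHull ℝ (Set.range B), g x =
      ∫ t, (|(edgeMap B).det| * ∏ l, t l ^ (Finset.univ.filter fun j => l < j).card : ℝ) •
        g (duffy B t) ∂cubeMeasure n := by
  have h1 : (interior (convexHull ℝ (Set.range B)) : Set (Fin n → ℝ)) =ᵐ[volume]
      convexHull ℝ (Set.range B) :=
    interior_ae_eq_of_null_frontier ((convex_convexHull ℝ _).addHaar_frontier volume)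
  rw [← setIntegral_congr_set h1, ← image_duffy B]
  have hd : ∀ t ∈ (Set.univ.pi fun _ => Set.Ioo (0 : ℝ) 1), HasFDerivWithinAt (duffy B)
      ((edgeMap B).comp (Matrix.toLin' (partialProdJacobian t)).toContinuousLinearMap)
      (Set.univ.pi fun _ => Set.Ioo (0 : ℝ) 1) t := by
    intro t _
    have h := ((edgeMap B).hasFDerivAt.comp t (hasFDerivAt_partialProd t)).const_add (B 0)
    refine (h.congr_of_eventuallyEq (Eventually.of_forall fun t => ?_)).hasFDerivWithinAt
    rw [duffy_eq]
    simp [edgeMap, Fintype.linearCombination_apply]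
  rw [integral_image_eq_integral_abs_det_fderiv_smul volume (measurableSet_openCube n) hd
    (injOn_duffy B), cubeMeasure_eq]
  refine setIntegral_congr_fun (measurableSet_openCube n) fun t ht => ?_
  congr 1
  have h2 : ((edgeMap B).comp (Matrix.toLin' (partialProdJacobian t)).toContinuousLinearMap).det
      = (edgeMap B).det * (partialProdJacobian t).det := by
    rw [← LinearMap.det_toLin']
    exact LinearMap.det_comp _ _
  rw [h2, abs_mul, det_partialProdJacobian, abs_of_nonneg (a := ∏ l, _)]
  exact Finset.prod_nonneg fun l _ => pow_nonneg (ht l trivial).1.le _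

lemma ofReal_coneSum (c t : ℕ → ℝ) (r : ℕ) :
    ((coneSum c t r : ℝ) : ℂ) = coneSum (fun i => (c i : ℂ)) (fun i => (t i : ℂ)) r := by
  simp [coneSum]

lemma ofReal_extendZero (t : Fin n → ℝ) (i : ℕ) :
    ((extendZero t i : ℝ) : ℂ) = extendZero (fun l => (t l : ℂ)) i := by
  unfold extendZero
  split_ifs <;> simp

lemma coneSum_apply {ι K : Type*} [CommRing K] (c : ℕ → ι → K) (t : ℕ → K) (r : ℕ) (k : ι) :
    coneSum c t r k = coneSum (fun i => c i k) t r := by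
  simp [coneSum]

lemma ofReal_duffy (w : Fin (n + 1) → (Fin n → ℝ)) (t : Fin n → ℝ) :
    duffy (fun i k => (w i k : ℂ)) (fun l => (t l : ℂ)) = fun k => (duffy w t k : ℂ) := by
  ext k
  simp only [duffy, coneSum_apply, ofReal_coneSum, ofReal_extendZero]

lemma AnalyticAt.coneSum {X : Type*} [NormedAddCommGroup X] [NormedSpace ℂ X] (c : ℕ → ℂ)
    {t : ℕ → X → ℂ} {x : X} (ht : ∀ i, AnalyticAt ℂ (t i) x) (r : ℕ) :
    AnalyticAt ℂ (fun x => coneSum c (fun i => t i x) r) x :=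
  analyticAt_const.fun_add (Finset.analyticAt_fun_sum _ fun _ _ =>
    (Finset.analyticAt_fun_prod _ fun l _ => ht l).fun_smul analyticAt_const)

lemma analyticAt_extendZero (i : ℕ) (p : ℂ × (Fin n → ℂ)) :
    AnalyticAt ℂ (fun p : ℂ × (Fin n → ℂ) => extendZero p.2 i) p := by
  unfold extendZero
  split_ifs
  · exact (ContinuousLinearMap.analyticAt
      ((ContinuousLinearMap.proj (R := ℂ) (φ := fun _ : Fin n => ℂ) _).comp
        (ContinuousLinearMap.snd ℂ ℂ (Fin n → ℂ))) p)
  · exact analyticAt_const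

lemma ofReal_prod_cpow {ι : Type*} (u : Finset ι) {x : ι → ℝ} (hx : ∀ i ∈ u, 0 ≤ x i) (s : ℂ) :
    ((∏ i ∈ u, x i : ℝ) : ℂ) ^ s = ∏ i ∈ u, (x i : ℂ) ^ s := by
  classical
  induction u using Finset.induction_on with
  | empty => simp
  | insert i u hi ih =>
    rw [Finset.prod_insert hi, Finset.prod_insert hi, ofReal_mul,
      mul_cpow_ofReal_nonneg (hx i (by simp))
        (Finset.prod_nonneg fun j hj => hx j (by simp [hj])),
      ih fun j hj => hx j (by simp [hj])]

/-- A function that is affine on the simplex with vertices `w` and vanishes exactly at the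
vertices with index less than `m` is a monomial times a nonvanishing factor in cone coordinates. -/
lemma AffineMap.map_duffy (w : Fin (n + 1) → (Fin n → ℝ)) (g : (Fin n → ℝ) →ᵃ[ℝ] ℝ)
    {m : Fin (n + 1)} (hm : ∀ i < m, g (w i) = 0) (t : Fin n → ℝ) :
    g (duffy w t) = (∏ l : Fin n, if (l : ℕ) < m then t l else 1) *
      coneSum (fun i => g (w (Fin.ofNat (n + 1) (i + m)))) (fun i => extendZero t (i + m))
        (n - m) := by
  rw [duffy, AffineMap.map_coneSum, ← prod_range_extendZero t (Nat.lt_succ_iff.1 m.2),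
    ← coneSum_eq_prod_mul (c := fun i => g (w (Fin.ofNat (n + 1) i))),
    Nat.add_sub_cancel' (Nat.lt_succ_iff.1 m.2)]
  intro i hi
  refine hm _ ?_
  rw [Fin.lt_def]
  simpa [Nat.mod_eq_of_lt (hi.trans m.2)] using hi

theorem hasMeromorphicContinuation_of_flag {ι : Type*} [Fintype ι]
    (B : AffineBasis (Fin (n + 1)) ℝ (Fin n → ℝ)) (g : ι → (Fin n → ℝ) →ᵃ[ℝ] ℝ)
    (hg0 : ∀ j i, 0 ≤ g j (B i))
    (hmono : ∀ j, ∀ i i', i ≤ i' → g j (B i') = 0 → g j (B i) = 0)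
    (hne : ∀ j, ∃ i, g j (B i) ≠ 0) {E : ℂ × (Fin n → ℂ) → ℂ}
    (hE : ∀ (s : ℂ) (x : Fin n → ℝ), x ∈ convexHull ℝ (Set.range B) →
      AnalyticAt ℂ E (s, fun i => (x i : ℂ))) :
    HasMeromorphicContinuation n fun s =>
      ∫ x in convexHull ℝ (Set.range B), (↑(∏ j, g j x) : ℂ) ^ s * E (s, fun i => (x i : ℂ)) := by
  have hm : ∀ j, ∃ m : Fin (n + 1), (∀ i < m, g j (B i) = 0) ∧ ∀ i, m ≤ i → 0 < g j (B i) := by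
    intro j
    obtain ⟨m, hm, hmin⟩ := WellFounded.has_min wellFounded_lt {i | g j (B i) ≠ 0} (hne j)
    refine ⟨m, fun i hi => ?_, fun i hi => (hg0 j i).lt_of_ne fun h => hm (hmono j m i hi h.symm)⟩
    by_contra h
    exact hmin i h hi
  choose m hm0 hmpos using hm
  set u : ι → (Fin n → ℝ) → ℝ := fun j t =>
    coneSum (fun i => g j (B (Fin.ofNat (n + 1) (i + m j)))) (fun i => extendZero t (i + m j))
      (n - m j) with hu
  set uc : ι → (Fin n → ℂ) → ℂ := fun j t =>
    coneSum (fun i => (g j (B (Fin.ofNat (n + 1) (i + m j))) : ℂ))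
      (fun i => extendZero t (i + m j)) (n - m j) with huc
  have hucu : ∀ j (t : Fin n → ℝ), uc j (fun l => (t l : ℂ)) = (u j t : ℂ) := by
    intro j t
    simp only [hu, huc, ofReal_coneSum, ofReal_extendZero]
  have hupos : ∀ j (t : Fin n → ℝ), (∀ l, t l ∈ Set.Icc (0 : ℝ) 1) → 0 < u j t := by
    intro j t ht
    refine coneSum_pos (fun i hi => hmpos j _ ?_) fun i => extendZero_mem_Icc ht _
    have : i + (m j : ℕ) < n + 1 := by omega
    rw [Fin.le_def]
    simp [Nat.mod_eq_of_lt this]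
  set G : ℂ × (Fin n → ℂ) → ℂ := fun p =>
    ((|(edgeMap B).det| : ℝ) : ℂ) * (∏ j, uc j p.2 ^ p.1) *
      E (p.1, duffy (fun i k => (B i k : ℂ)) p.2) with hGdef
  have hG : AnalyticOnCube G := by
    intro s t ht
    refine (analyticAt_const.fun_mul (Finset.analyticAt_fun_prod _ fun j _ => ?_)).fun_mul ?_
    · refine AnalyticAt.cpow ?_ analyticAt_fst ?_
      · exact AnalyticAt.coneSum _ (fun i => analyticAt_extendZero _ _) _
      · simp only [hucu]
        exact ofReal_mem_slitPlane.2 (hupos j t ht)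
    · refine AnalyticAt.comp_of_eq (hE s (duffy B t) (duffy_mem_convexHull B ht))
        (f := fun p : ℂ × (Fin n → ℂ) => (p.1, duffy (fun i k => (B i k : ℂ)) p.2)) ?_ ?_
      · refine analyticAt_fst.prod (AnalyticAt.pi fun k => ?_)
        simp only [duffy, coneSum_apply]
        exact AnalyticAt.coneSum _ (fun i => analyticAt_extendZero _ _) _
      · simp only [ofReal_duffy]
  refine (hasMeromorphicContinuation_mellinIntegral
    (fun l => (Finset.univ.filter fun j => (l : ℕ) < m j).card)
    (fun l => (Finset.univ.filter fun j => l < j).card) hG).congr fun s _ => ?_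
  rw [mellinIntegral, integral_convexHull_eq]
  refine integral_congr_ae ?_
  filter_upwards [ae_cubeMeasure n] with t ht
  have ht0 : ∀ l, 0 < t l := fun l => (ht l).1
  have ht' : ∀ l, t l ∈ Set.Icc (0 : ℝ) 1 := fun l => Set.Ioo_subset_Icc_self (ht l)
  have h1 : ((∏ j, g j (duffy B t) : ℝ) : ℂ) ^ s =
      (∏ l, (t l : ℂ) ^ (((Finset.univ.filter fun j => (l : ℕ) < m j).card : ℂ) * s)) *
        ∏ j, (u j t : ℂ) ^ s := by
    have h2 : ∀ j, (0 : ℝ) ≤ ∏ l : Fin n, if (l : ℕ) < m j then t l else 1 := fun j =>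
      Finset.prod_nonneg fun l _ => by split_ifs; exacts [(ht0 l).le, zero_le_one]
    have h3 : ∀ j, ((∏ l : Fin n, if (l : ℕ) < m j then t l else 1 : ℝ) : ℂ) ^ s =
        ∏ l : Fin n, if (l : ℕ) < m j then (t l : ℂ) ^ s else 1 := by
      intro j
      rw [ofReal_prod_cpow _ fun l _ => by split_ifs; exacts [(ht0 l).le, zero_le_one]]
      refine Finset.prod_congr rfl fun l _ => ?_
      split_ifs <;> simp
    simp only [fun j => AffineMap.map_duffy B (g j) (hm0 j) t]
    rw [Finset.prod_mul_distrib, ofReal_mul,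
      mul_cpow_ofReal_nonneg (Finset.prod_nonneg fun j _ => h2 j)
        (Finset.prod_nonneg fun j _ => (hupos j t ht').le),
      ofReal_prod_cpow _ fun j _ => h2 j, ofReal_prod_cpow _ fun j _ => (hupos j t ht').le]
    congr 1
    simp only [h3]
    rw [Finset.prod_comm]
    refine Finset.prod_congr rfl fun l _ => ?_
    rw [← Finset.prod_filter, Finset.prod_const, cpow_nat_mul]
  have h4 : ∀ l, (t l : ℂ) ^ (((Finset.univ.filter fun j => (l : ℕ) < m j).card : ℂ) * s +
      ((Finset.univ.filter fun j => l < j).card : ℂ)) =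
      (t l : ℂ) ^ (((Finset.univ.filter fun j => (l : ℕ) < m j).card : ℂ) * s) *
        (t l : ℂ) ^ (Finset.univ.filter fun j => l < j).card := by
    intro l
    rw [cpow_add _ _ (ofReal_ne_zero.2 (ht0 l).ne'), cpow_natCast]
  simp only [mellinIntegrand, hGdef, ofReal_duffy, hucu, h1, h4, Finset.prod_mul_distrib]
  rw [real_smul]
  push_cast
  ring

lemma AffineBasis.map_eq_sum (B : AffineBasis (Fin (n + 1)) ℝ (Fin n → ℝ))
    (g : (Fin n → ℝ) →ᵃ[ℝ] ℝ) (x : Fin n → ℝ) : g x = ∑ i, B.coord i x * g (B i) := by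
  conv_lhs => rw [← B.affineCombination_coord_eq_self x]
  rw [Finset.map_affineCombination _ _ _ (B.sum_coord_apply_eq_one x),
    Finset.affineCombination_eq_linear_combination _ _ _ (B.sum_coord_apply_eq_one x)]
  simp

/-- Bisecting a simplex at the midpoint of the edge joining its vertices `a` and `b`. -/
lemma AffineBasis.exists_update_midpoint (B : AffineBasis (Fin (n + 1)) ℝ (Fin n → ℝ))
    {a b : Fin (n + 1)} (hab : a ≠ b) :
    ∃ B' : AffineBasis (Fin (n + 1)) ℝ (Fin n → ℝ),
      ⇑B' = Function.update B b (midpoint ℝ (B a) (B b)) ∧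
      (∀ x, B'.coord a x = B.coord a x - B.coord b x) ∧
      convexHull ℝ (Set.range B') =
        convexHull ℝ (Set.range B) ∩ {x | B.coord b x ≤ B.coord a x} := by
  set p : Fin (n + 1) → Fin n → ℝ := Function.update B b (midpoint ℝ (B a) (B b)) with hp
  have hpa : p a = B a := Function.update_of_ne hab _ _
  have hpb : p b = midpoint ℝ (B a) (B b) := Function.update_self _ _ _
  have hpi : ∀ i, i ≠ b → p i = B i := fun i hi => Function.update_of_ne hi _ _
  have hspan : affineSpan ℝ (Set.range p) = ⊤ := by
    rw [eq_top_iff, ← B.tot]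
    refine affineSpan_le_of_subset_coe ?_
    rintro _ ⟨i, rfl⟩
    have hmem : ∀ i, p i ∈ affineSpan ℝ (Set.range p) := fun i =>
      subset_affineSpan ℝ _ ⟨i, rfl⟩
    by_cases hi : i = b
    · have h : B i = AffineMap.lineMap (p a) (p b) (2 : ℝ) := by
        rw [hpa, hpb, hi, AffineMap.lineMap_apply_module, midpoint_eq_smul_add, invOf_eq_inv]
        module
      rw [h]
      exact AffineMap.lineMap_mem _ (hmem a) (hmem b)
    · rw [← hpi i hi]
      exact hmem i
  have hind : AffineIndependent ℝ p := by
    rw [affineIndependent_iff_finrank_vectorSpan_eq ℝ p (Fintype.card_fin (n + 1)),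
      ← direction_affineSpan, hspan, AffineSubspace.direction_top, finrank_top]
    simp
  have hpm : ∀ i, B.coord i (p b) = (B.coord i (B a) + B.coord i (B b)) / 2 := by
    intro i
    rw [hpb, AffineMap.map_midpoint, midpoint_eq_smul_add]
    simp
    ring
  let B' : AffineBasis (Fin (n + 1)) ℝ (Fin n → ℝ) := ⟨p, hind, hspan⟩
  have hB' : ⇑B' = p := rfl
  have hcoord : ∀ (g : (Fin n → ℝ) →ᵃ[ℝ] ℝ) k, (∀ i, g (p i) = if i = k then 1 else 0) →
      ∀ x, B'.coord k x = g x := by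
    intro g k hg x
    rw [B'.map_eq_sum g x]
    simp [hB', hg]
  have hca : ∀ x, B'.coord a x = B.coord a x - B.coord b x := by
    refine hcoord (B.coord a - B.coord b) a fun i => ?_
    by_cases hi : i = b
    · subst hi
      simp [hpm, B.coord_apply, hab, hab.symm]
    · simp [hpi i hi, B.coord_apply, Ne.symm hi, eq_comm]
  have hcb : ∀ x, B'.coord b x = 2 * B.coord b x := by
    refine hcoord ((2 : ℝ) • B.coord b) b fun i => ?_
    by_cases hi : i = b
    · subst hi
      simp [hpm, B.coord_apply, hab.symm]
    · simp [hpi i hi, B.coord_apply, hi, Ne.symm hi]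
  have hci : ∀ k, k ≠ a → k ≠ b → ∀ x, B'.coord k x = B.coord k x := by
    intro k hka hkb
    refine hcoord (B.coord k) k fun i => ?_
    by_cases hi : i = b
    · subst hi
      simp [hpm, B.coord_apply, hka, hkb, hkb.symm]
    · simp [hpi i hi, B.coord_apply, eq_comm]
  refine ⟨B', rfl, hca, ?_⟩
  rw [B'.convexHull_eq_nonneg_coord, B.convexHull_eq_nonneg_coord]
  ext x
  constructor
  · intro hx
    have ha := hx a
    have hb := hx b
    rw [hca] at ha
    rw [hcb] at hb
    refine ⟨fun i => ?_, by simpa using ha⟩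
    by_cases hia : i = a
    · subst hia; linarith
    by_cases hib : i = b
    · subst hib; linarith
    exact (hci i hia hib x) ▸ hx i
  · rintro ⟨hx, hab' : B.coord b x ≤ B.coord a x⟩ i
    by_cases hia : i = a
    · subst hia; rw [hca]; linarith
    by_cases hib : i = b
    · subst hib; rw [hcb]; linarith [hx i]
    rw [hci i hia hib]
    exact hx i

/-- The set of affine functions vanishing at the vertex `i`. -/
noncomputable def vanishingSet {ι : Type*} [Fintype ι]
    (B : AffineBasis (Fin (n + 1)) ℝ (Fin n → ℝ)) (g : ι → (Fin n → ℝ) →ᵃ[ℝ] ℝ)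
    (i : Fin (n + 1)) : Finset ι :=
  open Classical in Finset.univ.filter fun j => g j (B i) = 0

lemma mem_vanishingSet {ι : Type*} [Fintype ι]
    {B : AffineBasis (Fin (n + 1)) ℝ (Fin n → ℝ)} {g : ι → (Fin n → ℝ) →ᵃ[ℝ] ℝ}
    {i : Fin (n + 1)} {j : ι} : j ∈ vanishingSet B g i ↔ g j (B i) = 0 := by
  simp [vanishingSet]

lemma sum_card_vanishingSet_lt {ι : Type*} [Fintype ι]
    {B B' : AffineBasis (Fin (n + 1)) ℝ (Fin n → ℝ)} {g : ι → (Fin n → ℝ) →ᵃ[ℝ] ℝ}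
    (hg0 : ∀ j i, 0 ≤ g j (B i)) {a b : Fin (n + 1)}
    (hB' : ⇑B' = Function.update B b (midpoint ℝ (B a) (B b)))
    (h : ¬ vanishingSet B g b ⊆ vanishingSet B g a) :
    (∀ j i, 0 ≤ g j (B' i)) ∧
      ∑ i, (vanishingSet B' g i).card < ∑ i, (vanishingSet B g i).card := by
  have hb : ∀ j, g j (B' b) = (g j (B a) + g j (B b)) / 2 := by
    intro j
    rw [hB', Function.update_self, AffineMap.map_midpoint, midpoint_eq_smul_add]
    simp
    ring
  have hi : ∀ i, i ≠ b → B' i = B i := fun i hi => by rw [hB', Function.update_of_ne hi]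
  have hlt : (vanishingSet B' g b).card < (vanishingSet B g b).card := by
    refine Finset.card_lt_card ⟨fun j hj => ?_, fun hsub => h fun j hj => ?_⟩
    · rw [mem_vanishingSet, hb] at hj
      rw [mem_vanishingSet]
      linarith [hg0 j a, hg0 j b]
    · have := hsub hj
      rw [mem_vanishingSet, hb] at this
      rw [mem_vanishingSet]
      linarith [hg0 j a, hg0 j b]
  constructor
  · intro j i
    by_cases hib : i = b
    · rw [hib, hb]
      linarith [hg0 j a, hg0 j b]
    · rw [hi i hib]
      exact hg0 j i
  · refine Finset.sum_lt_sum (fun i _ => ?_) ⟨b, Finset.mem_univ b, hlt⟩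
    by_cases hib : i = b
    · exact hib ▸ hlt.le
    · simp only [vanishingSet, hi i hib, le_refl]

theorem hasMeromorphicContinuation_of_affineBasis {ι : Type*} [Fintype ι]
    (B : AffineBasis (Fin (n + 1)) ℝ (Fin n → ℝ)) (g : ι → (Fin n → ℝ) →ᵃ[ℝ] ℝ)
    (hg0 : ∀ j i, 0 ≤ g j (B i)) (hne : ∀ j, ∃ x, g j x ≠ 0) {E : ℂ × (Fin n → ℂ) → ℂ}
    (hE : ∀ (s : ℂ) (x : Fin n → ℝ), x ∈ convexHull ℝ (Set.range B) →
      AnalyticAt ℂ E (s, fun i => (x i : ℂ))) :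
    HasMeromorphicContinuation n fun s =>
      ∫ x in convexHull ℝ (Set.range B), (↑(∏ j, g j x) : ℂ) ^ s * E (s, fun i => (x i : ℂ)) := by
  induction hN : ∑ i, (vanishingSet B g i).card using Nat.strong_induction_on generalizing B with
  | _ N ih =>
  by_cases hcomp : ∀ a b, vanishingSet B g b ⊆ vanishingSet B g a ∨
      vanishingSet B g a ⊆ vanishingSet B g b
  · set σ := Tuple.sort fun i => OrderDual.toDual (vanishingSet B g i).card
    have hσ := Tuple.monotone_sort fun i => OrderDual.toDual (vanishingSet B g i).card
    have hBσ : ⇑(B.reindex σ.symm) = B ∘ σ := by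
      ext; simp
    have hrange : Set.range (B.reindex σ.symm) = Set.range B := by
      rw [hBσ, EquivLike.range_comp]
    rw [← hrange] at hE ⊢
    refine hasMeromorphicContinuation_of_flag (B.reindex σ.symm) g
      (fun j i => by rw [hBσ]; exact hg0 j _) (fun j i i' hii h => ?_) (fun j => ?_) hE
    · rw [hBσ] at h ⊢
      have hcard : (vanishingSet B g (σ i')).card ≤ (vanishingSet B g (σ i)).card := hσ hii
      have hsub : vanishingSet B g (σ i') ⊆ vanishingSet B g (σ i) := by
        rcases hcomp (σ i) (σ i') with h1 | h1
        · exact h1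
        · exact (Finset.eq_of_subset_of_card_le h1 hcard).ge
      exact mem_vanishingSet.1 (hsub (mem_vanishingSet.2 h))
    · by_contra! hzero
      obtain ⟨x, hx⟩ := hne j
      rw [(B.reindex σ.symm).map_eq_sum (g j) x] at hx
      exact hx (Finset.sum_eq_zero fun i _ => by rw [hzero, mul_zero])
  · push Not at hcomp
    obtain ⟨a, b, hba, hab⟩ := hcomp
    have hne' : a ≠ b := by
      rintro rfl
      exact hba (Finset.Subset.refl _)
    obtain ⟨B₁, hB₁, hc₁, hconv₁⟩ := B.exists_update_midpoint hne'
    obtain ⟨B₂, hB₂, hc₂, hconv₂⟩ := B.exists_update_midpoint hne'.symm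
    obtain ⟨hg₁, hlt₁⟩ := sum_card_vanishingSet_lt hg0 hB₁ hba
    obtain ⟨hg₂, hlt₂⟩ := sum_card_vanishingSet_lt hg0 hB₂ hab
    have hsub₁ : convexHull ℝ (Set.range B₁) ⊆ convexHull ℝ (Set.range B) := by
      rw [hconv₁]; exact Set.inter_subset_left
    have hsub₂ : convexHull ℝ (Set.range B₂) ⊆ convexHull ℝ (Set.range B) := by
      rw [hconv₂]; exact Set.inter_subset_left
    have hunion : convexHull ℝ (Set.range B) =
        convexHull ℝ (Set.range B₁) ∪ convexHull ℝ (Set.range B₂) := by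
      refine Set.Subset.antisymm (fun x hx => ?_) (Set.union_subset hsub₁ hsub₂)
      rw [hconv₁, hconv₂]
      exact (le_total (B.coord b x) (B.coord a x)).imp (fun h => ⟨hx, h⟩) fun h => ⟨hx, h⟩
    have hdisj : AEDisjoint volume (convexHull ℝ (Set.range B₁)) (convexHull ℝ (Set.range B₂)) := by
      refine measure_mono_null (fun x hx => ?_)
        ((convex_convexHull ℝ (Set.range B₁)).addHaar_frontier volume)
      refine ⟨subset_closure hx.1, fun hinterior => ?_⟩
      rw [B₁.interior_convexHull] at hinterior
      have h1 := hinterior a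
      have h2 := hx.2
      rw [hconv₂] at h2
      have h3 : B.coord a x ≤ B.coord b x := h2.2
      rw [hc₁] at h1
      linarith
    have hcompact : ∀ B : AffineBasis (Fin (n + 1)) ℝ (Fin n → ℝ),
        IsCompact (convexHull ℝ (Set.range B)) := fun B =>
      (Set.finite_range B).isCompact_convexHull ℝ
    refine ((ih _ (hN ▸ hlt₁) B₁ hg₁ (fun s x hx => hE s x (hsub₁ hx)) rfl).add
      (ih _ (hN ▸ hlt₂) B₂ hg₂ (fun s x hx => hE s x (hsub₂ hx)) rfl)).congr fun s hs => ?_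
    have hintegrable : IntegrableOn (fun x => (↑(∏ j, g j x) : ℂ) ^ s * E (s, fun i => (x i : ℂ)))
        (convexHull ℝ (Set.range B)) := by
      refine ContinuousOn.integrableOn_compact (hcompact B) (ContinuousOn.mul ?_ fun x hx => ?_)
      · exact ((continuous_ofReal_cpow_const hs).comp (continuous_finsetProd _ fun j _ =>
          (g j).continuous_of_finiteDimensional)).continuousOn
      · exact (ContinuousAt.comp (f := fun x : Fin n → ℝ => ((s, fun i => (x i : ℂ)) : ℂ × _))
          (hE s x hx).continuousAt (continuous_ofReal_pi s).continuousAt).continuousWithinAt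
    rw [hunion, setIntegral_union₀ hdisj (hcompact B₂).measurableSet.nullMeasurableSet
      (hintegrable.mono_set hsub₁) (hintegrable.mono_set hsub₂)]

end SimplexIntegral

/-- Meromorphic continuation of `∫_V (f₁⋯f_k)^s E(s,x) dx` to all of `ℂ`,
with poles only at rational points and of order at most `n`. -/
theorem stmt_0 (n k : ℕ) (hn : 1 ≤ n)
    (V : Set (Fin n → ℝ)) (v : Fin (n + 1) → (Fin n → ℝ))
    (hv : AffineIndependent ℝ v) (hV : V = convexHull ℝ (Set.range v))
    (f : Fin k → (Fin n → ℝ) → ℝ)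
    (hf_aff : ∀ j, ∃ (a : Fin n → ℝ) (c : ℝ), f j = fun x => c + ∑ i, a i * x i)
    (hf_pos : ∀ j, ∀ x ∈ interior V, 0 < f j x)
    (E : ℂ × (Fin n → ℂ) → ℂ)
    (U : Set (ℂ × (Fin n → ℂ))) (hU : IsOpen U)
    (hUV : ∀ (s : ℂ) (x : Fin n → ℝ), x ∈ V → (s, fun i => (x i : ℂ)) ∈ U)
    (hE : AnalyticOnNhd ℂ E U) :
    ∃ F : ℂ → ℂ,
      (∀ z : ℂ, MeromorphicAt F z) ∧
      (∀ s : ℂ, 0 < s.re →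
        F s = ∫ x in V, (↑(∏ j, f j x) : ℂ) ^ s * E (s, fun i => (x i : ℂ))) ∧
      (∀ s : ℂ, s ∉ Set.range ((↑) : ℚ → ℂ) → AnalyticAt ℂ F s) ∧
      (∀ s₀ : ℂ, ∃ C : ℝ, ∀ᶠ s in nhdsWithin s₀ {s₀}ᶜ, ‖(s - s₀) ^ n * F s‖ ≤ C) := by
  let B : AffineBasis (Fin (n + 1)) ℝ (Fin n → ℝ) :=
    ⟨v, hv, hv.affineSpan_eq_top_iff_card_eq_finrank_add_one.2 (by simp)⟩
  have hg : ∀ j, ∃ g : (Fin n → ℝ) →ᵃ[ℝ] ℝ, ⇑g = f j := by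
    intro j
    obtain ⟨a, c, h⟩ := hf_aff j
    refine ⟨AffineMap.const ℝ _ c + (Fintype.linearCombination ℝ a).toAffineMap, ?_⟩
    ext x
    simp [h, Fintype.linearCombination_apply, mul_comm]
  choose g hg using hg
  subst hV
  have hinterior : (interior (convexHull ℝ (Set.range v))).Nonempty :=
    ⟨_, B.centroid_mem_interior_convexHull⟩
  have hg0 : ∀ j i, 0 ≤ g j (B i) := by
    intro j i
    have hmem : v i ∈ closure (interior (convexHull ℝ (Set.range v))) := by
      rw [(convex_convexHull ℝ _).closure_interior_eq_closure_of_nonempty_interior hinterior]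
      exact subset_closure (subset_convexHull ℝ _ ⟨i, rfl⟩)
    exact closure_minimal (t := {x | 0 ≤ g j x})
      (fun x hx => by rw [Set.mem_ofPred_eq, hg]; exact (hf_pos j x hx).le)
      (isClosed_le continuous_const (g j).continuous_of_finiteDimensional) hmem
  have hne : ∀ j, ∃ x, g j x ≠ 0 := by
    intro j
    obtain ⟨x, hx⟩ := hinterior
    exact ⟨x, by rw [hg]; exact (hf_pos j x hx).ne'⟩
  have h := hasMeromorphicContinuation_of_affineBasis B g hg0 hne
    fun s x hx => hE _ (hUV s x hx)
  simp only [hg] at h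
  exact h
end

section
/- Let n ≥ 1, let V ⊆ ℝ^n be an n-dimensional simplex, let f₁,…,f_k : ℝ^n → ℝ be affine (degree ≤ 1) polynomials with real coefficients, each positive on the interior of V, and let E : ℂ × ℂ^n → ℂ be analytic on an open set containing ℂ × V (with V ⊆ ℝ^n ⊆ ℂ^n). Then there exists a function F : ℂ → ℂ, meromorphic on all of ℂ, such that F(s) = ∫_V (f₁(x)⋯f_k(x))^s · E(s,x) dx for every s with Re(s) > 0, and for every s₀ ∈ ℂ the function s ↦ (s−s₀)^k · F(s) is bounded on some punctured neighborhood of s₀; i.e. the meromorphic continuation of the integral has a pole of order at most k (the number of affine factors appearing) at every point of ℂ. -/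
open Complex MeasureTheory Filter

open Set Topology

/-- `I` extends from `0 < re s` to a function meromorphic on `-R < re s`
whose pole at `s` has order at most `c s`. -/
def HasContinuation (R : ℝ) (c : ℂ → ℕ) (I : ℂ → ℂ) : Prop :=
  ∃ F : ℂ → ℂ,
    (∀ s : ℂ, -R < s.re →
      MeromorphicAt F s ∧ ((-(c s : ℤ) : ℤ) : WithTop ℤ) ≤ meromorphicOrderAt F s) ∧
    ∀ s : ℂ, 0 < s.re → F s = I s

namespace HasContinuation

variable {R : ℝ} {c c' : ℂ → ℕ} {I I' : ℂ → ℂ}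

lemma congr (h : HasContinuation R c I) (hI : ∀ s : ℂ, 0 < s.re → I' s = I s) :
    HasContinuation R c I' := by
  obtain ⟨F, h1, h2⟩ := h
  exact ⟨F, h1, fun s hs => (h2 s hs).trans (hI s hs).symm⟩

lemma mono (h : HasContinuation R c I) (hc : ∀ s, c s ≤ c' s) : HasContinuation R c' I := by
  obtain ⟨F, h1, h2⟩ := h
  refine ⟨F, fun s hs => ⟨(h1 s hs).1, le_trans ?_ (h1 s hs).2⟩, h2⟩
  have := hc s
  exact_mod_cast (by lia : -(c' s : ℤ) ≤ -(c s : ℤ))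

lemma of_differentiableOn (h : DifferentiableOn ℂ I {s | -R < s.re}) :
    HasContinuation R c I := by
  refine ⟨I, fun s hs => ?_, fun s _ => rfl⟩
  have ha : AnalyticAt ℂ I s :=
    h.analyticAt ((isOpen_lt continuous_const continuous_re).mem_nhds hs)
  refine ⟨ha.meromorphicAt, le_trans ?_ ha.meromorphicOrderAt_nonneg⟩
  exact_mod_cast (by lia : -(c s : ℤ) ≤ 0)

lemma add (h : HasContinuation R c I) (h' : HasContinuation R c I') :
    HasContinuation R c (fun s => I s + I' s) := by
  obtain ⟨F, h1, h2⟩ := h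
  obtain ⟨F', h1', h2'⟩ := h'
  refine ⟨F + F', fun s hs => ⟨(h1 s hs).1.add (h1' s hs).1, ?_⟩, fun s hs => ?_⟩
  · exact le_trans (le_min (h1 s hs).2 (h1' s hs).2)
      (meromorphicOrderAt_add (h1 s hs).1 (h1' s hs).1)
  · simp [h2 s hs, h2' s hs]

lemma neg (h : HasContinuation R c I) : HasContinuation R c (fun s => - I s) := by
  obtain ⟨F, h1, h2⟩ := h
  refine ⟨-F, fun s hs => ⟨(h1 s hs).1.neg, ?_⟩, fun s hs => by simp [h2 s hs]⟩
  rw [← meromorphicOrderAt_neg]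
  exact (h1 s hs).2

lemma sum {α : Type*} (t : Finset α) {J : α → ℂ → ℂ} (h : ∀ a ∈ t, HasContinuation R c (J a)) :
    HasContinuation R c (fun s => ∑ a ∈ t, J a s) := by
  classical
  induction t using Finset.induction_on with
  | empty =>
    simp only [Finset.sum_empty]
    exact of_differentiableOn (differentiableOn_const _)
  | insert a t ha ih =>
    simp only [Finset.sum_insert ha]
    exact (h a (by simp)).add (ih fun b hb => h b (by simp [hb]))

open Classical in
/-- Dividing by `d s + m + 1` raises the order of the pole by one at the root of this factor. -/
lemma of_linear_mul {d m : ℕ} (hd : d ≠ 0)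
    (h : HasContinuation R c (fun s => ((d : ℂ) * s + m + 1) * I s)) :
    HasContinuation R (fun s => c s + if (d : ℂ) * s + m + 1 = 0 then 1 else 0) I := by
  obtain ⟨F, h1, h2⟩ := h
  set L : ℂ → ℂ := fun s => (d : ℂ) * s + m + 1 with hL
  have hd' : (d : ℂ) ≠ 0 := by exact_mod_cast hd
  have hLan (s : ℂ) : AnalyticAt ℂ L s := by fun_prop
  refine ⟨F / L, fun s hs => ⟨(h1 s hs).1.div (hLan s).meromorphicAt, ?_⟩, fun s hs => ?_⟩
  · rw [div_eq_mul_inv, meromorphicOrderAt_mul (h1 s hs).1 (hLan s).meromorphicAt.inv,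
      meromorphicOrderAt_inv]
    have key : meromorphicOrderAt L s = ((if (d : ℂ) * s + m + 1 = 0 then 1 else 0 : ℕ) : ℤ) := by
      split_ifs with h0
      · have : L = (fun _ => (d : ℂ)) * (fun z => z - s) := by
          funext z
          have : (m : ℂ) + 1 = - (d * s) := by linear_combination h0
          simp only [hL, Pi.mul_apply]
          linear_combination this
        rw [this, meromorphicOrderAt_mul (by fun_prop) (by fun_prop), meromorphicOrderAt_const,
          if_neg hd']
        simp
      · rw [(hLan s).meromorphicOrderAt_eq, (hLan s).analyticOrderAt_eq_zero.2 h0]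
        rfl
    rw [key]
    refine le_trans ?_ (add_le_add_left (h1 s hs).2 _)
    rw [show (-(((if (d : ℂ) * s + m + 1 = 0 then 1 else 0 : ℕ) : ℤ) : WithTop ℤ)) =
      ((-((if (d : ℂ) * s + m + 1 = 0 then 1 else 0 : ℕ) : ℤ) : ℤ) : WithTop ℤ) from rfl]
    rw [← WithTop.coe_add, WithTop.coe_le_coe]
    push_cast
    lia
  · rw [Pi.div_apply, h2 s hs, div_eq_iff, mul_comm]
    intro h0
    have := congrArg re h0
    simp [hL] at this
    nlinarith [(by positivity : (0 : ℝ) ≤ d), (by positivity : (0 : ℝ) ≤ m)]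

/-- Continuations to all half planes glue to a continuation to the plane. -/
lemma glue {k : ℕ} (h : ∀ R : ℕ, HasContinuation R (fun _ => k) I) :
    ∃ F : ℂ → ℂ, (∀ z, MeromorphicAt F z) ∧ (∀ s : ℂ, 0 < s.re → F s = I s) ∧
      ∀ s₀ : ℂ, ∃ C : ℝ, ∀ᶠ s in 𝓝[≠] s₀, ‖(s - s₀) ^ k * F s‖ ≤ C := by
  choose F hF1 hF2 using h
  have agree : ∀ (A B : ℕ) (s₀ : ℂ), -(A : ℝ) < s₀.re → -(B : ℝ) < s₀.re →
      F A =ᶠ[𝓝[≠] s₀] F B := by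
    intro A B s₀ hA hB
    set W : Set ℂ := {s | max (-(A : ℝ)) (-(B : ℝ)) < s.re} with hW
    have hmer : MeromorphicOn (F A - F B) W := fun s hs =>
      (hF1 A s ((le_max_left _ _).trans_lt hs)).1.sub (hF1 B s ((le_max_right _ _).trans_lt hs)).1
    have hpre : IsPreconnected W := (convex_halfSpace_re_gt _).isPreconnected
    have h1 : (1 : ℂ) ∈ W := by
      simp only [hW, mem_ofPred_eq, one_re, max_lt_iff]
      constructor <;> linarith [(by positivity : (0 : ℝ) ≤ A), (by positivity : (0 : ℝ) ≤ B)]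
    have hs₀ : s₀ ∈ W := max_lt hA hB
    have htop1 : meromorphicOrderAt (F A - F B) 1 = ⊤ := by
      rw [meromorphicOrderAt_eq_top_iff]
      have : ∀ᶠ s : ℂ in 𝓝[≠] 1, 0 < s.re :=
        nhdsWithin_le_nhds ((isOpen_lt continuous_const continuous_re).mem_nhds (by simp))
      filter_upwards [this] with s hs
      simp [hF2 A s hs, hF2 B s hs]
    have htop : meromorphicOrderAt (F A - F B) s₀ = ⊤ := by
      by_contra hne
      exact hmer.meromorphicOrderAt_ne_top_of_isPreconnected hpre hs₀ h1 hne htop1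
    filter_upwards [meromorphicOrderAt_eq_top_iff.1 htop] with s hs
    exact sub_eq_zero.1 hs
  set G : ℂ → ℂ := fun s => if 0 < s.re then I s else F (⌊‖s‖⌋₊ + 2) s with hG
  have hre (s : ℂ) (A : ℕ) (hA : ‖s‖ < A) : -(A : ℝ) < s.re := by
    linarith [(abs_le.1 (abs_re_le_norm s)).1]
  have hfloor (s : ℂ) : ‖s‖ < ((⌊‖s‖⌋₊ + 2 : ℕ) : ℝ) := by
    push_cast
    linarith [Nat.lt_floor_add_one ‖s‖]
  have hGF (s₀ : ℂ) : F (⌊‖s₀‖⌋₊ + 2) =ᶠ[𝓝[≠] s₀] G := by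
    have hball : ∀ᶠ s in 𝓝[≠] s₀, ‖s - s₀‖ < 1 := nhdsWithin_le_nhds
      ((isOpen_lt (by fun_prop) continuous_const).mem_nhds (by simp : ‖s₀ - s₀‖ < 1))
    have hall : ∀ᶠ s in 𝓝[≠] s₀, ∀ A ∈ Finset.range (⌊‖s₀‖⌋₊ + 4), ‖s₀‖ < A →
        F (⌊‖s₀‖⌋₊ + 2) s = F A s := by
      rw [Filter.eventually_all_finset]
      intro A _
      by_cases hA : ‖s₀‖ < A
      · filter_upwards [agree _ A s₀ (hre _ _ (hfloor s₀)) (hre _ _ hA)] with s hs _ using hs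
      · exact Eventually.of_forall fun s h => absurd h hA
    filter_upwards [hball, hall] with s hs hs'
    have hlt : ‖s₀‖ < ((⌊‖s‖⌋₊ + 2 : ℕ) : ℝ) := by
      push_cast
      linarith [Nat.lt_floor_add_one ‖s‖, norm_sub_norm_le s₀ s, norm_sub_rev s₀ s]
    have hmem : ⌊‖s‖⌋₊ + 2 < ⌊‖s₀‖⌋₊ + 4 := by
      have : ⌊‖s‖⌋₊ ≤ ⌊‖s₀‖ + 1⌋₊ :=
        Nat.floor_le_floor (by linarith [norm_sub_norm_le s s₀])
      rw [Nat.floor_add_one (norm_nonneg _)] at this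
      omega
    have heq := hs' _ (Finset.mem_range.2 hmem) hlt
    rw [heq]
    by_cases h0 : 0 < s.re
    · simp only [hG, if_pos h0, hF2 _ s h0]
    · simp only [hG, if_neg h0]
  have hloc (s₀ : ℂ) := hF1 (⌊‖s₀‖⌋₊ + 2) s₀ (hre _ _ (hfloor s₀))
  refine ⟨G, fun z => (hloc z).1.congr (hGF z), fun s hs => if_pos hs, fun s₀ => ?_⟩
  have hm : MeromorphicAt G s₀ := (hloc s₀).1.congr (hGF s₀)
  have hord : ((-(k : ℤ) : ℤ) : WithTop ℤ) ≤ meromorphicOrderAt G s₀ := by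
    rw [← meromorphicOrderAt_congr (hGF s₀)]
    exact (hloc s₀).2
  have hpow : MeromorphicAt ((fun s => s - s₀) ^ k) s₀ := by fun_prop
  have hnn : 0 ≤ meromorphicOrderAt ((fun s => s - s₀) ^ k * G) s₀ := by
    rw [meromorphicOrderAt_mul hpow hm]
    have e : meromorphicOrderAt ((fun s => s - s₀) ^ k) s₀ = ((k : ℤ) : WithTop ℤ) := by
      simp
    rw [e]
    refine le_trans ?_ (add_le_add_right hord _)
    rw [← WithTop.coe_add]
    simp
  obtain ⟨l, hl⟩ := tendsto_nhds_of_meromorphicOrderAt_nonneg (hpow.mul hm) hnn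
  refine ⟨‖l‖ + 1, ?_⟩
  filter_upwards [hl.norm.eventually (gt_mem_nhds (lt_add_one ‖l‖))] with s hs
  exact le_of_lt hs

end HasContinuation

/-- A locally bounded integral of holomorphic functions is holomorphic. -/
lemma differentiableOn_integral_of_locally_bounded {α : Type*} [MeasurableSpace α]
    {μ : Measure α} [IsFiniteMeasure μ] {S : Set ℂ} (hS : IsOpen S) {φ : ℂ → α → ℂ}
    (hm : ∀ s ∈ S, AEStronglyMeasurable (φ s) μ)
    (hd : ∀ᵐ t ∂μ, DifferentiableOn ℂ (fun s => φ s t) S)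
    (hb : ∀ s₀ ∈ S, ∃ r > 0, ∃ C, Metric.ball s₀ r ⊆ S ∧
      ∀ᵐ t ∂μ, ∀ s ∈ Metric.ball s₀ r, ‖φ s t‖ ≤ C) :
    DifferentiableOn ℂ (fun s => ∫ t, φ s t ∂μ) S := by
  intro s₀ hs₀
  obtain ⟨r, hr, C, hrS, hC⟩ := hb s₀ hs₀
  have hderiv : ∀ᵐ t ∂μ, ∀ s ∈ S, HasDerivAt (fun s => φ s t) (deriv (fun s => φ s t) s) s := by
    filter_upwards [hd] with t ht s hs
    exact (ht.differentiableAt (hS.mem_nhds hs)).hasDerivAt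
  have hmeas : AEStronglyMeasurable (fun t => deriv (fun s => φ s t) s₀) μ := by
    set u : ℕ → ℂ := fun n => s₀ + ((r / (n + 2) : ℝ) : ℂ) with hu
    have hlim : Tendsto u atTop (𝓝[≠] s₀) := by
      refine tendsto_nhdsWithin_iff.2 ⟨?_, Eventually.of_forall fun n => ?_⟩
      · have h1 : Tendsto (fun n : ℕ => (r / ((n : ℝ) + 2) : ℝ)) atTop (𝓝 0) :=
          tendsto_const_nhds.div_atTop
            (tendsto_atTop_add_const_right _ _ tendsto_natCast_atTop_atTop)
        have h2 := (continuous_ofReal.tendsto (0 : ℝ)).comp h1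
        simpa [hu, Function.comp_def] using h2.const_add s₀
      · have : r / ((n : ℝ) + 2) ≠ 0 := by positivity
        simpa [hu] using (by exact_mod_cast this : (r : ℂ) / ((n : ℂ) + 2) ≠ 0)
    have huS (n : ℕ) : u n ∈ S := by
      apply hrS
      have h0 : (0 : ℝ) < (n : ℝ) + 2 := by positivity
      have : ‖((r / (n + 2) : ℝ) : ℂ)‖ < r := by
        rw [norm_real, Real.norm_of_nonneg (by positivity), div_lt_iff₀ h0]
        nlinarith [(by positivity : (0 : ℝ) ≤ n)]
      simpa [hu, Metric.mem_ball, dist_eq_norm] using this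
    refine aestronglyMeasurable_of_tendsto_ae atTop
      (f := fun n t => slope (fun s => φ s t) s₀ (u n)) (fun n => ?_) ?_
    · simp only [slope_def_field]
      exact ((hm _ (huS n)).sub (hm _ hs₀)).div₀ aestronglyMeasurable_const
    · filter_upwards [hderiv] with t ht
      exact (hasDerivAt_iff_tendsto_slope.1 (ht s₀ hs₀)).comp hlim
  have hbound : ∀ᵐ t ∂μ, ∀ s ∈ Metric.ball s₀ (r / 2),
      ‖deriv (fun s => φ s t) s‖ ≤ C / (r / 4) := by
    filter_upwards [hC, hd] with t ht hdt s hs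
    have hsub : Metric.closedBall s (r / 4) ⊆ Metric.ball s₀ r := fun z hz => by
      rw [Metric.mem_ball] at hs ⊢
      rw [Metric.mem_closedBall] at hz
      linarith [dist_triangle z s s₀]
    refine norm_deriv_le_of_forall_mem_sphere_norm_le (by positivity) ?_ fun z hz =>
      ht z (hsub (Metric.sphere_subset_closedBall hz))
    exact (hdt.mono (hsub.trans hrS)).diffContOnCl_ball subset_rfl
  refine (hasDerivAt_integral_of_dominated_loc_of_deriv_le
    (F := φ) (F' := fun s t => deriv (fun s => φ s t) s)
    (Metric.ball_mem_nhds s₀ (by positivity : 0 < r / 2)) ?_ ?_ hmeas hbound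
    (integrable_const _) ?_).2.differentiableAt.differentiableWithinAt
  · filter_upwards [hS.mem_nhds hs₀] with s hs using hm s hs
  · exact Integrable.of_bound (hm s₀ hs₀) C
      (hC.mono fun t ht => ht s₀ (Metric.mem_ball_self hr))
  · filter_upwards [hderiv] with t ht s hs
    exact ht s (hrS (Metric.ball_subset_ball (by linarith) hs))

lemma integrableOn_of_continuousOn_of_bounded {α : Type*} [TopologicalSpace α]
    [MeasurableSpace α] [OpensMeasurableSpace α] [SecondCountableTopologyEither α ℂ]
    {μ : Measure α} {A : Set α} (hA : MeasurableSet A) (hμ : μ A ≠ ⊤) {φ : α → ℂ}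
    (hφ : ContinuousOn φ A) {C : ℝ} (hC : ∀ x ∈ A, ‖φ x‖ ≤ C) : IntegrableOn φ A μ :=
  IntegrableOn.of_bound hμ.lt_top (hφ.aestronglyMeasurable hA) C
    ((ae_restrict_iff' hA).2 (Eventually.of_forall hC))

lemma volume_affine_zero_set {E : Type*} [NormedAddCommGroup E] [NormedSpace ℝ E]
    [MeasurableSpace E] [BorelSpace E] [FiniteDimensional ℝ E] (μ : Measure E)
    [μ.IsAddHaarMeasure] (h : E →ᵃ[ℝ] ℝ) {x₀ : E} (hx₀ : h x₀ ≠ 0) : μ {x | h x = 0} = 0 := by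
  have := Measure.addHaar_affineSubspace μ ((AffineSubspace.mk' (0 : ℝ) ⊥).comap h) ?_
  · convert! this
    ext x
    rw [SetLike.mem_coe, AffineSubspace.mem_comap, AffineSubspace.mem_mk']
    simp
  · intro htop
    have : x₀ ∈ (AffineSubspace.mk' (0 : ℝ) ⊥).comap h := htop ▸ AffineSubspace.mem_top ℝ E x₀
    rw [AffineSubspace.mem_comap, AffineSubspace.mem_mk'] at this
    exact hx₀ (by simpa using this)

/-- An integral splits according to which of the functions `c i` is largest. -/
lemma setIntegral_eq_sum_argmax {α β : Type*} [MeasurableSpace α] {μ : Measure α} {A : Set α}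
    (hA : MeasurableSet A) {S : Finset β} (hS : S.Nonempty) {c : β → α → ℝ}
    (hc : ∀ i, Measurable (c i)) (hnull : ∀ i j, i ≠ j → μ {x | c i x = c j x} = 0)
    {g : α → ℂ} (hg : IntegrableOn g A μ) :
    ∫ x in A, g x ∂μ = ∑ i ∈ S, ∫ x in {x ∈ A | ∀ j ∈ S, c j x ≤ c i x}, g x ∂μ := by
  have hU : (⋃ i : S, {x ∈ A | ∀ j ∈ S, c j x ≤ c i x}) = A := by
    ext x
    simp only [mem_iUnion, mem_ofPred_eq, exists_and_left, and_iff_left_iff_imp]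
    intro _
    obtain ⟨i, hi, hmax⟩ := S.exists_max_image (fun i => c i x) hS
    exact ⟨⟨i, hi⟩, hmax⟩
  conv_lhs => rw [← hU]
  rw [integral_iUnion_ae (fun i => ?_) (fun i j hij => ?_) (by rwa [hU]), tsum_fintype,
    Finset.sum_coe_sort S fun i => ∫ x in {x ∈ A | ∀ j ∈ S, c j x ≤ c i x}, g x ∂μ]
  · have : {x ∈ A | ∀ j ∈ S, c j x ≤ c i x} = A ∩ ⋂ j ∈ S, {x | c j x ≤ c i x} := by
      ext x
      simp
    rw [this]
    exact (hA.inter (Finset.measurableSet_biInter S fun j _ =>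
      measurableSet_le (hc j) (hc i))).nullMeasurableSet
  · refine measure_mono_null ?_ (hnull i j fun h => hij (Subtype.ext h))
    rintro x ⟨hx, hx'⟩
    exact le_antisymm (hx'.2 i i.2) (hx.2 j j.2)

section Cube

variable {ι : Type*}

/-- The half-open unit cube. -/
def unitCube (ι : Type*) : Set (ι → ℝ) := univ.pi fun _ => Ioc 0 1

/-- The product of `ℂ` and the real points of the closed unit cube. -/
def cubePoints (ι : Type*) : Set (ℂ × (ι → ℂ)) :=
  {p | ∃ t : ι → ℝ, (∀ i, t i ∈ Icc (0 : ℝ) 1) ∧ p.2 = fun i => (t i : ℂ)}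

lemma mem_unitCube {t : ι → ℝ} : t ∈ unitCube ι ↔ ∀ i, t i ∈ Ioc (0 : ℝ) 1 := by
  simp [unitCube]

lemma mem_cubePoints {s : ℂ} {t : ι → ℝ} (ht : t ∈ unitCube ι) :
    (s, fun i => (t i : ℂ)) ∈ cubePoints ι :=
  ⟨t, fun i => Ioc_subset_Icc_self (mem_unitCube.1 ht i), rfl⟩

variable [Fintype ι]

lemma measurableSet_unitCube : MeasurableSet (unitCube ι) :=
  MeasurableSet.univ_pi fun _ => measurableSet_Ioc

lemma volume_unitCube : volume (unitCube ι) = 1 := by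
  simp [unitCube, volume_pi_pi]

lemma AnalyticOnNhd.continuousOn_unitCube {G : ℂ × (ι → ℂ) → ℂ}
    (hG : AnalyticOnNhd ℂ G (cubePoints ι)) (s : ℂ) :
    ContinuousOn (fun t : ι → ℝ => G (s, fun i => (t i : ℂ))) (unitCube ι) :=
  hG.continuousOn.comp (by fun_prop) fun _ ht => mem_cubePoints ht

lemma AnalyticOnNhd.bounded_unitCube {G : ℂ × (ι → ℂ) → ℂ}
    (hG : AnalyticOnNhd ℂ G (cubePoints ι)) (s₀ : ℂ) (r : ℝ) :
    ∃ C, ∀ s ∈ Metric.closedBall s₀ r, ∀ t ∈ unitCube ι, ‖G (s, fun i => (t i : ℂ))‖ ≤ C := by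
  have hK : IsCompact (Metric.closedBall s₀ r ×ˢ (univ.pi fun _ : ι => Icc (0 : ℝ) 1)) :=
    (isCompact_closedBall _ _).prod (isCompact_univ_pi fun _ => isCompact_Icc)
  have hc : ContinuousOn (fun p : ℂ × (ι → ℝ) => G (p.1, fun i => (p.2 i : ℂ)))
      (Metric.closedBall s₀ r ×ˢ (univ.pi fun _ : ι => Icc (0 : ℝ) 1)) :=
    hG.continuousOn.comp (by fun_prop) fun p hp => ⟨p.2, fun i => hp.2 i trivial, rfl⟩
  obtain ⟨C, hC⟩ := hK.exists_bound_of_continuousOn hc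
  exact ⟨C, fun s hs t ht => hC (s, t)
    ⟨hs, fun i _ => Ioc_subset_Icc_self (mem_unitCube.1 ht i)⟩⟩

variable [DecidableEq ι]

lemma measurePreserving_update (μ : Measure ℝ) [IsProbabilityMeasure μ] (i : ι) :
    MeasurePreserving (fun p : (ι → ℝ) × ℝ => Function.update p.1 i p.2)
      ((Measure.pi fun _ => μ).prod μ) (Measure.pi fun _ => μ) := by
  have hmeas : Measurable fun p : (ι → ℝ) × ℝ => Function.update p.1 i p.2 := by
    refine measurable_pi_iff.2 fun j => ?_
    by_cases h : j = i
    · subst h; simpa using measurable_snd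
    · simpa [h, Function.comp_def] using
        (measurable_pi_apply (X := fun _ : ι => ℝ) j).comp measurable_fst
  refine ⟨hmeas, (Measure.pi_eq fun S hS => ?_).symm⟩
  rw [Measure.map_apply hmeas (MeasurableSet.univ_pi hS)]
  have : (fun p : (ι → ℝ) × ℝ => Function.update p.1 i p.2) ⁻¹' univ.pi S =
      (univ.pi (Function.update S i univ)) ×ˢ (S i) := by
    ext p
    simp only [mem_preimage, mem_univ_pi, mem_prod]
    constructor
    · refine fun h => ⟨fun j => ?_, by simpa using h i⟩
      by_cases hj : j = i
      · subst hj; simp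
      · simpa [hj] using h j
    · rintro ⟨h1, h2⟩ j
      by_cases hj : j = i
      · subst hj; simpa using h2
      · simpa [hj] using h1 j
  rw [this, Measure.prod_prod, Measure.pi_pi, ← Finset.mul_prod_erase _ _ (Finset.mem_univ i),
    ← Finset.mul_prod_erase Finset.univ (fun j => μ (S j)) (Finset.mem_univ i), mul_comm]
  simp only [Function.update_self, measure_univ, one_mul]
  congr 1
  exact Finset.prod_congr rfl fun j hj => by simp [Finset.ne_of_mem_erase hj]

lemma unitCube_average {ψ : (ι → ℝ) → ℂ} (hψ : IntegrableOn ψ (unitCube ι)) (i : ι) :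
    IntegrableOn (fun t => ∫ u in Ioc (0 : ℝ) 1, ψ (Function.update t i u)) (unitCube ι) ∧
    ∫ t in unitCube ι, ψ t =
      ∫ t in unitCube ι, ∫ u in Ioc (0 : ℝ) 1, ψ (Function.update t i u) := by
  set μ : Measure ℝ := volume.restrict (Ioc 0 1) with hμ
  have : IsProbabilityMeasure μ := ⟨by simp [hμ]⟩
  have hres : (volume : Measure (ι → ℝ)).restrict (unitCube ι) = Measure.pi fun _ => μ := by
    rw [volume_pi, unitCube, Measure.restrict_pi_pi]
  have hmp := measurePreserving_update μ i
  unfold IntegrableOn at hψ ⊢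
  rw [hres] at hψ ⊢
  have hint := hmp.integrable_comp_of_integrable hψ
  refine ⟨hint.integral_prod_left, ?_⟩
  rw [← hmp.map_eq, integral_map hmp.aemeasurable (by rw [hmp.map_eq]; exact hψ.1),
    hmp.map_eq]
  exact integral_prod _ hint

lemma integral_cpow_by_parts {h h' : ℝ → ℂ} (hh : ∀ u ∈ Icc (0 : ℝ) 1, HasDerivAt h (h' u) u)
    (hh' : ContinuousOn h' (Icc 0 1)) {z : ℂ} (hz : 0 < z.re) :
    (z + 1) * ∫ u in Ioc (0 : ℝ) 1, (u : ℂ) ^ z * h u =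
      h 1 - ∫ u in Ioc (0 : ℝ) 1, (u : ℂ) ^ (z + 1) * h' u := by
  have hz1 : z + 1 ≠ 0 := fun h0 => by
    have := congrArg re h0
    simp at this
    linarith
  have hh0 : ContinuousOn h (Icc 0 1) := fun u hu => (hh u hu).continuousAt.continuousWithinAt
  have c1 : Continuous fun u : ℝ => (u : ℂ) ^ z := continuous_ofReal_cpow_const hz
  have c2 : Continuous fun u : ℝ => (u : ℂ) ^ (z + 1) :=
    continuous_ofReal_cpow_const (by simp; linarith)
  have i1 : IntervalIntegrable (fun u : ℝ => (z + 1) * ((u : ℂ) ^ z * h u)) volume 0 1 :=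
    ContinuousOn.intervalIntegrable_of_Icc zero_le_one
      (continuousOn_const.mul (c1.continuousOn.mul hh0))
  have i2 : IntervalIntegrable (fun u : ℝ => (u : ℂ) ^ (z + 1) * h' u) volume 0 1 :=
    ContinuousOn.intervalIntegrable_of_Icc zero_le_one (c2.continuousOn.mul hh')
  have ftc := intervalIntegral.integral_eq_sub_of_hasDerivAt_of_le (zero_le_one' ℝ)
    (f := fun u : ℝ => (u : ℂ) ^ (z + 1) * h u)
    (f' := fun u : ℝ => (z + 1) * ((u : ℂ) ^ z * h u) + (u : ℂ) ^ (z + 1) * h' u)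
    (c2.continuousOn.mul hh0) (fun u hu => ?_) (i1.add i2)
  · rw [intervalIntegral.integral_add i1 i2, intervalIntegral.integral_const_mul] at ftc
    rw [← intervalIntegral.integral_of_le zero_le_one,
      ← intervalIntegral.integral_of_le zero_le_one]
    simp only [ofReal_one, one_cpow, one_mul, ofReal_zero, zero_cpow hz1, zero_mul, sub_zero] at ftc
    linear_combination ftc
  · have d1 := (hasDerivAt_ofReal_cpow_const hu.1.ne' hz1)
    rw [add_sub_cancel_right] at d1
    convert! d1.mul (hh u (Ioo_subset_Icc_self hu)) using 1
    ring

omit [DecidableEq ι] in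
lemma analyticAt_coord (i : ι) (p : ℂ × (ι → ℂ)) :
    AnalyticAt ℂ (fun p : ℂ × (ι → ℂ) => p.2 i) p :=
  (ContinuousLinearMap.proj (R := ℂ) (φ := fun _ : ι => ℂ) i
    ∘L ContinuousLinearMap.snd ℂ ℂ (ι → ℂ)).analyticAt p

/-- The factor `∏ i, t i ^ (d i * s + m i)`. -/
noncomputable def cubeMonomial (d m : ι → ℕ) (s : ℂ) (t : ι → ℝ) : ℂ :=
  ∏ i, (t i : ℂ) ^ ((d i : ℂ) * s + m i)

section Monomial

omit [DecidableEq ι]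

variable {d m : ι → ℕ} {s : ℂ} {t : ι → ℝ}

lemma norm_cubeMonomial_le_one (hre : ∀ i, 0 ≤ ((d i : ℂ) * s + m i).re) (ht : t ∈ unitCube ι) :
    ‖cubeMonomial d m s t‖ ≤ 1 := by
  rw [cubeMonomial, norm_prod]
  refine Finset.prod_le_one (fun _ _ => norm_nonneg _) fun i _ => ?_
  obtain ⟨h0, h1⟩ := mem_unitCube.1 ht i
  rw [norm_cpow_eq_rpow_re_of_pos h0]
  exact Real.rpow_le_one h0.le h1 (hre i)

lemma continuousOn_cubeMonomial : ContinuousOn (cubeMonomial d m s) (unitCube ι) := by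
  intro t ht
  refine ContinuousAt.continuousWithinAt ?_
  refine tendsto_finsetProd _ fun i _ => ?_
  exact ContinuousAt.comp (f := fun t : ι → ℝ => t i) (g := fun u : ℝ => (u : ℂ) ^ _)
    (continuousAt_ofReal_cpow_const (t i) _ (Or.inr (mem_unitCube.1 ht i).1.ne'))
    (continuous_apply i).continuousAt

lemma differentiable_cubeMonomial (ht : t ∈ unitCube ι) :
    Differentiable ℂ fun s => cubeMonomial d m s t := by
  unfold cubeMonomial
  refine Differentiable.fun_finsetProd fun i _ => ?_
  have h0 : (t i : ℂ) ≠ 0 := by exact_mod_cast (mem_unitCube.1 ht i).1.ne'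
  exact Differentiable.const_cpow (by fun_prop) (Or.inl h0)

end Monomial

/-- The integral of `∏ i, t i ^ (d i * s + m i) * G (s, t)` over the unit cube. -/
noncomputable def cubeIntegral (d m : ι → ℕ) (G : ℂ × (ι → ℂ) → ℂ) (s : ℂ) : ℂ :=
  ∫ t in unitCube ι, cubeMonomial d m s t * G (s, fun i => (t i : ℂ))

lemma linear_re_nonneg (d m : ℕ) {s : ℂ} (hs : 0 < s.re) : 0 ≤ ((d : ℂ) * s + m).re := by
  simp only [add_re, mul_re, natCast_re, natCast_im, zero_mul, sub_zero]
  positivity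

variable {d m : ι → ℕ} {G : ℂ × (ι → ℂ) → ℂ} {s : ℂ}

omit [DecidableEq ι] in
lemma integrableOn_cubeMonomial_mul (hG : AnalyticOnNhd ℂ G (cubePoints ι))
    (hre : ∀ i, 0 ≤ ((d i : ℂ) * s + m i).re) :
    IntegrableOn (fun t => cubeMonomial d m s t * G (s, fun i => (t i : ℂ))) (unitCube ι) := by
  obtain ⟨C, hC⟩ := hG.bounded_unitCube s 0
  refine integrableOn_of_continuousOn_of_bounded measurableSet_unitCube
    (by simp [volume_unitCube]) (continuousOn_cubeMonomial.mul (hG.continuousOn_unitCube s))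
    (C := C) fun t ht => ?_
  rw [norm_mul]
  have h1 := hC s (by simp) t ht
  exact (mul_le_of_le_one_left (norm_nonneg _) (norm_cubeMonomial_le_one hre ht)).trans h1

omit [DecidableEq ι] in
lemma differentiableOn_cubeIntegral (hG : AnalyticOnNhd ℂ G (cubePoints ι)) {R : ℝ}
    (hd : ∀ i, d i ≠ 0 → d i * R ≤ m i) :
    DifferentiableOn ℂ (cubeIntegral d m G) {s | -R < s.re} := by
  have hS : IsOpen {s : ℂ | -R < s.re} := isOpen_lt continuous_const continuous_re
  have hre : ∀ s : ℂ, -R < s.re → ∀ i, 0 ≤ ((d i : ℂ) * s + m i).re := by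
    intro s hs i
    simp only [add_re, mul_re, natCast_re, natCast_im, zero_mul, sub_zero]
    by_cases h0 : d i = 0
    · simp [h0]
    · have := hd i h0
      have h1 : (0 : ℝ) ≤ d i := by positivity
      nlinarith
  have hfin : IsFiniteMeasure ((volume : Measure (ι → ℝ)).restrict (unitCube ι)) :=
    ⟨by simp [volume_unitCube]⟩
  refine differentiableOn_integral_of_locally_bounded hS (fun s hs =>
    (integrableOn_cubeMonomial_mul hG (hre s hs)).1) ?_ fun s₀ hs₀ => ?_
  · refine (ae_restrict_iff' measurableSet_unitCube).2 (Eventually.of_forall fun t ht => ?_)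
    refine (differentiable_cubeMonomial ht).differentiableOn.mul fun s _ => ?_
    refine DifferentiableAt.differentiableWithinAt ?_
    exact (hG _ (mem_cubePoints ht)).differentiableAt.comp s
      (differentiableAt_id.prodMk (differentiableAt_const _))
  · obtain ⟨r, hr, hball⟩ := Metric.isOpen_iff.1 hS s₀ hs₀
    obtain ⟨C, hC⟩ := hG.bounded_unitCube s₀ r
    refine ⟨r, hr, C, hball, (ae_restrict_iff' measurableSet_unitCube).2
      (Eventually.of_forall fun t ht s hs => ?_)⟩
    rw [norm_mul]
    have h1 := hC s (Metric.ball_subset_closedBall hs) t ht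
    exact (mul_le_of_le_one_left (norm_nonneg _)
      (norm_cubeMonomial_le_one (hre s (hball hs)) ht)).trans h1

/-- The restriction of `G` to the face `t i = 1`. -/
def faceRestrict (i : ι) (G : ℂ × (ι → ℂ) → ℂ) (p : ℂ × (ι → ℂ)) : ℂ :=
  G (p.1, Function.update p.2 i 1)

/-- The partial derivative of `G` in the `i`-th cube variable. -/
noncomputable def cubeDeriv (i : ι) (G : ℂ × (ι → ℂ) → ℂ) (p : ℂ × (ι → ℂ)) : ℂ :=
  fderiv ℂ G p (0, Pi.single i 1)

lemma AnalyticOnNhd.cubeDeriv (hG : AnalyticOnNhd ℂ G (cubePoints ι)) (i : ι) :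
    AnalyticOnNhd ℂ (cubeDeriv i G) (cubePoints ι) := fun p hp =>
  AnalyticAt.comp (g := ContinuousLinearMap.apply ℂ ℂ ((0 : ℂ), (Pi.single i (1 : ℂ) : ι → ℂ)))
    (ContinuousLinearMap.analyticAt _ _) (hG.fderiv p hp)

omit [Fintype ι] in
lemma ofReal_update (t : ι → ℝ) (i : ι) (u : ℝ) :
    (fun j => ((Function.update t i u j : ℝ) : ℂ)) =
      Function.update (fun j => (t j : ℂ)) i (u : ℂ) := by
  ext j
  by_cases h : j = i
  · subst h; simp
  · simp [h]

lemma AnalyticOnNhd.faceRestrict (hG : AnalyticOnNhd ℂ G (cubePoints ι)) (i : ι) :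
    AnalyticOnNhd ℂ (faceRestrict i G) (cubePoints ι) := by
  rintro ⟨s, p⟩ ⟨t, ht, rfl⟩
  refine AnalyticAt.comp (g := G) (f := fun p : ℂ × (ι → ℂ) => (p.1, Function.update p.2 i 1))
    (hG _ ⟨Function.update t i 1, fun j => ?_, ?_⟩) ?_
  · by_cases h : j = i
    · subst h; simp
    · simpa [h] using ht j
  · simp [ofReal_update]
  · refine analyticAt_fst.prod (AnalyticAt.pi fun j => ?_)
    by_cases h : j = i
    · subst h; simpa using analyticAt_const
    · simpa only [Function.update_of_ne h] using analyticAt_coord j _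

lemma cubeMonomial_update (t : ι → ℝ) (i : ι) (u : ℝ) :
    cubeMonomial d m s (Function.update t i u) =
      (u : ℂ) ^ ((d i : ℂ) * s + m i) *
        cubeMonomial (Function.update d i 0) (Function.update m i 0) s t := by
  rw [cubeMonomial, cubeMonomial, ← Finset.mul_prod_erase _ _ (Finset.mem_univ i),
    ← Finset.mul_prod_erase Finset.univ (fun j => (t j : ℂ) ^ _) (Finset.mem_univ i)]
  simp only [Function.update_self, Nat.cast_zero, zero_mul, add_zero, cpow_zero, one_mul]
  congr 1
  exact Finset.prod_congr rfl fun j hj => by simp [Finset.ne_of_mem_erase hj]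

lemma cubeIntegral_by_parts (hG : AnalyticOnNhd ℂ G (cubePoints ι)) {i : ι} (hd : d i ≠ 0)
    (hs : 0 < s.re) :
    ((d i : ℂ) * s + m i + 1) * cubeIntegral d m G s =
      cubeIntegral (Function.update d i 0) (Function.update m i 0) (faceRestrict i G) s +
        - cubeIntegral d (Function.update m i (m i + 1)) (cubeDeriv i G) s := by
  have hz : 0 < ((d i : ℂ) * s + m i).re := by
    have : (0 : ℝ) < d i := by exact_mod_cast Nat.pos_of_ne_zero hd
    simp only [add_re, mul_re, natCast_re, natCast_im, zero_mul, sub_zero]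
    positivity
  have hD := hG.cubeDeriv i
  have int1 := integrableOn_cubeMonomial_mul (d := d) (m := m) hG
    fun j => linear_re_nonneg (d j) (m j) hs
  have int2 := integrableOn_cubeMonomial_mul (d := d) (m := Function.update m i (m i + 1)) hD
    fun j => linear_re_nonneg (d j) _ hs
  have int3 := integrableOn_cubeMonomial_mul (d := Function.update d i 0)
    (m := Function.update m i 0) (hG.faceRestrict i) fun j => linear_re_nonneg _ _ hs
  obtain ⟨-, av1⟩ := unitCube_average int1 i
  obtain ⟨int2', av2⟩ := unitCube_average int2 i
  unfold cubeIntegral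
  rw [av1, av2, ← integral_const_mul, ← sub_eq_add_neg, ← integral_sub int3 int2']
  refine setIntegral_congr_fun measurableSet_unitCube fun t ht => ?_
  simp only [cubeMonomial_update, ofReal_update, Function.update_self, Function.update_idem]
  set W := cubeMonomial (Function.update d i 0) (Function.update m i 0) s t
  have hmem : ∀ u ∈ Icc (0 : ℝ) 1,
      (s, Function.update (fun j => (t j : ℂ)) i (u : ℂ)) ∈ cubePoints ι := by
    intro u hu
    refine ⟨Function.update t i u, fun j => ?_, (ofReal_update t i u).symm⟩
    by_cases h : j = i
    · subst h; simpa using hu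
    · simpa [h] using Ioc_subset_Icc_self (mem_unitCube.1 ht j)
  have key := integral_cpow_by_parts
    (h := fun u : ℝ => G (s, Function.update (fun j => (t j : ℂ)) i (u : ℂ)))
    (h' := fun u : ℝ => cubeDeriv i G (s, Function.update (fun j => (t j : ℂ)) i (u : ℂ)))
    (fun u hu => ?_) ?_ hz
  · have e1 : ∀ u : ℝ, (u : ℂ) ^ ((d i : ℂ) * s + m i) * W *
        G (s, Function.update (fun j => (t j : ℂ)) i (u : ℂ)) =
        W * ((u : ℂ) ^ ((d i : ℂ) * s + m i) *
          G (s, Function.update (fun j => (t j : ℂ)) i (u : ℂ))) := fun u => by ring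
    have e2 : ∀ u : ℝ, (u : ℂ) ^ ((d i : ℂ) * s + (m i + 1 : ℕ)) * W *
        cubeDeriv i G (s, Function.update (fun j => (t j : ℂ)) i (u : ℂ)) =
        W * ((u : ℂ) ^ ((d i : ℂ) * s + m i + 1) *
          cubeDeriv i G (s, Function.update (fun j => (t j : ℂ)) i (u : ℂ))) := fun u => by
      push_cast
      rw [← add_assoc]
      ring
    simp only [e1, e2]
    rw [integral_const_mul, integral_const_mul, mul_left_comm, key, mul_sub]
    simp [faceRestrict]
  · have hc : HasDerivAt (fun w : ℂ => (s, Function.update (fun j => (t j : ℂ)) i w))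
        ((0 : ℂ), Pi.single i 1) (u : ℂ) :=
      (hasDerivAt_const _ _).prodMk (hasDerivAt_update _ i _)
    exact ((hG _ (hmem u hu)).differentiableAt.hasFDerivAt.comp_hasDerivAt (u : ℂ) hc).comp_ofReal
  · exact hD.continuousOn.comp (by fun_prop) hmem

open Classical in
/-- The number of variables whose exponents `d i * s + m i` are negative integers. -/
noncomputable def poleCount (d m : ι → ℕ) (s : ℂ) : ℕ :=
  (Finset.univ.filter fun i => d i ≠ 0 ∧ ∃ l : ℕ, (d i : ℂ) * s + m i + l + 1 = 0).card

lemma poleCount_face_le (i : ι) :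
    poleCount (Function.update d i 0) (Function.update m i 0) s ≤
      poleCount d (Function.update m i (m i + 1)) s := by
  refine Finset.card_le_card fun j hj => ?_
  simp only [Finset.mem_filter, Finset.mem_univ, true_and] at hj ⊢
  by_cases h : j = i
  · subst h; simp at hj
  · simpa [h] using hj

open Classical in
lemma poleCount_succ_add_le (i : ι) (hd : d i ≠ 0) :
    poleCount d (Function.update m i (m i + 1)) s +
      (if (d i : ℂ) * s + m i + 1 = 0 then 1 else 0) ≤ poleCount d m s := by
  have hsub : ∀ j, (d j ≠ 0 ∧ ∃ l : ℕ,
      (d j : ℂ) * s + (Function.update m i (m i + 1) j : ℕ) + l + 1 = 0) →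
      (d j ≠ 0 ∧ ∃ l : ℕ, (d j : ℂ) * s + m j + l + 1 = 0) := by
    rintro j ⟨h0, l, hl⟩
    refine ⟨h0, ?_⟩
    by_cases h : j = i
    · subst h
      refine ⟨l + 1, ?_⟩
      rw [Function.update_self] at hl
      push_cast at hl ⊢
      linear_combination hl
    · exact ⟨l, by simpa [h] using hl⟩
  split_ifs with h0
  · rw [poleCount, poleCount, Nat.add_one_le_iff]
    refine Finset.card_lt_card (Finset.ssubset_iff_of_subset ?_ |>.2 ⟨i, ?_, ?_⟩)
    · exact Finset.monotone_filter_right _ fun j _ => hsub j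
    · simp only [Finset.mem_filter, Finset.mem_univ, true_and]
      exact ⟨hd, 0, by simpa using h0⟩
    · simp only [Finset.mem_filter, Finset.mem_univ, true_and, not_and, not_exists]
      intro _ l hl
      rw [Function.update_self] at hl
      push_cast at hl
      have : ((l + 1 : ℕ) : ℂ) = 0 := by
        push_cast
        linear_combination hl - h0
      exact absurd (by exact_mod_cast this) (Nat.succ_ne_zero l)
  · exact Finset.card_le_card (Finset.monotone_filter_right _ fun j _ => hsub j)

/-- Integration by parts continues cube integrals meromorphically. -/
theorem hasContinuation_cubeIntegral (R : ℝ) (d m : ι → ℕ) {G : ℂ × (ι → ℂ) → ℂ}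
    (hG : AnalyticOnNhd ℂ G (cubePoints ι)) :
    HasContinuation R (poleCount d m) (cubeIntegral d m G) := by
  induction hD : (∑ i, if d i = 0 then 0 else ⌈d i * R⌉₊ - m i) using Nat.strong_induction_on
    generalizing d m G with
  | _ D ih =>
  by_cases hdone : ∀ i, d i ≠ 0 → d i * R ≤ m i
  · exact .of_differentiableOn (differentiableOn_cubeIntegral hG hdone)
  push Not at hdone
  obtain ⟨i, hdi, hi⟩ := hdone
  have hi' : m i < ⌈d i * R⌉₊ := Nat.lt_ceil.2 hi
  have face := ih _ ?_ (Function.update d i 0) (Function.update m i 0) (hG.faceRestrict i) rfl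
  have inner := ih _ ?_ d (Function.update m i (m i + 1)) (hG.cubeDeriv i) rfl
  · refine HasContinuation.mono (HasContinuation.of_linear_mul hdi (m := m i)
      (((face.mono fun s => poleCount_face_le i).add inner.neg).congr fun s hs =>
        cubeIntegral_by_parts hG hdi hs)) fun s => poleCount_succ_add_le i hdi
  · rw [← hD]
    refine Finset.sum_lt_sum (fun j _ => ?_) ⟨i, Finset.mem_univ _, ?_⟩
    · by_cases h : j = i
      · subst h; simp only [Function.update_self]; split_ifs <;> omega
      · simp [h]
    · simp only [Function.update_self, if_neg hdi]; omega
  · rw [← hD]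
    refine Finset.sum_lt_sum (fun j _ => ?_) ⟨i, Finset.mem_univ _, ?_⟩
    · by_cases h : j = i
      · subst h; simp
      · simp [h]
    · simp only [Function.update_self, if_neg hdi, if_true]; omega

omit [DecidableEq ι] in
lemma poleCount_le (d m : ι → ℕ) (s : ℂ) :
    poleCount d m s ≤ (Finset.univ.filter fun i => d i ≠ 0).card := by
  classical
  exact Finset.card_le_card (Finset.monotone_filter_right _ fun j _ h => h.1)

lemma det_diagonal_add_vecMulVec {D : ι → ℝ} (hD : ∀ i, D i ≠ 0) (u w : ι → ℝ) :
    (Matrix.diagonal D + Matrix.vecMulVec u w).det =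
      (∏ i, D i) * (1 + ∑ i, w i * (u i / D i)) := by
  have : Matrix.diagonal D + Matrix.vecMulVec u w = Matrix.diagonal D *
      (1 + Matrix.replicateCol Unit (fun i => u i / D i) * Matrix.replicateRow Unit w) := by
    ext i j
    rw [Matrix.mul_add, Matrix.mul_one, Matrix.add_apply, Matrix.add_apply, Matrix.diagonal_mul]
    simp only [Matrix.vecMulVec_apply, Matrix.mul_apply, Matrix.replicateCol_apply,
      Matrix.replicateRow_apply, Finset.univ_unique, Finset.sum_const, Finset.card_singleton,
      one_smul]
    field_simp [hD i]
  rw [this, Matrix.det_mul, Matrix.det_diagonal, Matrix.det_one_add_replicateCol_mul_replicateRow]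
  rfl

/-- Change of variables for a map whose derivative is diagonal plus a rank one matrix. -/
lemma setIntegral_image_diagonal_add_vecMulVec {A : Set (ι → ℝ)} (hA : MeasurableSet A)
    {f : (ι → ℝ) → ι → ℝ} (hinj : InjOn f A) {D u w : (ι → ℝ) → ι → ℝ}
    (hD : ∀ t ∈ A, ∀ i, D t i ≠ 0)
    (hf : ∀ t ∈ A, ∀ i, HasFDerivAt (fun t => f t i)
      (D t i • ContinuousLinearMap.proj (R := ℝ) (φ := fun _ : ι => ℝ) i +
        u t i • ∑ j, w t j • ContinuousLinearMap.proj (R := ℝ) (φ := fun _ : ι => ℝ) j) t)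
    (g : (ι → ℝ) → ℂ) :
    ∫ x in f '' A, g x = ∫ t in A,
      |(∏ i, D t i) * (1 + ∑ i, w t i * (u t i / D t i))| • g (f t) := by
  rw [integral_image_eq_integral_abs_det_fderiv_smul volume hA (f' := fun t =>
    LinearMap.toContinuousLinearMap (Matrix.toLin'
      (Matrix.diagonal (D t) + Matrix.vecMulVec (u t) (w t)))) (fun t ht => ?_) hinj]
  · refine setIntegral_congr_fun hA fun t ht => ?_
    rw [LinearMap.det_toContinuousLinearMap, LinearMap.det_toLin',
      det_diagonal_add_vecMulVec (hD t ht)]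
  · refine (hasFDerivAt_pi'.2 fun i => ?_).hasFDerivWithinAt
    convert! hf t ht i using 1
    ext x
    simp [Matrix.mulVec_diagonal, Matrix.vecMulVec_mulVec, dotProduct, mul_comm]

/-- The substitution `x j = t i * t j` for `j ∈ S`, `j ≠ i`. -/
def blowUp {K : Type*} [Mul K] (i : ι) (S : Finset ι) (t : ι → K) : ι → K :=
  fun j => if j ∈ S.erase i then t i * t j else t j

omit [Fintype ι] in
lemma blowUp_self {K : Type*} [Mul K] (i : ι) (S : Finset ι) (t : ι → K) :
    blowUp i S t i = t i := by
  simp [blowUp]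

omit [Fintype ι] in
lemma blowUp_of_mem {K : Type*} [Mul K] {i j : ι} {S : Finset ι} (hj : j ∈ S) (hji : j ≠ i)
    (t : ι → K) : blowUp i S t j = t i * t j := by
  simp [blowUp, hj, hji]

omit [Fintype ι] in
lemma blowUp_of_notMem {K : Type*} [Mul K] {i j : ι} {S : Finset ι} (hj : j ∉ S) (t : ι → K) :
    blowUp i S t j = t j := by
  simp [blowUp, hj]

omit [Fintype ι] in
lemma blowUp_mem_unitCube {i : ι} {S : Finset ι} {t : ι → ℝ} (ht : t ∈ unitCube ι) :
    blowUp i S t ∈ unitCube ι := by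
  refine mem_unitCube.2 fun j => ?_
  obtain ⟨h0, h1⟩ := mem_unitCube.1 ht i
  obtain ⟨h0', h1'⟩ := mem_unitCube.1 ht j
  unfold blowUp
  split_ifs
  · exact ⟨by positivity, by nlinarith⟩
  · exact ⟨h0', h1'⟩

omit [Fintype ι] in
lemma blowUp_image {i : ι} {S : Finset ι} :
    blowUp i S '' unitCube ι = {x ∈ unitCube ι | ∀ j ∈ S, x j ≤ x i} := by
  ext x
  constructor
  · rintro ⟨t, ht, rfl⟩
    refine ⟨blowUp_mem_unitCube ht, fun j hj => ?_⟩
    rw [blowUp_self]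
    obtain ⟨h0, h1⟩ := mem_unitCube.1 ht i
    obtain ⟨h0', h1'⟩ := mem_unitCube.1 ht j
    by_cases hji : j = i
    · subst hji; rw [blowUp_self]
    · rw [blowUp_of_mem hj hji]; nlinarith
  · rintro ⟨hx, hmax⟩
    have hi := (mem_unitCube.1 hx i).1
    refine ⟨fun j => if j ∈ S.erase i then x j / x i else x j, mem_unitCube.2 fun j => ?_, ?_⟩
    · have hj := mem_unitCube.1 hx j
      split_ifs with h
      · exact ⟨div_pos hj.1 hi, (div_le_one hi).2 (hmax j (Finset.mem_of_mem_erase h))⟩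
      · exact hj
    · ext j
      unfold blowUp
      by_cases h : j ∈ S.erase i
      · simp only [if_pos h]
        simp [mul_div_cancel₀ _ hi.ne']
      · simp only [if_neg h]

omit [Fintype ι] in
lemma blowUp_injOn {i : ι} {S : Finset ι} : InjOn (blowUp (K := ℝ) i S) (unitCube ι) := by
  intro t ht t' _ h
  have hi : t i = t' i := by simpa only [blowUp_self] using congrFun h i
  ext j
  have hj := congrFun h j
  unfold blowUp at hj
  split_ifs at hj
  · rw [← hi] at hj
    exact mul_left_cancel₀ (mem_unitCube.1 ht i).1.ne' hj
  · exact hj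

lemma setIntegral_blowUp_image (i : ι) (S : Finset ι) (g : (ι → ℝ) → ℂ) :
    ∫ x in {x ∈ unitCube ι | ∀ j ∈ S, x j ≤ x i}, g x =
      ∫ t in unitCube ι, (t i : ℂ) ^ (S.erase i).card * g (blowUp i S t) := by
  rw [← blowUp_image, setIntegral_image_diagonal_add_vecMulVec measurableSet_unitCube blowUp_injOn
    (D := fun t j => if j ∈ S.erase i then t i else 1)
    (u := fun t j => if j ∈ S.erase i then t j else 0) (w := fun _ => Pi.single i 1)]
  · refine setIntegral_congr_fun measurableSet_unitCube fun t ht => ?_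
    have hi := (mem_unitCube.1 ht i).1
    have h0 : ∑ j, (Pi.single i 1 : ι → ℝ) j *
        ((if j ∈ S.erase i then t j else 0) / if j ∈ S.erase i then t i else 1) = 0 := by
      refine Finset.sum_eq_zero fun j _ => ?_
      by_cases h : j = i
      · subst h; simp
      · simp [h]
    simp only [h0, add_zero, mul_one]
    rw [Finset.prod_ite_mem, Finset.univ_inter, Finset.prod_const, abs_of_pos (by positivity)]
    simp
  · intro t ht j
    split_ifs
    · exact (mem_unitCube.1 ht i).1.ne'
    · exact one_ne_zero
  · intro t _ j
    have hproj (l : ι) : HasFDerivAt (fun t : ι → ℝ => t l)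
      (ContinuousLinearMap.proj (R := ℝ) (φ := fun _ : ι => ℝ) l) t := hasFDerivAt_apply l t
    unfold blowUp
    split_ifs with h
    · convert! (hproj i).mul (hproj j) using 1
      ext x
      simp [Pi.single_apply]
    · convert! hproj j using 1
      ext x
      simp

lemma ofReal_prod_cpow_of_nonneg {κ : Type*} {J : Finset κ} {p : κ → ℝ} (hp : ∀ j ∈ J, 0 ≤ p j)
    (s : ℂ) : (↑(∏ j ∈ J, p j) : ℂ) ^ s = ∏ j ∈ J, (p j : ℂ) ^ s := by
  classical
  induction J using Finset.induction_on with
  | empty => simp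
  | insert j J hj ih =>
    rw [Finset.prod_insert hj, Finset.prod_insert hj, ofReal_mul,
      mul_cpow_ofReal_nonneg (hp j (Finset.mem_insert_self j J))
        (Finset.prod_nonneg fun l hl => hp l (Finset.mem_insert_of_mem hl)),
      ih fun l hl => hp l (Finset.mem_insert_of_mem hl)]

section Forms

variable {κ : Type*} {J : Finset κ} {a : κ → ι → ℝ} {b : κ → ℝ}

/-- The product of the monomial `∏ i, t i ^ d i` and of affine forms indexed by `J`. -/
def formsProd (d : ι → ℕ) (J : Finset κ) (b : κ → ℝ) (a : κ → ι → ℝ) (t : ι → ℝ) : ℝ :=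
  (∏ i, t i ^ d i) * ∏ j ∈ J, (b j + ∑ i, a j i * t i)

/-- The integral over the cube of `G` times the `s`-th power of `formsProd d J b a`. -/
noncomputable def formsIntegral (d : ι → ℕ) (J : Finset κ) (b : κ → ℝ) (a : κ → ι → ℝ)
    (G : ℂ × (ι → ℂ) → ℂ) (s : ℂ) : ℂ :=
  ∫ t in unitCube ι, (formsProd d J b a t : ℂ) ^ s * G (s, fun i => (t i : ℂ))

/-- The product of the `s`-th powers of affine forms. -/
noncomputable def formsPow (J : Finset κ) (b : κ → ℝ) (a : κ → ι → ℝ) (p : ℂ × (ι → ℂ)) : ℂ :=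
  ∏ j ∈ J, ((b j : ℂ) + ∑ i, (a j i : ℂ) * p.2 i) ^ p.1

omit [DecidableEq ι] in
lemma analyticOnNhd_formsPow (hb : ∀ j ∈ J, 0 < b j) (ha : ∀ j ∈ J, ∀ i, 0 ≤ a j i) :
    AnalyticOnNhd ℂ (formsPow J b a) (cubePoints ι) := by
  rintro ⟨s, p⟩ ⟨t, ht, rfl⟩
  refine Finset.analyticAt_fun_prod _ fun j hj => ?_
  refine AnalyticAt.cpow ?_ analyticAt_fst ?_
  · refine analyticAt_const.add (Finset.analyticAt_fun_sum _ fun i _ => ?_)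
    exact analyticAt_const.mul (analyticAt_coord i _)
  · have h0 : 0 < b j + ∑ i, a j i * t i := add_pos_of_pos_of_nonneg (hb j hj)
      (Finset.sum_nonneg fun i _ => mul_nonneg (ha j hj i) (ht i).1)
    simpa using ofReal_mem_slitPlane.2 h0

omit [DecidableEq ι] in
lemma integrableOn_formsProd_cpow_mul {d : ι → ℕ} {G : ℂ × (ι → ℂ) → ℂ}
    (hG : AnalyticOnNhd ℂ G (cubePoints ι)) {s : ℂ} (hs : 0 < s.re) :
    IntegrableOn (fun t => (formsProd d J b a t : ℂ) ^ s * G (s, fun i => (t i : ℂ)))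
      (unitCube ι) := by
  have hK : IsCompact (univ.pi fun _ : ι => Icc (0 : ℝ) 1) :=
    isCompact_univ_pi fun _ => isCompact_Icc
  refine (ContinuousOn.integrableOn_compact hK ?_).mono_set
    (pi_mono fun _ _ => Ioc_subset_Icc_self)
  refine ContinuousOn.mul ?_ (hG.continuousOn.comp (by fun_prop) fun t ht =>
    ⟨t, fun i => ht i trivial, rfl⟩)
  refine ((continuous_ofReal_cpow_const hs).comp ?_).continuousOn
  unfold formsProd
  fun_prop

omit [DecidableEq ι] in
lemma formsIntegral_eq_filter (d : ι → ℕ) (hb : ∀ j ∈ J, 0 ≤ b j) (ha : ∀ j ∈ J, ∀ i, 0 ≤ a j i)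
    (G : ℂ × (ι → ℂ) → ℂ) (s : ℂ) :
    formsIntegral d J b a G s = formsIntegral d (J.filter fun j => b j = 0) b a
      (fun p => formsPow (J.filter fun j => b j ≠ 0) b a p * G p) s := by
  refine setIntegral_congr_fun measurableSet_unitCube fun t ht => ?_
  have hform : ∀ j ∈ J, 0 ≤ b j + ∑ i, a j i * t i := fun j hj =>
    add_nonneg (hb j hj) (Finset.sum_nonneg fun i _ =>
      mul_nonneg (ha j hj i) (mem_unitCube.1 ht i).1.le)
  have hmon : 0 ≤ ∏ i, t i ^ d i :=
    Finset.prod_nonneg fun i _ => pow_nonneg (mem_unitCube.1 ht i).1.le _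
  have hsplit : formsProd d J b a t = formsProd d (J.filter fun j => b j = 0) b a t *
      ∏ j ∈ J.filter fun j => b j ≠ 0, (b j + ∑ i, a j i * t i) := by
    rw [formsProd, formsProd, mul_assoc, Finset.prod_filter_mul_prod_filter_not]
  have hprod : 0 ≤ formsProd d (J.filter fun j => b j = 0) b a t :=
    mul_nonneg hmon (Finset.prod_nonneg fun j hj => hform j (Finset.mem_of_mem_filter j hj))
  simp only
  rw [hsplit, ofReal_mul, mul_cpow_ofReal_nonneg hprod
    (Finset.prod_nonneg fun j hj => hform j (Finset.mem_of_mem_filter j hj)), mul_assoc,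
    ofReal_prod_cpow_of_nonneg fun j hj => hform j (Finset.mem_of_mem_filter j hj)]
  simp [formsPow]

omit [DecidableEq ι] in
lemma formsIntegral_empty (d : ι → ℕ) (G : ℂ × (ι → ℂ) → ℂ) (s : ℂ) :
    formsIntegral d ∅ b a G s = cubeIntegral d 0 G s := by
  refine setIntegral_congr_fun measurableSet_unitCube fun t ht => ?_
  have h (i : ι) := (mem_unitCube.1 ht i).1.le
  simp only [formsProd, Finset.prod_empty, mul_one, cubeMonomial]
  rw [ofReal_prod_cpow_of_nonneg fun i _ => pow_nonneg (h i) _]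
  congr 1
  refine Finset.prod_congr rfl fun i _ => ?_
  have hpow := ofReal_prod_cpow_of_nonneg (J := Finset.range (d i)) (fun _ _ => h i) s
  simp only [Finset.prod_const, Finset.card_range] at hpow
  rw [hpow, Pi.zero_apply, Nat.cast_zero, add_zero, cpow_nat_mul]

omit [Fintype ι] in
lemma ofReal_blowUp (i : ι) (S : Finset ι) (t : ι → ℝ) :
    blowUp i S (fun j => (t j : ℂ)) = fun j => ((blowUp i S t j : ℝ) : ℂ) := by
  ext j
  unfold blowUp
  split_ifs <;> simp

lemma AnalyticOnNhd.blowUp {G : ℂ × (ι → ℂ) → ℂ} (hG : AnalyticOnNhd ℂ G (cubePoints ι))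
    (i : ι) (S : Finset ι) (m : ℕ) :
    AnalyticOnNhd ℂ (fun p => p.2 i ^ m * G (p.1, blowUp i S p.2)) (cubePoints ι) := by
  rintro ⟨s, p⟩ ⟨t, ht, rfl⟩
  refine ((analyticAt_coord i _).pow m).mul ?_
  refine AnalyticAt.comp (g := G) (f := fun p : ℂ × (ι → ℂ) => (p.1, _root_.blowUp i S p.2))
    (hG _ ⟨_root_.blowUp i S t, fun j => ?_, ofReal_blowUp i S t⟩) ?_
  · have h1 := ht i
    have h2 := ht j
    unfold _root_.blowUp
    split_ifs
    · exact ⟨mul_nonneg h1.1 h2.1, mul_le_one₀ h1.2 h2.1 h2.2⟩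
    · exact h2
  · refine analyticAt_fst.prod (analyticAt_pi_iff.2 fun j => ?_)
    unfold _root_.blowUp
    split_ifs
    · exact (analyticAt_coord i _).mul (analyticAt_coord j _)
    · exact analyticAt_coord j _

lemma formsProd_blowUp {d : ι → ℕ} {i : ι} {S : Finset ι} (hi : i ∈ S) (hd : ∀ l ∈ S, d l = 0)
    (hb : ∀ j ∈ J, b j = 0) (ha : ∀ j ∈ J, ∀ l ∉ S, a j l = 0) (t : ι → ℝ) :
    formsProd d J b a (blowUp i S t) = formsProd (Function.update d i J.card) J
      (fun j => a j i) (fun j => Function.update (a j) i 0) t := by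
  have hlin : ∀ j ∈ J, b j + ∑ l, a j l * blowUp i S t l =
      t i * (a j i + ∑ l, Function.update (a j) i 0 l * t l) := fun j hj => by
    rw [hb j hj, zero_add, mul_add, ← Finset.add_sum_erase _ _ (Finset.mem_univ i),
      ← Finset.add_sum_erase Finset.univ (fun l => Function.update (a j) i 0 l * t l)
        (Finset.mem_univ i), blowUp_self, Function.update_self, zero_mul, zero_add, Finset.mul_sum,
      mul_comm (a j i)]
    congr 1
    refine Finset.sum_congr rfl fun l hl => ?_
    have hli := Finset.ne_of_mem_erase hl
    rw [Function.update_of_ne hli]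
    by_cases h : l ∈ S
    · rw [blowUp_of_mem h hli]; ring
    · simp [ha j hj l h]
  have hmon : ∏ l, blowUp i S t l ^ d l = ∏ l, t l ^ d l := Finset.prod_congr rfl fun l _ => by
    by_cases h : l ∈ S
    · simp [hd l h]
    · rw [blowUp_of_notMem h]
  have hmon' : ∏ l, t l ^ Function.update d i J.card l = t i ^ J.card * ∏ l, t l ^ d l := by
    rw [← Finset.mul_prod_erase _ _ (Finset.mem_univ i),
      ← Finset.mul_prod_erase Finset.univ (fun l => t l ^ d l) (Finset.mem_univ i),
      Function.update_self, hd i hi, pow_zero, one_mul]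
    congr 1
    exact Finset.prod_congr rfl fun l hl => by
      rw [Function.update_of_ne (Finset.ne_of_mem_erase hl)]
  rw [formsProd, formsProd, Finset.prod_congr rfl hlin, hmon, hmon', Finset.prod_mul_distrib,
    Finset.prod_const]
  ring

lemma volume_coord_eq {i j : ι} (hij : i ≠ j) : volume {x : ι → ℝ | x i = x j} = 0 := by
  have := volume_affine_zero_set (volume : Measure (ι → ℝ))
    (LinearMap.proj (R := ℝ) (φ := fun _ : ι => ℝ) i -
      LinearMap.proj (R := ℝ) (φ := fun _ : ι => ℝ) j).toAffineMap (x₀ := Pi.single i 1)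
    (by simp [hij.symm])
  simpa [sub_eq_zero] using this

lemma formsIntegral_eq_sum_blowUp {d : ι → ℕ} {S : Finset ι} (hS : S.Nonempty)
    (hd : ∀ l ∈ S, d l = 0) (hb : ∀ j ∈ J, b j = 0) (ha : ∀ j ∈ J, ∀ l ∉ S, a j l = 0)
    {G : ℂ × (ι → ℂ) → ℂ} (hG : AnalyticOnNhd ℂ G (cubePoints ι)) {s : ℂ} (hs : 0 < s.re) :
    formsIntegral d J b a G s = ∑ i ∈ S, formsIntegral (Function.update d i J.card) J
      (fun j => a j i) (fun j => Function.update (a j) i 0)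
      (fun p => p.2 i ^ (S.erase i).card * G (p.1, blowUp i S p.2)) s := by
  rw [formsIntegral, setIntegral_eq_sum_argmax measurableSet_unitCube hS
    (c := fun i (x : ι → ℝ) => x i) (fun i => measurable_pi_apply i)
    (fun i j hij => volume_coord_eq hij) (integrableOn_formsProd_cpow_mul hG hs)]
  refine Finset.sum_congr rfl fun i hi => ?_
  rw [setIntegral_blowUp_image]
  refine setIntegral_congr_fun measurableSet_unitCube fun t _ => ?_
  simp only [formsProd_blowUp hi hd hb ha, ofReal_blowUp]
  ring

theorem hasContinuation_formsIntegral (R : ℝ) {k : ℕ} (d : ι → ℕ) (J : Finset κ) (b : κ → ℝ)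
    (a : κ → ι → ℝ) {G : ℂ × (ι → ℂ) → ℂ} (hG : AnalyticOnNhd ℂ G (cubePoints ι))
    (hb : ∀ j ∈ J, 0 ≤ b j) (ha : ∀ j ∈ J, ∀ i, 0 ≤ a j i)
    (hpos : ∀ j ∈ J, b j = 0 → ∃ i, 0 < a j i)
    (hd : ∀ j ∈ J, b j = 0 → ∀ i, 0 < a j i → d i = 0)
    (hk : (Finset.univ.filter fun i => d i ≠ 0).card + (J.filter fun j => b j = 0).card ≤ k) :
    HasContinuation R (fun _ => k) (formsIntegral d J b a G) := by
  induction hN : (J.filter fun j => b j = 0).card using Nat.strong_induction_on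
    generalizing d J b a G with
  | _ N ih =>
  have hG' : AnalyticOnNhd ℂ (fun p => formsPow (J.filter fun j => b j ≠ 0) b a p * G p)
      (cubePoints ι) := AnalyticOnNhd.mul (analyticOnNhd_formsPow
    (fun j hj => lt_of_le_of_ne (hb j (Finset.mem_of_mem_filter j hj))
      (Finset.mem_filter.1 hj).2.symm)
    fun j hj => ha j (Finset.mem_of_mem_filter j hj)) hG
  refine HasContinuation.congr ?_ fun s _ => formsIntegral_eq_filter d hb ha G s
  generalize (fun p => formsPow (J.filter fun j => b j ≠ 0) b a p * G p) = G' at hG' ⊢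
  rcases (J.filter fun j => b j = 0).eq_empty_or_nonempty with hJ | hJ
  · rw [hJ]
    refine HasContinuation.congr ?_ fun s _ => formsIntegral_empty d G' s
    exact (hasContinuation_cubeIntegral R d 0 hG').mono fun s =>
      (poleCount_le d 0 s).trans ((Nat.le_add_right _ _).trans hk)
  set J' := J.filter fun j => b j = 0 with hJ'
  have hJb : ∀ j ∈ J', b j = 0 := fun j hj => (Finset.mem_filter.1 hj).2
  have hJJ : ∀ j ∈ J', j ∈ J := fun j hj => (Finset.mem_filter.1 hj).1
  classical
  set S : Finset ι := Finset.univ.filter fun i => ∃ j ∈ J', 0 < a j i with hS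
  have hSne : S.Nonempty := by
    obtain ⟨j, hj⟩ := hJ
    obtain ⟨i, hi⟩ := hpos j (hJJ j hj) (hJb j hj)
    exact ⟨i, Finset.mem_filter.2 ⟨Finset.mem_univ i, j, hj, hi⟩⟩
  have hdS : ∀ l ∈ S, d l = 0 := fun l hl => by
    obtain ⟨-, j, hj, hjl⟩ := Finset.mem_filter.1 hl
    exact hd j (hJJ j hj) (hJb j hj) l hjl
  have haS : ∀ j ∈ J', ∀ l ∉ S, a j l = 0 := fun j hj l hl => by
    by_contra h
    exact hl (Finset.mem_filter.2 ⟨Finset.mem_univ l, j, hj,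
      lt_of_le_of_ne (ha j (hJJ j hj) l) (Ne.symm h)⟩)
  refine HasContinuation.congr ?_ fun s hs => formsIntegral_eq_sum_blowUp hSne hdS hJb haS hG' hs
  refine HasContinuation.sum S fun i hi => ?_
  have hlt : (J'.filter fun j => a j i = 0).card < J'.card := by
    obtain ⟨-, j, hj, hji⟩ := Finset.mem_filter.1 hi
    exact Finset.card_lt_card (Finset.filter_ssubset.2 ⟨j, hj, hji.ne'⟩)
  refine ih _ (hN ▸ hlt) _ _ _ _ (hG'.blowUp i S _) (fun j hj => ha j (hJJ j hj) i)
    (fun j hj l => ?_) (fun j hj h0 => ?_) (fun j hj h0 l hl => ?_) ?_ rfl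
  · by_cases h : l = i
    · subst h; simp
    · simpa [h] using ha j (hJJ j hj) l
  · obtain ⟨l, hl⟩ := hpos j (hJJ j hj) (hJb j hj)
    have h : l ≠ i := fun h => by rw [h, h0] at hl; exact hl.false
    exact ⟨l, by simpa [h] using hl⟩
  · by_cases h : l = i
    · subst h; simp at hl
    · rw [Function.update_of_ne h] at hl ⊢
      exact hd j (hJJ j hj) (hJb j hj) l hl
  · have hsub : (Finset.univ.filter fun l => Function.update d i J'.card l ≠ 0) ⊆
        insert i (Finset.univ.filter fun l => d l ≠ 0) := fun l hl => by
      by_cases h : l = i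
      · simp [h]
      · simpa [h] using hl
    have := (Finset.card_le_card hsub).trans (Finset.card_insert_le _ _)
    omega

end Forms

end Cube

section Projective

variable {ι : Type*}

lemma unitCube_nonneg {t : ι → ℝ} (ht : t ∈ unitCube ι) (i : ι) : 0 ≤ t i :=
  (mem_unitCube.1 ht i).1.le

variable [Fintype ι]

lemma one_add_sum_pos {t : ι → ℝ} (ht : ∀ i, 0 ≤ t i) : 0 < 1 + ∑ i, t i :=
  add_pos_of_pos_of_nonneg one_pos (Finset.sum_nonneg fun i _ => ht i)

variable [DecidableEq ι]

lemma setIntegral_projective_image {T : (ι → ℝ) → ι → ℝ}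
    (hT : T = fun t j => (1 + ∑ i, t i)⁻¹ * t j) (hinj : InjOn T (unitCube ι))
    (g : (ι → ℝ) → ℂ) :
    ∫ x in T '' unitCube ι, g x =
      ∫ t in unitCube ι, (1 + ∑ i, t i)⁻¹ ^ (Fintype.card ι + 1) • g (T t) := by
  rw [setIntegral_image_diagonal_add_vecMulVec measurableSet_unitCube hinj
    (D := fun t _ => (1 + ∑ i, t i)⁻¹) (u := fun t j => -((1 + ∑ i, t i) ^ 2)⁻¹ * t j)
    (w := fun _ _ => 1)]
  · refine setIntegral_congr_fun measurableSet_unitCube fun t ht => ?_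
    have h0 := one_add_sum_pos (unitCube_nonneg ht)
    have h1 : 1 + ∑ j, 1 * (-((1 + ∑ i, t i) ^ 2)⁻¹ * t j / (1 + ∑ i, t i)⁻¹) =
        (1 + ∑ i, t i)⁻¹ := by
      simp only [one_mul, div_eq_mul_inv, ← Finset.sum_mul, ← Finset.mul_sum]
      field_simp
      ring
    simp only [h1, Finset.prod_const, Finset.card_univ]
    rw [← pow_succ, abs_of_pos (by positivity)]
  · intro t ht _
    exact (inv_pos.2 (one_add_sum_pos (unitCube_nonneg ht))).ne'
  · intro t ht j
    have h0 := one_add_sum_pos (unitCube_nonneg ht)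
    have hproj (l : ι) : HasFDerivAt (fun t : ι → ℝ => t l)
      (ContinuousLinearMap.proj (R := ℝ) (φ := fun _ : ι => ℝ) l) t := hasFDerivAt_apply l t
    have hsum : HasFDerivAt (fun t : ι → ℝ => 1 + ∑ i, t i)
        (∑ i, ContinuousLinearMap.proj (R := ℝ) (φ := fun _ : ι => ℝ) i) t :=
      (HasFDerivAt.fun_sum fun i _ => hproj i).const_add 1
    rw [hT]
    convert! ((hasDerivAt_inv h0.ne').comp_hasFDerivAt t hsum).mul (hproj j) using 1
    ext x
    simp
    ring

end Projective

section Simplex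

variable {n : ℕ}

/-- The chart of a simplex with vertices `v` given by ratios of barycentric coordinates to the
`i`-th one. -/
def simplexChart {K : Type*} [Field K] (v : Fin (n + 1) → Fin n → K) (i : Fin (n + 1))
    (t : Fin n → K) : Fin n → K :=
  (1 + ∑ m, t m)⁻¹ • (v i + ∑ m, t m • v (i.succAbove m))

lemma AffineMap.apply_simplexChart (h : (Fin n → ℝ) →ᵃ[ℝ] ℝ) (v : Fin (n + 1) → Fin n → ℝ)
    (i : Fin (n + 1)) {t : Fin n → ℝ} (ht : 1 + ∑ m, t m ≠ 0) :
    h (simplexChart v i t) =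
      (1 + ∑ m, t m)⁻¹ * (h (v i) + ∑ m, h (v (i.succAbove m)) * t m) := by
  have hL (x : Fin n → ℝ) : h x = h.linear x + h 0 := by
    simpa using h.map_vadd 0 x
  rw [simplexChart, hL, hL (v i)]
  simp only [hL (v (i.succAbove _)), map_smul, map_add, map_sum, smul_eq_mul, add_mul,
    Finset.sum_add_distrib, ← Finset.mul_sum]
  field_simp
  simp only [mul_comm]
  ring

variable (B : AffineBasis (Fin (n + 1)) ℝ (Fin n → ℝ)) (i : Fin (n + 1))

lemma coord_simplexChart_self {t : Fin n → ℝ} (ht : 1 + ∑ m, t m ≠ 0) :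
    B.coord i (simplexChart B i t) = (1 + ∑ m, t m)⁻¹ := by
  rw [AffineMap.apply_simplexChart _ _ _ ht]
  simp [Fin.ne_succAbove]

lemma coord_simplexChart_succAbove {t : Fin n → ℝ} (ht : 1 + ∑ m, t m ≠ 0) (m : Fin n) :
    B.coord (i.succAbove m) (simplexChart B i t) = (1 + ∑ m, t m)⁻¹ * t m := by
  rw [AffineMap.apply_simplexChart _ _ _ ht]
  simp [AffineBasis.coord_apply, Fin.succAbove_ne]

lemma simplexChart_mem_convexHull {t : Fin n → ℝ} (ht : ∀ m, 0 ≤ t m) :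
    simplexChart B i t ∈ convexHull ℝ (range B) := by
  have h0 := one_add_sum_pos ht
  rw [B.convexHull_eq_nonneg_coord]
  refine fun j => ?_
  rcases Fin.eq_self_or_eq_succAbove i j with rfl | ⟨m, rfl⟩
  · rw [coord_simplexChart_self B _ h0.ne']
    positivity
  · rw [coord_simplexChart_succAbove B _ h0.ne']
    have := ht m
    positivity

lemma simplexChart_image : simplexChart B i '' unitCube (Fin n) =
    {x ∈ interior (convexHull ℝ (range B)) | ∀ j ∈ Finset.univ, B.coord j x ≤ B.coord i x} := by
  ext x
  rw [B.interior_convexHull]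
  constructor
  · rintro ⟨t, ht, rfl⟩
    have h0 := one_add_sum_pos (unitCube_nonneg ht)
    have h1 := inv_pos.2 h0
    refine ⟨fun j => ?_, fun j _ => ?_⟩ <;>
    rcases Fin.eq_self_or_eq_succAbove i j with rfl | ⟨m, rfl⟩
    · rwa [coord_simplexChart_self B _ h0.ne']
    · rw [coord_simplexChart_succAbove B _ h0.ne']
      exact mul_pos h1 (mem_unitCube.1 ht m).1
    · exact le_rfl
    · rw [coord_simplexChart_succAbove B _ h0.ne', coord_simplexChart_self B _ h0.ne']
      exact mul_le_of_le_one_right h1.le (mem_unitCube.1 ht m).2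
  · rintro ⟨hpos, hmax⟩
    have hi := hpos i
    have hsum : 1 + ∑ m, B.coord (i.succAbove m) x / B.coord i x = (B.coord i x)⁻¹ := by
      have := B.sum_coord_apply_eq_one x
      rw [Fin.sum_univ_succAbove _ i] at this
      rw [← Finset.sum_div]
      field_simp
      exact this
    have h0 : 1 + ∑ m, B.coord (i.succAbove m) x / B.coord i x ≠ 0 := by
      rw [hsum]
      exact (inv_pos.2 hi).ne'
    refine ⟨fun m => B.coord (i.succAbove m) x / B.coord i x, mem_unitCube.2 fun m =>
      ⟨div_pos (hpos _) hi, (div_le_one hi).2 (hmax _ (Finset.mem_univ _))⟩, ?_⟩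
    refine B.ext_elem fun j => ?_
    rcases Fin.eq_self_or_eq_succAbove i j with rfl | ⟨m, rfl⟩
    · rw [coord_simplexChart_self B _ h0, hsum, inv_inv]
    · rw [coord_simplexChart_succAbove B _ h0, hsum, inv_inv, mul_div_cancel₀ _ hi.ne']

lemma simplexChart_injOn : InjOn (simplexChart B i) (unitCube (Fin n)) := by
  intro t ht t' ht' h
  have h0 := one_add_sum_pos (unitCube_nonneg ht)
  have h0' := one_add_sum_pos (unitCube_nonneg ht')
  have hi := congrArg (B.coord i) h
  rw [coord_simplexChart_self B _ h0.ne', coord_simplexChart_self B _ h0'.ne'] at hi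
  ext m
  have hm := congrArg (B.coord (i.succAbove m)) h
  rw [coord_simplexChart_succAbove B _ h0.ne', coord_simplexChart_succAbove B _ h0'.ne', ← hi] at hm
  exact mul_left_cancel₀ (inv_pos.2 h0).ne' hm

lemma exists_setIntegral_simplexChart_image : ∃ C : ℝ, ∀ g : (Fin n → ℝ) → ℂ,
    ∫ x in simplexChart B i '' unitCube (Fin n), g x =
      ∫ t in unitCube (Fin n), ((C : ℂ) * (1 + ∑ m, (t m : ℂ))⁻¹ ^ (n + 1)) *
        g (simplexChart B i t) := by
  set L : (Fin n → ℝ) →L[ℝ] (Fin n → ℝ) :=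
    ∑ m, (ContinuousLinearMap.proj (R := ℝ) (φ := fun _ : Fin n => ℝ) m).smulRight
      (B (i.succAbove m) - B i) with hL
  set T : (Fin n → ℝ) → Fin n → ℝ := fun t j => (1 + ∑ m, t m)⁻¹ * t j with hT
  have hcomp : EqOn ((fun y => B i + L y) ∘ T) (simplexChart B i) (unitCube (Fin n)) := by
    intro t ht
    have h0 := one_add_sum_pos (unitCube_nonneg ht)
    ext l
    simp only [hL, hT, simplexChart, Function.comp_apply, sum_apply,
      ContinuousLinearMap.smulRight_apply, ContinuousLinearMap.proj_apply, Pi.add_apply,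
      Finset.sum_apply, Pi.smul_apply, Pi.sub_apply, smul_eq_mul, mul_sub, mul_assoc,
      Finset.sum_sub_distrib, ← Finset.mul_sum, ← Finset.sum_mul]
    field_simp
    ring
  have hinj : InjOn ((fun y => B i + L y) ∘ T) (unitCube (Fin n)) :=
    (simplexChart_injOn B i).congr hcomp.symm
  have hTinj : InjOn T (unitCube (Fin n)) := fun t ht t' ht' h =>
    hinj ht ht' (congrArg (fun y => B i + L y) h)
  have hTmeas : MeasurableSet (T '' unitCube (Fin n)) :=
    measurableSet_unitCube.image_of_continuousOn_injOn (continuousOn_pi.2 fun j =>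
      ContinuousOn.mul (ContinuousOn.inv₀ (by fun_prop) fun t ht =>
        (one_add_sum_pos (unitCube_nonneg ht)).ne') (by fun_prop)) hTinj
  refine ⟨|L.det|, fun g => ?_⟩
  rw [← hcomp.image_eq, image_comp, integral_image_eq_integral_abs_det_fderiv_smul volume hTmeas
    (fun y _ => (L.hasFDerivAt.const_add (B i)).hasFDerivWithinAt) hinj.image_of_comp,
    setIntegral_projective_image hT hTinj]
  refine setIntegral_congr_fun measurableSet_unitCube fun t ht => ?_
  simp only [← hcomp ht, Function.comp_apply, Fintype.card_fin, real_smul]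
  push_cast
  ring

lemma ofReal_simplexChart (v : Fin (n + 1) → Fin n → ℝ) (t : Fin n → ℝ) :
    simplexChart (fun j l => (v j l : ℂ)) i (fun m => (t m : ℂ)) =
      fun l => ((simplexChart v i t l : ℝ) : ℂ) := by
  ext l
  simp [simplexChart]

variable {B i}

lemma analyticAt_one_add_sum_inv {t : Fin n → ℝ} (ht : ∀ m, 0 ≤ t m) (s : ℂ) :
    AnalyticAt ℂ (fun p : ℂ × (Fin n → ℂ) => (1 + ∑ m, p.2 m)⁻¹) (s, fun m => (t m : ℂ)) := by
  refine AnalyticAt.inv (analyticAt_const.add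
    (Finset.analyticAt_fun_sum _ fun m _ => analyticAt_coord m _)) ?_
  simpa using ofReal_ne_zero.2 (one_add_sum_pos ht).ne'

lemma analyticAt_comp_simplexChart {E : ℂ × (Fin n → ℂ) → ℂ}
    (hE : ∀ (s : ℂ) (x : Fin n → ℝ), x ∈ convexHull ℝ (range B) →
      AnalyticAt ℂ E (s, fun l => (x l : ℂ))) {t : Fin n → ℝ} (ht : ∀ m, 0 ≤ t m) (s : ℂ) :
    AnalyticAt ℂ (fun p : ℂ × (Fin n → ℂ) =>
      E (p.1, simplexChart (fun j l => (B j l : ℂ)) i p.2)) (s, fun m => (t m : ℂ)) := by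
  refine AnalyticAt.comp (g := E) (f := fun p : ℂ × (Fin n → ℂ) =>
    (p.1, simplexChart (fun j l => (B j l : ℂ)) i p.2)) ?_ ?_
  · rw [ofReal_simplexChart]
    exact hE s _ (simplexChart_mem_convexHull B i ht)
  · refine analyticAt_fst.prod (analyticAt_pi_iff.2 fun l => ?_)
    simp only [simplexChart, Pi.smul_apply, Pi.add_apply, Finset.sum_apply, smul_eq_mul]
    exact (analyticAt_one_add_sum_inv ht s).mul (analyticAt_const.add
      (Finset.analyticAt_fun_sum _ fun m _ => (analyticAt_coord m _).mul analyticAt_const))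

theorem hasContinuation_simplexChart (R : ℝ) {k : ℕ} {f : Fin k → (Fin n → ℝ) →ᵃ[ℝ] ℝ}
    (hf0 : ∀ j x, x ∈ convexHull ℝ (range B) → 0 ≤ f j x)
    (hf : ∀ j, ∀ x ∈ interior (convexHull ℝ (range B)), 0 < f j x) {E : ℂ × (Fin n → ℂ) → ℂ}
    (hE : ∀ (s : ℂ) (x : Fin n → ℝ), x ∈ convexHull ℝ (range B) →
      AnalyticAt ℂ E (s, fun l => (x l : ℂ))) :
    HasContinuation R (fun _ => k) fun s => ∫ x in simplexChart B i '' unitCube (Fin n),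
      (↑(∏ j, f j x) : ℂ) ^ s * E (s, fun l => (x l : ℂ)) := by
  obtain ⟨C, hC⟩ := exists_setIntegral_simplexChart_image B i
  have hv (j : Fin k) (l : Fin (n + 1)) : 0 ≤ f j (B l) :=
    hf0 j _ (subset_convexHull ℝ _ (mem_range_self l))
  refine HasContinuation.congr (hasContinuation_formsIntegral R 0 Finset.univ (fun j => f j (B i))
    (fun j m => f j (B (i.succAbove m))) (G := fun p => ((C : ℂ) * (1 + ∑ m, p.2 m)⁻¹ ^ (n + 1)) *
      (((1 + ∑ m, p.2 m)⁻¹ ^ k) ^ p.1 * E (p.1, simplexChart (fun j l => (B j l : ℂ)) i p.2)))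
      ?_ (fun j _ => hv j i) (fun j _ m => hv j _) (fun j _ h0 => ?_) (fun _ _ _ _ _ => rfl) ?_)
    fun s _ => ?_
  · rintro ⟨s, p⟩ ⟨t, ht, rfl⟩
    have ht0 : ∀ m, 0 ≤ t m := fun m => (ht m).1
    have hinv := analyticAt_one_add_sum_inv ht0 s
    refine (analyticAt_const.mul (hinv.pow _)).mul (AnalyticAt.mul ?_
      (analyticAt_comp_simplexChart hE ht0 s))
    refine (hinv.pow k).cpow analyticAt_fst ?_
    have : 0 < (1 + ∑ m, t m)⁻¹ ^ k := pow_pos (inv_pos.2 (one_add_sum_pos ht0)) k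
    simpa using ofReal_mem_slitPlane.2 this
  · by_contra! h
    have h1 : (fun _ => 1 : Fin n → ℝ) ∈ unitCube (Fin n) := mem_unitCube.2 fun _ => by simp
    have hmem : simplexChart B i (fun _ => 1) ∈ interior (convexHull ℝ (range B)) :=
      ((simplexChart_image B i).subset (mem_image_of_mem _ h1)).1
    have hpos := hf j _ hmem
    rw [AffineMap.apply_simplexChart _ _ _ (one_add_sum_pos (unitCube_nonneg h1)).ne', h0,
      Finset.sum_eq_zero fun m _ => mul_eq_zero_of_left (le_antisymm (h m) (hv j _)) _] at hpos
    simp at hpos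
  · simpa using Finset.card_le_univ (Finset.univ.filter fun j => f j (B i) = 0)
  · rw [hC]
    refine setIntegral_congr_fun measurableSet_unitCube fun t ht => ?_
    have h0 := one_add_sum_pos (unitCube_nonneg ht)
    have hprod : ∏ j, f j (simplexChart B i t) = (1 + ∑ m, t m)⁻¹ ^ k *
        formsProd 0 Finset.univ (fun j => f j (B i)) (fun j m => f j (B (i.succAbove m))) t := by
      simp only [AffineMap.apply_simplexChart _ _ _ h0.ne', Finset.prod_mul_distrib, formsProd]
      simp
    have hnn : 0 ≤ formsProd 0 Finset.univ (fun j => f j (B i))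
        (fun j m => f j (B (i.succAbove m))) t :=
      mul_nonneg (by simp) (Finset.prod_nonneg fun j _ => add_nonneg (hv j i)
        (Finset.sum_nonneg fun m _ => mul_nonneg (hv j _) (unitCube_nonneg ht m)))
    simp only [hprod, ofReal_simplexChart]
    rw [ofReal_mul, mul_cpow_ofReal_nonneg (by positivity) hnn]
    push_cast
    ring

theorem hasContinuation_simplex (R : ℝ) {k : ℕ} {f : Fin k → (Fin n → ℝ) →ᵃ[ℝ] ℝ}
    (hf : ∀ j, ∀ x ∈ interior (convexHull ℝ (range B)), 0 < f j x) {E : ℂ × (Fin n → ℂ) → ℂ}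
    (hE : ∀ (s : ℂ) (x : Fin n → ℝ), x ∈ convexHull ℝ (range B) →
      AnalyticAt ℂ E (s, fun l => (x l : ℂ))) :
    HasContinuation R (fun _ => k) fun s => ∫ x in convexHull ℝ (range B),
      (↑(∏ j, f j x) : ℂ) ^ s * E (s, fun l => (x l : ℂ)) := by
  have hV : Convex ℝ (convexHull ℝ (range B)) := convex_convexHull ℝ _
  have hK : IsCompact (convexHull ℝ (range B)) := (finite_range B).isCompact_convexHull ℝ
  have hfc (j : Fin k) : Continuous (f j) := (f j).continuous_of_finiteDimensional
  have hne : (interior (convexHull ℝ (range B))).Nonempty :=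
    interior_convexHull_nonempty_iff_affineSpan_eq_top.2 B.tot
  have hf0 : ∀ j x, x ∈ convexHull ℝ (range B) → 0 ≤ f j x := fun j x hx => by
    have hx' : x ∈ closure (interior (convexHull ℝ (range B))) := by
      rw [hV.closure_interior_eq_closure_of_nonempty_interior hne]
      exact subset_closure hx
    exact closure_minimal (fun y hy => (hf j y hy).le) (isClosed_le continuous_const (hfc j)) hx'
  have hae : (interior (convexHull ℝ (range B)) : Set (Fin n → ℝ)) =ᵐ[volume]
      convexHull ℝ (range B) :=
    interior_ae_eq_of_null_frontier (hV.addHaar_frontier volume)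
  refine HasContinuation.congr (HasContinuation.sum Finset.univ fun i _ =>
    hasContinuation_simplexChart (i := i) R hf0 hf hE) fun s hs => ?_
  have hint : IntegrableOn (fun x : Fin n → ℝ =>
      (↑(∏ j, f j x) : ℂ) ^ s * E (s, fun l => (x l : ℂ))) (convexHull ℝ (range B)) := by
    refine ContinuousOn.integrableOn_compact hK (ContinuousOn.mul ?_ fun x hx => ?_)
    · exact ((continuous_ofReal_cpow_const hs).comp
        (continuous_finsetProd _ fun j _ => hfc j)).continuousOn
    · exact (ContinuousAt.comp (g := E) (f := fun x : Fin n → ℝ => (s, fun l => (x l : ℂ)))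
        (hE s x hx).continuousAt
        (Continuous.continuousAt (by fun_prop))).continuousWithinAt
  rw [← setIntegral_congr_set hae, setIntegral_eq_sum_argmax isOpen_interior.measurableSet
    Finset.univ_nonempty (c := fun i => B.coord i) (fun i => ?_) (fun i j hij => ?_)
    (hint.mono_set interior_subset)]
  · simp only [simplexChart_image]
  · exact (B.coord i).continuous_of_finiteDimensional.measurable
  · have := volume_affine_zero_set volume (B.coord i - B.coord j) (x₀ := B i)
      (by simp [hij.symm])
    simpa [sub_eq_zero] using this

end Simplex

/-- The meromorphic continuation of `∫_V (f₁⋯f_k)^s E(s,x) dx` has a pole of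
order at most `k` (the number of affine factors) at every point of `ℂ`. -/
theorem stmt_1 (n k : ℕ) (hn : 1 ≤ n)
    (V : Set (Fin n → ℝ)) (v : Fin (n + 1) → (Fin n → ℝ))
    (hv : AffineIndependent ℝ v) (hV : V = convexHull ℝ (Set.range v))
    (f : Fin k → (Fin n → ℝ) → ℝ)
    (hf_aff : ∀ j, ∃ (a : Fin n → ℝ) (c : ℝ), f j = fun x => c + ∑ i, a i * x i)
    (hf_pos : ∀ j, ∀ x ∈ interior V, 0 < f j x)
    (E : ℂ × (Fin n → ℂ) → ℂ)
    (U : Set (ℂ × (Fin n → ℂ))) (hU : IsOpen U)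
    (hUV : ∀ (s : ℂ) (x : Fin n → ℝ), x ∈ V → (s, fun i => (x i : ℂ)) ∈ U)
    (hE : AnalyticOnNhd ℂ E U) :
    ∃ F : ℂ → ℂ,
      (∀ z : ℂ, MeromorphicAt F z) ∧
      (∀ s : ℂ, 0 < s.re →
        F s = ∫ x in V, (↑(∏ j, f j x) : ℂ) ^ s * E (s, fun i => (x i : ℂ))) ∧
      (∀ s₀ : ℂ, ∃ C : ℝ, ∀ᶠ s in nhdsWithin s₀ {s₀}ᶜ, ‖(s - s₀) ^ k * F s‖ ≤ C) := by
  obtain ⟨B, rfl⟩ : ∃ B : AffineBasis (Fin (n + 1)) ℝ (Fin n → ℝ), B = v :=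
    ⟨⟨v, hv, hv.affineSpan_eq_top_iff_card_eq_finrank_add_one.2 (by simp)⟩, rfl⟩
  subst hV
  have hf_map : ∀ j, ∃ h : (Fin n → ℝ) →ᵃ[ℝ] ℝ, f j = h := fun j => by
    obtain ⟨a, c, h⟩ := hf_aff j
    refine ⟨AffineMap.const ℝ _ c + (∑ i, a i •
      LinearMap.proj (R := ℝ) (φ := fun _ : Fin n => ℝ) i).toAffineMap, ?_⟩
    rw [h]
    ext x
    simp
  choose h hfh using hf_map
  obtain rfl : f = fun j x => h j x := funext hfh
  exact HasContinuation.glue fun R =>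
    hasContinuation_simplex R hf_pos fun s x hx => hE _ (hUV s x hx)
end

section
/- Let θ > 0 be a real number, let A be a positive integer, let m be a nonnegative integer, and let E : ℂ × ℂ → ℂ be analytic on an open set containing ℂ × [0,θ]. Then there exists a function F : ℂ → ℂ, meromorphic on all of ℂ, such that F(s) = ∫_0^θ x^{As−1} · E(s,x) dx for every s with Re(s) > 0, and lim_{s→−m} (s+m)·F(s) = (1/A)·c_{Am}, where c_j denotes the coefficient of z^j in the Taylor expansion at z = 0 of the analytic function z ↦ E(−m, z). -/
open Complex MeasureTheory Filter intervalIntegral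

/-- An integral of functions holomorphic in a parameter and dominated by an integrable function
is differentiable in the parameter. -/
theorem differentiableAt_intervalIntegral_of_norm_le {F : ℂ → ℝ → ℂ} {a b r : ℝ} {s₀ : ℂ}
    {bound : ℝ → ℝ} (hr : 0 < r)
    (hmeas : ∀ z, AEStronglyMeasurable (F z) (volume.restrict (Set.uIoc a b)))
    (hdiff : ∀ x ∈ Set.uIoc a b, DifferentiableOn ℂ (fun z => F z x) (Metric.ball s₀ r))
    (hbound : ∀ x ∈ Set.uIoc a b, ∀ z ∈ Metric.ball s₀ r, ‖F z x‖ ≤ bound x)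
    (hint : IntervalIntegrable bound volume a b) :
    DifferentiableAt ℂ (fun z => ∫ x in a..b, F z x) s₀ := by
  have hs₀ : s₀ ∈ Metric.ball s₀ r := Metric.mem_ball_self hr
  have hderiv : ∀ x ∈ Set.uIoc a b, ∀ z ∈ Metric.ball s₀ r,
      HasDerivAt (fun z => F z x) (deriv (fun z => F z x) z) z := fun x hx z hz =>
    ((hdiff x hx).differentiableAt (Metric.isOpen_ball.mem_nhds hz)).hasDerivAt
  refine (intervalIntegral.hasDerivAt_integral_of_dominated_loc_of_deriv_le (μ := volume)
    (F := F) (F' := fun z x => deriv (fun z => F z x) z) (bound := fun x => bound x / (r / 4))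
    (Metric.ball_mem_nhds s₀ (half_pos hr)) (Eventually.of_forall hmeas) ?_ ?_ ?_
    (hint.div_const _) ?_).2.differentiableAt
  · refine hint.mono_fun (hmeas s₀) ?_
    filter_upwards [ae_restrict_mem measurableSet_uIoc] with x hx
    exact (hbound x hx s₀ hs₀).trans (le_abs_self _)
  · refine aestronglyMeasurable_of_tendsto_ae (nhdsWithin (0 : ℂ) {0}ᶜ)
      (f := fun t x => t⁻¹ • (F (s₀ + t) x - F s₀ x))
      (fun t => ((hmeas (s₀ + t)).sub (hmeas s₀)).const_smul t⁻¹) ?_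
    filter_upwards [ae_restrict_mem measurableSet_uIoc] with x hx
    exact (hderiv x hx s₀ hs₀).tendsto_slope_zero
  · refine Eventually.of_forall fun x hx z hz => ?_
    have hsub : Metric.closedBall z (r / 4) ⊆ Metric.ball s₀ r := by
      refine Metric.closedBall_subset_ball' ?_
      have := Metric.mem_ball.1 hz
      linarith
    refine Complex.norm_deriv_le_of_forall_mem_sphere_norm_le (by positivity) ?_
      fun y hy => hbound x hx y (hsub (Metric.sphere_subset_closedBall hy))
    refine DifferentiableOn.diffContOnCl ((hdiff x hx).mono ?_)
    exact Metric.closure_ball_subset_closedBall.trans hsub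
  · exact Eventually.of_forall fun x hx z hz =>
      hderiv x hx z (Metric.ball_subset_ball (by linarith) hz)

/-- The partial derivative in the second variable. -/
noncomputable def partialSnd (G : ℂ × ℂ → ℂ) (p : ℂ × ℂ) : ℂ :=
  deriv (fun z => G (p.1, z)) p.2

theorem AnalyticAt.hasDerivAt_snd {G : ℂ × ℂ → ℂ} {p : ℂ × ℂ} (hG : AnalyticAt ℂ G p) :
    HasDerivAt (fun z => G (p.1, z)) (fderiv ℂ G p (0, 1)) p.2 :=
  HasFDerivAt.comp_hasDerivAt (l := G) (f := fun z => (p.1, z)) p.2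
    hG.differentiableAt.hasFDerivAt ((hasDerivAt_const p.2 p.1).prodMk (hasDerivAt_id p.2))

theorem AnalyticOnNhd.partialSnd {G : ℂ × ℂ → ℂ} {U : Set (ℂ × ℂ)} (hU : IsOpen U)
    (hG : AnalyticOnNhd ℂ G U) : AnalyticOnNhd ℂ (partialSnd G) U := by
  have h : AnalyticOnNhd ℂ (fun p => fderiv ℂ G p (0, 1)) U := fun p hp =>
    ((ContinuousLinearMap.apply ℂ ℂ ((0, 1) : ℂ × ℂ)).analyticAt _).comp (hG.fderiv p hp)
  exact h.congr hU fun p hp => ((hG p hp).hasDerivAt_snd.deriv).symm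

theorem AnalyticAt.hasDerivAt_partialSnd {G : ℂ × ℂ → ℂ} {s : ℂ} {x : ℝ}
    (hG : AnalyticAt ℂ G (s, (x : ℂ))) :
    HasDerivAt (fun y : ℝ => G (s, (y : ℂ))) (partialSnd G (s, (x : ℂ))) x := by
  have h := hG.hasDerivAt_snd.differentiableAt.hasDerivAt
  exact h.comp_ofReal

/-- The Mellin-type integral `∫_0^θ x^{As+k-1} G(s,x) dx`. -/
noncomputable def mellinInterval (θ : ℝ) (A k : ℕ) (G : ℂ × ℂ → ℂ) (s : ℂ) : ℂ :=
  ∫ x in (0 : ℝ)..θ, (x : ℂ) ^ ((A : ℂ) * s + k - 1) * G (s, (x : ℂ))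

/-- The continuation of `mellinInterval` obtained from `n` integrations by parts. -/
noncomputable def mellinContinuation (θ : ℝ) (A : ℕ) :
    ℕ → ℕ → (ℂ × ℂ → ℂ) → ℂ → ℂ
  | 0, k, G, s => mellinInterval θ A k G s
  | n + 1, k, G, s => ((θ : ℂ) ^ ((A : ℂ) * s + k) * G (s, (θ : ℂ)) -
      mellinContinuation θ A n (k + 1) (partialSnd G) s) / ((A : ℂ) * s + k)

section

variable {θ : ℝ} {A : ℕ} {U : Set (ℂ × ℂ)} {G : ℂ × ℂ → ℂ}

theorem continuousOn_slice
    (hUV : ∀ (s : ℂ) (x : ℝ), x ∈ Set.Icc (0 : ℝ) θ → (s, (x : ℂ)) ∈ U)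
    (hG : AnalyticOnNhd ℂ G U) (s : ℂ) :
    ContinuousOn (fun x : ℝ => G (s, (x : ℂ))) (Set.Icc 0 θ) :=
  hG.continuousOn.comp (by fun_prop) fun x hx => hUV s x hx

theorem differentiableAt_mellinInterval (hθ : 0 < θ)
    (hUV : ∀ (s : ℂ) (x : ℝ), x ∈ Set.Icc (0 : ℝ) θ → (s, (x : ℂ)) ∈ U)
    (hG : AnalyticOnNhd ℂ G U) {k : ℕ} {s₀ : ℂ} (hs : 0 < A * s₀.re + k) :
    DifferentiableAt ℂ (mellinInterval θ A k G) s₀ := by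
  obtain ⟨δ, hδ, hδs⟩ : ∃ δ : ℝ, 0 < δ ∧ A * s₀.re + k = 2 * δ :=
    ⟨(A * s₀.re + k) / 2, by linarith, by ring⟩
  have hA : (0 : ℝ) ≤ A := A.cast_nonneg
  obtain ⟨r, hr, hrA⟩ : ∃ r : ℝ, 0 < r ∧ A * r ≤ δ := by
    refine ⟨δ / (A + 1), by positivity, ?_⟩
    rw [mul_div_assoc', div_le_iff₀ (by positivity)]
    nlinarith
  obtain ⟨C, hC⟩ : ∃ C, ∀ p ∈ Metric.closedBall s₀ r ×ˢ ((↑) '' Set.Icc (0 : ℝ) θ : Set ℂ),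
      ‖G p‖ ≤ C := by
    refine ((isCompact_closedBall s₀ r).prod
      (isCompact_Icc.image Complex.continuous_ofReal)).exists_bound_of_continuousOn ?_
    refine hG.continuousOn.mono ?_
    rintro ⟨s, _⟩ ⟨-, x, hx, rfl⟩
    exact hUV s x hx
  have hmem : ∀ x ∈ Set.uIoc 0 θ, 0 < x ∧ x ∈ Set.Icc 0 θ := fun x hx => by
    rw [Set.uIoc_of_le hθ.le] at hx
    exact ⟨hx.1, hx.1.le, hx.2⟩
  refine differentiableAt_intervalIntegral_of_norm_le hr
    (bound := fun x => (x ^ (δ - 1) + x ^ (3 * δ - 1)) * C) ?_ ?_ ?_ ?_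
  · refine fun z => ContinuousOn.aestronglyMeasurable ?_ measurableSet_uIoc
    refine ContinuousOn.mul (fun x hx => ?_)
      ((continuousOn_slice hUV hG z).mono fun x hx => (hmem x hx).2)
    exact (Complex.continuousAt_ofReal_cpow_const x _
      (Or.inr (hmem x hx).1.ne')).continuousWithinAt
  · intro x hx z _
    have hx0 : (x : ℂ) ≠ 0 := by exact_mod_cast (hmem x hx).1.ne'
    have h1 : DifferentiableAt ℂ (fun z => G (z, (x : ℂ))) z :=
      ((hG _ (hUV z x (hmem x hx).2)).differentiableAt).comp (f := fun z => (z, (x : ℂ))) z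
        (by fun_prop)
    have h2 : DifferentiableAt ℂ (fun z : ℂ => (x : ℂ) ^ ((A : ℂ) * z + k - 1)) z :=
      DifferentiableAt.const_cpow (by fun_prop) (Or.inl hx0)
    exact (h2.mul h1).differentiableWithinAt
  · intro x hx z hz
    obtain ⟨hx0, hxI⟩ := hmem x hx
    have hre : |z.re - s₀.re| < r := by
      have h := (Complex.abs_re_le_norm (z - s₀)).trans_lt (mem_ball_iff_norm.1 hz)
      simpa using h
    have hre' := abs_lt.1 hre
    have hexp : ((A : ℂ) * z + k - 1).re = A * z.re + k - 1 := by simp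
    rw [norm_mul, Complex.norm_cpow_eq_rpow_re_of_pos hx0, hexp]
    refine mul_le_mul ?_ (hC _ ⟨Metric.ball_subset_closedBall hz, x, hxI, rfl⟩) (norm_nonneg _)
      (by positivity)
    have hp1 := Real.rpow_nonneg hx0.le (δ - 1)
    have hp2 := Real.rpow_nonneg hx0.le (3 * δ - 1)
    rcases le_total x 1 with h | h
    · have := Real.rpow_le_rpow_of_exponent_ge hx0 h
        (show δ - 1 ≤ A * z.re + k - 1 by nlinarith)
      linarith
    · have := Real.rpow_le_rpow_of_exponent_le h
        (show A * z.re + k - 1 ≤ 3 * δ - 1 by nlinarith)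
      linarith
  · exact ((intervalIntegrable_rpow' (by linarith)).add
      (intervalIntegrable_rpow' (by linarith))).mul_const C

theorem mellinInterval_eq_integration_by_parts (hθ : 0 < θ) (hU : IsOpen U)
    (hUV : ∀ (s : ℂ) (x : ℝ), x ∈ Set.Icc (0 : ℝ) θ → (s, (x : ℂ)) ∈ U)
    (hG : AnalyticOnNhd ℂ G U) {k : ℕ} {s : ℂ} (hs : 0 < A * s.re + k) :
    mellinInterval θ A k G s = mellinContinuation θ A 1 k G s := by
  set w : ℂ := (A : ℂ) * s + k with hw
  have hwre : 0 < w.re := by simpa [hw] using hs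
  have hw0 : w ≠ 0 := fun h => by simp [h] at hwre
  have hIcc : Set.uIcc 0 θ = Set.Icc 0 θ := Set.uIcc_of_le hθ.le
  have key := integral_mul_deriv_eq_deriv_mul_of_hasDerivAt (a := 0) (b := θ)
    (u := fun x : ℝ => G (s, (x : ℂ))) (u' := fun x : ℝ => partialSnd G (s, (x : ℂ)))
    (v := fun x : ℝ => (x : ℂ) ^ w / w) (v' := fun x : ℝ => (x : ℂ) ^ (w - 1))
    (hIcc ▸ continuousOn_slice hUV hG s)
    ((Complex.continuous_ofReal_cpow_const hwre).div_const w).continuousOn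
    (fun x hx => by
      rw [min_eq_left hθ.le, max_eq_right hθ.le] at hx
      exact (hG _ (hUV s x (Set.Ioo_subset_Icc_self hx))).hasDerivAt_partialSnd)
    (fun x hx => by
      rw [min_eq_left hθ.le, max_eq_right hθ.le] at hx
      have h := hasDerivAt_ofReal_cpow_const' (x := x) hx.1.ne' (r := w - 1)
        (fun h => hw0 (by linear_combination h))
      simpa using h)
    ((hIcc ▸ continuousOn_slice hUV (hG.partialSnd hU) s).intervalIntegrable)
    (intervalIntegrable_cpow' (by simpa using hwre))
  have hJ : mellinInterval θ A (k + 1) (partialSnd G) s =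
      w * ∫ x in (0 : ℝ)..θ, partialSnd G (s, (x : ℂ)) * ((x : ℂ) ^ w / w) := by
    rw [mellinInterval, ← intervalIntegral.integral_const_mul]
    refine intervalIntegral.integral_congr fun x _ => ?_
    have : (A : ℂ) * s + ((k + 1 : ℕ) : ℂ) - 1 = w := by push_cast; rw [hw]; ring
    simp only [this]
    field_simp
  have hL : mellinInterval θ A k G s =
      ∫ x in (0 : ℝ)..θ, G (s, (x : ℂ)) * (x : ℂ) ^ (w - 1) :=
    intervalIntegral.integral_congr fun x _ => mul_comm _ _
  simp only [mellinContinuation]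
  rw [hL, key, hJ, ← hw, Complex.ofReal_zero, Complex.zero_cpow hw0]
  field_simp
  ring

theorem mellinContinuation_succ (hθ : 0 < θ) (hU : IsOpen U)
    (hUV : ∀ (s : ℂ) (x : ℝ), x ∈ Set.Icc (0 : ℝ) θ → (s, (x : ℂ)) ∈ U) {s : ℂ} (n : ℕ) :
    ∀ {k : ℕ} {G : ℂ × ℂ → ℂ}, AnalyticOnNhd ℂ G U → 0 < A * s.re + k + n →
      mellinContinuation θ A (n + 1) k G s = mellinContinuation θ A n k G s := by
  induction n with
  | zero =>
    intro k G hG hs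
    exact (mellinInterval_eq_integration_by_parts hθ hU hUV hG (by simpa using hs)).symm
  | succ n ih =>
    intro k G hG hs
    rw [mellinContinuation, ih (hG.partialSnd hU) (by push_cast at hs ⊢; linarith)]
    rfl

theorem mellinContinuation_eq_of_le (hθ : 0 < θ) (hU : IsOpen U)
    (hUV : ∀ (s : ℂ) (x : ℝ), x ∈ Set.Icc (0 : ℝ) θ → (s, (x : ℂ)) ∈ U)
    (hG : AnalyticOnNhd ℂ G U) {s : ℂ} {k n n' : ℕ} (hn : n ≤ n') (hs : 0 < A * s.re + k + n) :
    mellinContinuation θ A n' k G s = mellinContinuation θ A n k G s := by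
  induction n', hn using Nat.le_induction with
  | base => rfl
  | succ j hj ih =>
    have : (n : ℝ) ≤ j := by exact_mod_cast hj
    rw [mellinContinuation_succ hθ hU hUV j hG (by linarith), ih]

theorem analyticAt_mellinInterval (hθ : 0 < θ)
    (hUV : ∀ (s : ℂ) (x : ℝ), x ∈ Set.Icc (0 : ℝ) θ → (s, (x : ℂ)) ∈ U)
    (hG : AnalyticOnNhd ℂ G U) {k : ℕ} {s₀ : ℂ} (hs : 0 < A * s₀.re + k) :
    AnalyticAt ℂ (mellinInterval θ A k G) s₀ := by
  rw [Complex.analyticAt_iff_eventually_differentiableAt]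
  have hopen : IsOpen {s : ℂ | 0 < A * s.re + k} := isOpen_lt (by fun_prop) (by fun_prop)
  filter_upwards [hopen.mem_nhds hs] with s hs
  exact differentiableAt_mellinInterval hθ hUV hG hs

theorem analyticAt_boundaryTerm (hθ : 0 < θ)
    (hUV : ∀ (s : ℂ) (x : ℝ), x ∈ Set.Icc (0 : ℝ) θ → (s, (x : ℂ)) ∈ U)
    (hG : AnalyticOnNhd ℂ G U) (k : ℕ) (s₀ : ℂ) :
    AnalyticAt ℂ (fun s => (θ : ℂ) ^ ((A : ℂ) * s + k) * G (s, (θ : ℂ))) s₀ := by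
  have hθ0 : (θ : ℂ) ∈ slitPlane := Complex.ofReal_mem_slitPlane.2 hθ
  have h1 : AnalyticAt ℂ (fun s => G (s, (θ : ℂ))) s₀ :=
    (hG (s₀, (θ : ℂ)) (hUV s₀ θ ⟨hθ.le, le_rfl⟩)).comp (f := fun s => (s, (θ : ℂ)))
      (by fun_prop)
  exact (analyticAt_const.cpow (by fun_prop) hθ0).mul h1

theorem meromorphicAt_mellinContinuation (hθ : 0 < θ) (hU : IsOpen U)
    (hUV : ∀ (s : ℂ) (x : ℝ), x ∈ Set.Icc (0 : ℝ) θ → (s, (x : ℂ)) ∈ U) {s₀ : ℂ} (n : ℕ) :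
    ∀ {k : ℕ} {G : ℂ × ℂ → ℂ}, AnalyticOnNhd ℂ G U → 0 < A * s₀.re + k + n →
      MeromorphicAt (mellinContinuation θ A n k G) s₀ := by
  induction n with
  | zero =>
    intro k G hG hs
    exact (analyticAt_mellinInterval hθ hUV hG (by simpa using hs)).meromorphicAt
  | succ n ih =>
    intro k G hG hs
    have hden : AnalyticAt ℂ (fun s : ℂ => (A : ℂ) * s + k) s₀ := by fun_prop
    exact ((analyticAt_boundaryTerm hθ hUV hG k s₀).meromorphicAt.sub
      (ih (hG.partialSnd hU) (by push_cast at hs ⊢; linarith))).div hden.meromorphicAt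

theorem tendsto_mul_mellinContinuation (hθ : 0 < θ) (hA : 0 < A) (hU : IsOpen U)
    (hUV : ∀ (s : ℂ) (x : ℝ), x ∈ Set.Icc (0 : ℝ) θ → (s, (x : ℂ)) ∈ U) {m : ℕ} (n : ℕ) :
    ∀ {k : ℕ} {G : ℂ × ℂ → ℂ}, AnalyticOnNhd ℂ G U → k + n = A * m →
      Tendsto (fun s => (s + (m : ℂ)) * mellinContinuation θ A (n + 1) k G s)
        (nhdsWithin (-(m : ℂ)) {-(m : ℂ)}ᶜ)
        (nhds ((1 / (A : ℂ)) *
          (iteratedDeriv n (fun z => G (-(m : ℂ), z)) 0 / (Nat.factorial n : ℂ)))) := by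
  have hA0 : (A : ℂ) ≠ 0 := by exact_mod_cast hA.ne'
  induction n with
  | zero =>
    intro k G hG hk
    have hkC : (k : ℂ) = A * m := by exact_mod_cast hk
    have hkR : (k : ℝ) = A * m := by exact_mod_cast hk
    have hJ : mellinInterval θ A (k + 1) (partialSnd G) (-(m : ℂ)) =
        G (-(m : ℂ), (θ : ℂ)) - G (-(m : ℂ), 0) := by
      have hexp : (A : ℂ) * -(m : ℂ) + ((k + 1 : ℕ) : ℂ) - 1 = 0 := by
        push_cast; rw [hkC]; ring
      rw [mellinInterval, hexp]
      simp only [Complex.cpow_zero, one_mul]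
      have hIcc : Set.uIcc 0 θ = Set.Icc 0 θ := Set.uIcc_of_le hθ.le
      rw [integral_eq_sub_of_hasDerivAt (f := fun x : ℝ => G (-(m : ℂ), (x : ℂ)))
        (fun x hx => (hG _ (hUV _ x (hIcc ▸ hx))).hasDerivAt_partialSnd)
        ((hIcc ▸ continuousOn_slice hUV (hG.partialSnd hU) _).intervalIntegrable)]
      simp
    have hcont : ContinuousAt (fun s => ((θ : ℂ) ^ ((A : ℂ) * s + k) * G (s, (θ : ℂ)) -
        mellinInterval θ A (k + 1) (partialSnd G) s) / A) (-(m : ℂ)) :=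
      (((analyticAt_boundaryTerm hθ hUV hG k _).sub (analyticAt_mellinInterval hθ hUV
        (hG.partialSnd hU) (by simp [hkR]))).continuousAt).div_const _
    have hlim := hcont.tendsto.mono_left (nhdsWithin_le_nhds (s := {-(m : ℂ)}ᶜ))
    have hval : (A : ℂ) * -(m : ℂ) + k = 0 := by rw [hkC]; ring
    rw [hJ, hval, Complex.cpow_zero] at hlim
    have hval' : (1 * G (-(m : ℂ), (θ : ℂ)) - (G (-(m : ℂ), (θ : ℂ)) - G (-(m : ℂ), 0))) / A =
        (1 / (A : ℂ)) * (iteratedDeriv 0 (fun z => G (-(m : ℂ), z)) 0 /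
          (Nat.factorial 0 : ℂ)) := by
      simp [div_eq_inv_mul]
    rw [hval'] at hlim
    refine hlim.congr' ?_
    filter_upwards [self_mem_nhdsWithin] with s hs
    have hs0 : s + m ≠ 0 := fun h => hs (eq_neg_of_add_eq_zero_left h)
    have hden : (A : ℂ) * s + k = A * (s + m) := by rw [hkC]; ring
    simp only [mellinContinuation]
    generalize hB : (θ : ℂ) ^ ((A : ℂ) * s + k) * G (s, (θ : ℂ)) -
      mellinInterval θ A (k + 1) (partialSnd G) s = B
    rw [hden]
    field_simp
  | succ n ih =>
    intro k G hG hk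
    have hkC : (k : ℂ) + (n + 1) = A * m := by exact_mod_cast hk
    have hrec := ih (k := k + 1) (hG.partialSnd hU) (by omega)
    have hB : Tendsto (fun s => (s + (m : ℂ)) * ((θ : ℂ) ^ ((A : ℂ) * s + k) * G (s, (θ : ℂ))))
        (nhdsWithin (-(m : ℂ)) {-(m : ℂ)}ᶜ) (nhds 0) := by
      have h1 : ContinuousAt (fun s : ℂ => s + (m : ℂ)) (-(m : ℂ)) := by fun_prop
      have h := ((h1.mul (analyticAt_boundaryTerm (A := A) hθ hUV hG k _).continuousAt).tendsto)
      simp only [Pi.mul_def, neg_add_cancel, zero_mul] at h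
      exact h.mono_left nhdsWithin_le_nhds
    have hn0 : (n : ℂ) + 1 ≠ 0 := by exact_mod_cast n.succ_ne_zero
    have hden : Tendsto (fun s : ℂ => (A : ℂ) * s + k)
        (nhdsWithin (-(m : ℂ)) {-(m : ℂ)}ᶜ) (nhds (-((n : ℂ) + 1))) := by
      have h1 : ContinuousAt (fun s : ℂ => (A : ℂ) * s + k) (-(m : ℂ)) := by fun_prop
      have hval : (A : ℂ) * -(m : ℂ) + k = -((n : ℂ) + 1) := by linear_combination hkC
      have h := h1.tendsto
      rw [hval] at h
      exact h.mono_left nhdsWithin_le_nhds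
    have hlim := (hB.sub hrec).div hden (neg_ne_zero.2 hn0)
    have hiter : iteratedDeriv (n + 1) (fun z => G (-(m : ℂ), z)) 0 =
        iteratedDeriv n (fun z => partialSnd G (-(m : ℂ), z)) 0 := by
      rw [iteratedDeriv_succ']
      rfl
    have hfac : (Nat.factorial n : ℂ) ≠ 0 := by exact_mod_cast n.factorial_ne_zero
    convert hlim using 1
    · funext s
      rw [mellinContinuation]
      simp only [Pi.div_apply]
      ring
    · rw [hiter, Nat.factorial_succ]
      push_cast
      congr 1
      field_simp
      ring

end

/-- Meromorphic continuation of `∫_0^θ x^{As-1} E(s,x) dx`, with at most a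
simple pole at `s = -m` whose residue is `(1/A)` times the `(Am)`-th Taylor coefficient at `0`
of `z ↦ E(-m, z)`. -/
theorem stmt_2 (θ : ℝ) (hθ : 0 < θ) (A : ℕ) (hA : 0 < A) (m : ℕ)
    (E : ℂ × ℂ → ℂ) (U : Set (ℂ × ℂ)) (hU : IsOpen U)
    (hUV : ∀ (s : ℂ) (x : ℝ), x ∈ Set.Icc (0 : ℝ) θ → (s, (x : ℂ)) ∈ U)
    (hE : AnalyticOnNhd ℂ E U) :
    ∃ F : ℂ → ℂ,
      (∀ z : ℂ, MeromorphicAt F z) ∧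
      (∀ s : ℂ, 0 < s.re →
        F s = ∫ x in (0 : ℝ)..θ, (x : ℂ) ^ ((A : ℂ) * s - 1) * E (s, (x : ℂ))) ∧
      Tendsto (fun s => (s + (m : ℂ)) * F s) (nhdsWithin (-(m : ℂ)) {-(m : ℂ)}ᶜ)
        (nhds ((1 / (A : ℂ)) *
          (iteratedDeriv (A * m) (fun z => E (-(m : ℂ), z)) 0 / (Nat.factorial (A * m) : ℂ)))) := by
  obtain ⟨N, hN⟩ : ∃ N : ℂ → ℕ, ∀ s, 0 < A * s.re + N s :=
    ⟨fun s => ⌊-(A * s.re)⌋₊ + 1, fun s => by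
      have := Nat.lt_floor_add_one (-(A * s.re))
      push_cast
      linarith⟩
  have heq : ∀ (n : ℕ) (s : ℂ), 0 < A * s.re + n →
      mellinContinuation θ A (N s) 0 E s = mellinContinuation θ A n 0 E s := by
    intro n s hs
    rcases le_total n (N s) with h | h
    · exact mellinContinuation_eq_of_le hθ hU hUV hE h (by simpa using hs)
    · exact (mellinContinuation_eq_of_le hθ hU hUV hE h (by simpa using hN s)).symm
  have hnear : ∀ (n : ℕ) (z : ℂ), 0 < A * z.re + n → ∀ᶠ s in nhds z,
      mellinContinuation θ A (N s) 0 E s = mellinContinuation θ A n 0 E s := by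
    intro n z hz
    have hopen : IsOpen {s : ℂ | 0 < A * s.re + n} := isOpen_lt (by fun_prop) (by fun_prop)
    filter_upwards [hopen.mem_nhds hz] with s hs using heq n s hs
  refine ⟨fun s => mellinContinuation θ A (N s) 0 E s, fun z => ?_, fun s hs => ?_, ?_⟩
  · refine (meromorphicAt_mellinContinuation hθ hU hUV (A := A) (k := 0) (N z) hE
      (by simpa using hN z)).congr ?_
    exact ((hnear (N z) z (hN z)).filter_mono nhdsWithin_le_nhds).mono fun s h => h.symm
  · have hA' : (0 : ℝ) < A := by exact_mod_cast hA
    have h := heq 0 s (by simpa using mul_pos hA' hs)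
    simpa [mellinContinuation, mellinInterval] using h
  · refine (tendsto_mul_mellinContinuation hθ hA hU hUV (A * m) hE (zero_add _)).congr' ?_
    filter_upwards [(hnear (A * m + 1) (-(m : ℂ)) (by simp)).filter_mono nhdsWithin_le_nhds]
      with s hs
    rw [hs]
end

section
/- Let m be a positive integer, let a ∈ ℂ with Re(a) > 0, and let x ∈ ℂ with |x| < |a|. Then Σ_{n=0}^∞ 1/(n+a+x)^{m+1} = Σ_{k=0}^∞ (−1)^k · C(m+k, k) · ( Σ_{n=0}^∞ 1/(n+a)^{m+1+k} ) · x^k, where C(a,b) denotes the binomial coefficient; all series involved converge absolutely (note that Re(a) > 0 forces |a+n| ≥ |a| > |x| for every n ≥ 0, so no term vanishes in the denominators). -/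
open Complex

lemma norm_natCast_add_ge {a : ℂ} (ha : 0 ≤ a.re) (n : ℕ) : ‖a‖ ≤ ‖(n : ℂ) + a‖ := by
  rw [← sq_le_sq₀ (norm_nonneg _) (norm_nonneg _), Complex.sq_norm, Complex.sq_norm,
    Complex.normSq_apply, Complex.normSq_apply]
  simp only [add_re, add_im, natCast_re, natCast_im, zero_add]
  nlinarith [mul_nonneg n.cast_nonneg ha, sq_nonneg (n : ℝ)]

lemma summable_norm_one_div_natCast_add_pow {a : ℂ} (ha : 0 < a.re) {s : ℕ} (hs : 1 < s) :
    Summable (fun n : ℕ => ‖1 / ((n : ℂ) + a) ^ s‖) := by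
  have h := (Real.summable_one_div_nat_add_rpow a.re s).2 (by exact_mod_cast hs)
  refine h.of_nonneg_of_le (fun n => norm_nonneg _) fun n => ?_
  have hpos : 0 < (n : ℝ) + a.re := by positivity
  have hle : (n : ℝ) + a.re ≤ ‖(n : ℂ) + a‖ := by
    simpa using Complex.re_le_norm ((n : ℂ) + a)
  rw [abs_of_pos hpos, Real.rpow_natCast, norm_div, norm_one, norm_pow]
  gcongr

/-- The binomial series of `(b + x) ^ (-(m + 1))`. -/
lemma hasSum_choose_mul_one_div_pow (m : ℕ) {b x : ℂ} (h : ‖x‖ < ‖b‖) :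
    HasSum (fun k : ℕ => (-1 : ℂ) ^ k * (Nat.choose (m + k) k : ℂ) *
      (1 / b ^ (m + 1 + k)) * x ^ k) (1 / (b + x) ^ (m + 1)) := by
  have hb : 0 < ‖b‖ := (norm_nonneg x).trans_lt h
  have hb0 : b ≠ 0 := norm_pos_iff.1 hb
  have hr : ‖-(x / b)‖ < 1 := by rwa [norm_neg, norm_div, div_lt_one hb]
  convert! (hasSum_choose_mul_geometric_of_norm_lt_one m hr).mul_left (1 / b ^ (m + 1)) using 1
  · ext k
    rw [add_comm k m, ← Nat.choose_symm_add, neg_pow (x / b), div_pow, pow_add b (m + 1) k]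
    field_simp
  · rw [one_div_mul_one_div, ← mul_pow]
    congr 2
    field_simp
    ring

/-- The double series behind the Taylor expansion converges absolutely. -/
lemma summable_choose_mul_one_div_natCast_add_pow {m : ℕ} (hm : 0 < m) {a x : ℂ}
    (ha : 0 < a.re) (hx : ‖x‖ < ‖a‖) :
    Summable (fun p : ℕ × ℕ => (-1 : ℂ) ^ p.2 * (Nat.choose (m + p.2) p.2 : ℂ) *
      (1 / ((p.1 : ℂ) + a) ^ (m + 1 + p.2)) * x ^ p.2) := by
  have hapos : 0 < ‖a‖ := (norm_nonneg x).trans_lt hx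
  have hr : ‖‖x‖ / ‖a‖‖ < 1 := by
    rwa [Real.norm_of_nonneg (by positivity), div_lt_one hapos]
  refine Summable.of_norm_bounded
    ((summable_norm_one_div_natCast_add_pow ha (Nat.lt_add_of_pos_left hm)).mul_of_nonneg
      (summable_choose_mul_geometric_of_norm_lt_one m hr)
      (fun _ => norm_nonneg _) (fun _ => by simp only [Pi.zero_apply]; positivity)) ?_
  rintro ⟨n, k⟩
  have hle := norm_natCast_add_ge ha.le n
  have hpos : 0 < ‖(n : ℂ) + a‖ := hapos.trans_le hle
  simp only [norm_mul, norm_pow, norm_neg, norm_one, one_pow, one_mul, norm_div,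
    Complex.norm_natCast]
  rw [add_comm k m, ← Nat.choose_symm_add, pow_add _ (m + 1) k]
  calc ((m + k).choose m : ℝ) * (1 / (‖(n : ℂ) + a‖ ^ (m + 1) * ‖(n : ℂ) + a‖ ^ k)) * ‖x‖ ^ k
      = 1 / ‖(n : ℂ) + a‖ ^ (m + 1) *
          ((m + k).choose m * (‖x‖ / ‖(n : ℂ) + a‖) ^ k) := by
        rw [div_pow]; field_simp
    _ ≤ 1 / ‖(n : ℂ) + a‖ ^ (m + 1) * ((m + k).choose m * (‖x‖ / ‖a‖) ^ k) := by
        gcongr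

/-- Taylor expansion of the Hurwitz zeta value `ζ(1+m, a+x)` around `x = 0`:
`Σ_{n≥0} (n+a+x)^{-(m+1)} = Σ_{k≥0} (-1)^k C(m+k,k) (Σ_{n≥0} (n+a)^{-(m+1+k)}) x^k`,
with all series involved converging (absolutely, since `ℂ` is finite-dimensional). -/
theorem stmt_3 (m : ℕ) (hm : 0 < m) (a x : ℂ) (ha : 0 < a.re) (hx : ‖x‖ < ‖a‖) :
    Summable (fun n : ℕ => 1 / ((n : ℂ) + a + x) ^ (m + 1)) ∧
    (∀ k : ℕ, Summable (fun n : ℕ => 1 / ((n : ℂ) + a) ^ (m + 1 + k))) ∧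
    Summable (fun k : ℕ => (-1 : ℂ) ^ k * (Nat.choose (m + k) k : ℂ) *
      (∑' n : ℕ, 1 / ((n : ℂ) + a) ^ (m + 1 + k)) * x ^ k) ∧
    ∑' n : ℕ, 1 / ((n : ℂ) + a + x) ^ (m + 1) =
      ∑' k : ℕ, (-1 : ℂ) ^ k * (Nat.choose (m + k) k : ℂ) *
        (∑' n : ℕ, 1 / ((n : ℂ) + a) ^ (m + 1 + k)) * x ^ k := by
  have hF := summable_choose_mul_one_div_natCast_add_pow hm ha hx
  have hrow (n : ℕ) := hasSum_choose_mul_one_div_pow m (hx.trans_le (norm_natCast_add_ge ha.le n))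
  have hcol (k : ℕ) : ∑' n : ℕ, (-1 : ℂ) ^ k * (Nat.choose (m + k) k : ℂ) *
      (1 / ((n : ℂ) + a) ^ (m + 1 + k)) * x ^ k = (-1 : ℂ) ^ k * (Nat.choose (m + k) k : ℂ) *
        (∑' n : ℕ, 1 / ((n : ℂ) + a) ^ (m + 1 + k)) * x ^ k := by
    rw [tsum_mul_right, tsum_mul_left]
  refine ⟨hF.prod.congr fun n => (hrow n).tsum_eq,
    fun k => (summable_norm_one_div_natCast_add_pow ha (by lia)).of_norm,
    hF.prod_symm.prod.congr fun k => hcol k, ?_⟩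
  simp_rw [← hcol, ← (hrow _).tsum_eq]
  exact hF.prod_symm.tsum_comm
end
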